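/- Define a_j := 1/√(4^{j+1} − 1) and b_j := √(1 + a_j²) for j ≥ 0, so that (a_j) and (b_j) are strictly decreasing, (a_j, b_j) lies on the curve η = √(1+ξ²), and b_j → 1 as j → ∞. Then the collection of intervals { −[a_{j+1},a_j) − (1, b_j) : j ≥ 0 } can be split into two subcollections whose intervals are pairwise disjoint, and consequently for every triple of exponents with 2 ≤ p₁ < ∞, 1 < p₂ < ∞, 2 ≤ p₃ < ∞ and 1/p₁ + 1/p₂ + 1/p₃ = 1, there exists a finite constant C = C(p₁,p₂) such that ‖B_{m_{a,b}}(f,g)‖_{L^{p₃'}(ℝ)} ≤ C ‖f‖_{L^{p₁}(ℝ)} ‖g‖_{L^{p₂}(ℝ)} for all Schwartz functions f, g on ℝ. -/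

import Mathlib

open MeasureTheory Set
open scoped ENNReal NNReal

noncomputable section

/-- The character `e^{2π i t x}`. -/
def eChar (t x : ℝ) : ℂ := Complex.exp (2 * Real.pi * Complex.I * t * x)

/-- The Fourier transform `f̂(ξ) = ∫ f(x) e^{-2π i ξ x} dx`. -/
def fourierT (f : ℝ → ℂ) (ξ : ℝ) : ℂ := ∫ x : ℝ, f x * eChar (-ξ) x

/-- The bilinear multiplier operator `B_m` with symbol `m`. -/
def Bm (m : ℝ → ℝ → ℂ) (f g : ℝ → ℂ) (x : ℝ) : ℂ :=
  ∫ ξ : ℝ, ∫ η : ℝ, m ξ η * fourierT f ξ * fourierT g η * eChar (ξ + η) x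

/-- Complex-valued indicator function of a set of reals. -/
def indC (s : Set ℝ) (x : ℝ) : ℂ := s.indicator 1 x

/-- The set `-A - B = {-x-y : x ∈ A, y ∈ B}`. -/
def mink2 (A B : Set ℝ) : Set ℝ := Set.image2 (fun x y => -x - y) A B

/-- The paraproduct symbol `m_{a,b}(ξ,η) = Σ_{j≥1} 1_{[a_{j+1},a_j)}(ξ) 1_{[b_j,b_0)}(η)`. -/
def mab (a b : ℕ → ℝ) (ξ η : ℝ) : ℂ :=
  ∑' j : ℕ, indC (Ico (a (j + 2)) (a (j + 1))) ξ * indC (Ico (b (j + 1)) (b 0)) η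

/-- The interval `-[a_{j+1},a_j) - [b_j, b_0)` from the collection `I_{a,b}`. -/
def Iab (a b : ℕ → ℝ) (j : ℕ) : Set ℝ := mink2 (Ico (a (j + 1)) (a j)) (Ico (b j) (b 0))

/-- The interval `-[a_{j+1},a_j) - (b_∞, b_j)` from the collection `J_{a,b}`. -/
def Jab (a b : ℕ → ℝ) (binf : ℝ) (j : ℕ) : Set ℝ :=
  mink2 (Ico (a (j + 1)) (a j)) (Ioo binf (b j))

/-- The symbol `m̃_{u,v}(ξ,η) = Σ_{j≥1} 1_{(u_0,u_j]}(ξ) 1_{[v_j,v_{j+1})}(η)`. -/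
def muv (u v : ℕ → ℝ) (ξ η : ℝ) : ℂ :=
  ∑' j : ℕ, indC (Ioc (u 0) (u (j + 1))) ξ * indC (Ico (v (j + 1)) (v (j + 2))) η

/-- The interval `-(u_0,u_j] - [v_j, v_{j+1})`. -/
def Iuv (u v : ℕ → ℝ) (j : ℕ) : Set ℝ :=
  mink2 (Ioc (u 0) (u j)) (Ico (v j) (v (j + 1)))

/-- The frequency projection `(1_S f̂)^∨`. -/
def fproj (S : Set ℝ) (f : ℝ → ℂ) (x : ℝ) : ℂ := ∫ ξ in S, fourierT f ξ * eChar ξ x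

/-- The `L^p(ℓ²)` norm of the family of frequency projections onto the sets `T i`. -/
def sqNormLp {ι : Type*} (T : ι → Set ℝ) (f : ℝ → ℂ) (p : ℝ) : ℝ≥0∞ :=
  (∫⁻ x : ℝ, (∑' i, ((‖fproj (T i) f x‖₊ : ℝ≥0∞)) ^ 2) ^ (p / 2)) ^ (1 / p)

/-- The collection of connected components of a set `U ⊆ ℝ`. -/
def componentsOf (U : Set ℝ) : Set (Set ℝ) := {S | ∃ x ∈ U, S = connectedComponentIn U x}

/-- A closed Lebesgue-null set `E ⊆ ℝ` is Littlewood–Paley if for every `1 < p < ∞` the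
square function associated with the connected components of `ℝ \ E` is comparable with the
`L^p` norm (stated on the dense class of Schwartz functions). -/
def IsLPSet (E : Set ℝ) : Prop :=
  IsClosed E ∧ volume E = 0 ∧
    ∀ p : ℝ, 1 < p → ∃ c : ℝ, 0 < c ∧ ∃ C : ℝ, 0 < C ∧
      ∀ f : SchwartzMap ℝ ℂ,
        ENNReal.ofReal c * eLpNorm (⇑f) (ENNReal.ofReal p) volume ≤
            sqNormLp (fun ω : componentsOf Eᶜ => (ω : Set ℝ)) (⇑f) p ∧
          sqNormLp (fun ω : componentsOf Eᶜ => (ω : Set ℝ)) (⇑f) p ≤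
            ENNReal.ofReal C * eLpNorm (⇑f) (ENNReal.ofReal p) volume

/-- A strictly monotone real sequence is Littlewood–Paley if the closure of its range is a
Littlewood–Paley set. -/
def IsLPSeq (a : ℕ → ℝ) : Prop := IsLPSet (closure (Set.range a))

/-- A family of (pairwise disjoint) intervals is Littlewood–Paley if for every `1 < p < ∞`
the associated square function is bounded by the `L^p` norm. -/
def IsLPFamily {ι : Type*} (T : ι → Set ℝ) : Prop :=
  ∀ p : ℝ, 1 < p → ∃ C : ℝ, 0 < C ∧ ∀ f : SchwartzMap ℝ ℂ,
    sqNormLp T (⇑f) p ≤ ENNReal.ofReal C * eLpNorm (⇑f) (ENNReal.ofReal p) volume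

/-- Slope of the `j`-th segment of the piecewise linear curve with vertices `(a_j, b_j)`. -/
def pslope (a b : ℕ → ℝ) (j : ℕ) : ℝ := (b j - b (j + 1)) / (a j - a (j + 1))

/-- The epigraph of the piecewise linear curve with vertices `(a_j, b_j)`. -/
def polyEpi (a b : ℕ → ℝ) : Set (ℝ × ℝ) :=
  ⋃ j : ℕ, {p : ℝ × ℝ | a (j + 1) ≤ p.1 ∧ p.1 ≤ a j ∧
    b (j + 1) + pslope a b j * (p.1 - a (j + 1)) ≤ p.2}

end

/-- Complex-valued indicator function of a set in the plane, as a bilinear symbol. -/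
noncomputable def indC2 (S : Set (ℝ × ℝ)) (ξ η : ℝ) : ℂ := S.indicator 1 (ξ, η)

namespace PoissonLP
open Filter Topology

/-- The Poisson kernel of the upper half-plane. -/
noncomputable def pk (x y : ℝ) : ℝ := y / (Real.pi * (x ^ 2 + y ^ 2))

/-- The horizontal derivative of the Poisson kernel. -/
noncomputable def pkx (x y : ℝ) : ℝ := -2 * x * y / (Real.pi * (x ^ 2 + y ^ 2) ^ 2)

/-- The vertical derivative of the Poisson kernel. -/
noncomputable def pky (x y : ℝ) : ℝ := (x ^ 2 - y ^ 2) / (Real.pi * (x ^ 2 + y ^ 2) ^ 2)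

/-- The second vertical derivative of the Poisson kernel. -/
noncomputable def pkyy (x y : ℝ) : ℝ :=
  (2 * y ^ 3 - 6 * x ^ 2 * y) / (Real.pi * (x ^ 2 + y ^ 2) ^ 3)

lemma sq_add_sq_pos (x : ℝ) {y : ℝ} (hy : 0 < y) : 0 < x ^ 2 + y ^ 2 := by positivity

lemma pk_pos (x : ℝ) {y : ℝ} (hy : 0 < y) : 0 < pk x y := by
  unfold pk; have := Real.pi_pos; positivity

lemma hasDerivAt_pk_x (x : ℝ) {y : ℝ} (hy : 0 < y) :
    HasDerivAt (fun x => pk x y) (pkx x y) x := by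
  have h := sq_add_sq_pos x hy
  have hp := Real.pi_pos
  have h1 : HasDerivAt (fun x : ℝ => Real.pi * (x ^ 2 + y ^ 2)) (Real.pi * (2 * x)) x := by
    simpa using ((hasDerivAt_pow 2 x).add_const (y ^ 2)).const_mul Real.pi
  refine ((hasDerivAt_const x y).div h1 (by positivity)).congr_deriv ?_
  unfold pkx; field_simp; ring

lemma hasDerivAt_pk_y (x : ℝ) {y : ℝ} (hy : 0 < y) :
    HasDerivAt (fun y => pk x y) (pky x y) y := by
  have h := sq_add_sq_pos x hy
  have hp := Real.pi_pos
  have h1 : HasDerivAt (fun y : ℝ => Real.pi * (x ^ 2 + y ^ 2)) (Real.pi * (2 * y)) y := by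
    simpa using ((hasDerivAt_pow 2 y).const_add (x ^ 2)).const_mul Real.pi
  refine ((hasDerivAt_id y).div h1 (by positivity)).congr_deriv ?_
  simp only [id]
  unfold pky; field_simp; ring

lemma hasDerivAt_pkx (x : ℝ) {y : ℝ} (hy : 0 < y) :
    HasDerivAt (fun x => pkx x y) (-pkyy x y) x := by
  have h := sq_add_sq_pos x hy
  have hp := Real.pi_pos
  have h0 : HasDerivAt (fun x : ℝ => x ^ 2 + y ^ 2) (2 * x) x := by
    simpa using (hasDerivAt_pow 2 x).add_const (y ^ 2)
  have h1 := (h0.pow 2).const_mul Real.pi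
  have h2 : HasDerivAt (fun x : ℝ => -2 * x * y) (-2 * y) x := by
    simpa using ((hasDerivAt_id x).const_mul (-2)).mul_const y
  refine (h2.div h1 (by simp only [Pi.pow_apply]; positivity)).congr_deriv ?_
  simp only [Pi.pow_apply]
  unfold pkyy; field_simp; ring

lemma hasDerivAt_pky (x : ℝ) {y : ℝ} (hy : 0 < y) :
    HasDerivAt (fun y => pky x y) (pkyy x y) y := by
  have h := sq_add_sq_pos x hy
  have hp := Real.pi_pos
  have h0 : HasDerivAt (fun y : ℝ => x ^ 2 + y ^ 2) (2 * y) y := by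
    simpa using (hasDerivAt_pow 2 y).const_add (x ^ 2)
  have h1 := (h0.pow 2).const_mul Real.pi
  have h2 : HasDerivAt (fun y : ℝ => x ^ 2 - y ^ 2) (-(2 * y)) y := by
    simpa using (hasDerivAt_pow 2 y).const_sub (x ^ 2)
  refine (h2.div h1 (by simp only [Pi.pow_apply]; positivity)).congr_deriv ?_
  simp only [Pi.pow_apply]
  unfold pkyy; field_simp; ring

lemma abs_pkx_le (x : ℝ) {y : ℝ} (hy : 0 < y) : |pkx x y| ≤ 1 / y * pk x y := by
  have h := sq_add_sq_pos x hy
  have hp := Real.pi_pos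
  have e : 1 / y * pk x y = (x ^ 2 + y ^ 2) / (Real.pi * (x ^ 2 + y ^ 2) ^ 2) := by
    unfold pk; field_simp
  rw [e, pkx, abs_div, abs_of_pos (show 0 < Real.pi * (x ^ 2 + y ^ 2) ^ 2 by positivity)]
  gcongr
  rw [abs_le]; constructor <;> nlinarith [sq_nonneg (x - y), sq_nonneg (x + y)]

lemma abs_pky_le (x : ℝ) {y : ℝ} (hy : 0 < y) : |pky x y| ≤ 1 / y * pk x y := by
  have h := sq_add_sq_pos x hy
  have hp := Real.pi_pos
  have e : 1 / y * pk x y = (x ^ 2 + y ^ 2) / (Real.pi * (x ^ 2 + y ^ 2) ^ 2) := by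
    unfold pk; field_simp
  rw [e, pky, abs_div, abs_of_pos (show 0 < Real.pi * (x ^ 2 + y ^ 2) ^ 2 by positivity)]
  gcongr
  rw [abs_le]; constructor <;> nlinarith [sq_nonneg x, sq_nonneg y]

lemma abs_pkyy_le (x : ℝ) {y : ℝ} (hy : 0 < y) : |pkyy x y| ≤ 6 / y ^ 2 * pk x y := by
  have h := sq_add_sq_pos x hy
  have hp := Real.pi_pos
  have e : 6 / y ^ 2 * pk x y =
      (6 / y * (x ^ 2 + y ^ 2) ^ 2) / (Real.pi * (x ^ 2 + y ^ 2) ^ 3) := by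
    unfold pk; field_simp
  rw [e, pkyy, abs_div, abs_of_pos (show 0 < Real.pi * (x ^ 2 + y ^ 2) ^ 3 by positivity)]
  gcongr
  have e2 : 6 / y * (x ^ 2 + y ^ 2) ^ 2 = (6 * x ^ 4) / y + 12 * x ^ 2 * y + 6 * y ^ 3 := by
    field_simp; ring
  have h1 : 0 ≤ (6 * x ^ 4) / y := by positivity
  have h2 : 0 ≤ x ^ 2 * y := by positivity
  have h3 : 0 < y ^ 3 := by positivity
  rw [e2, abs_le]; constructor <;> nlinarith

/-- A kernel on the upper half-plane dominated, locally in height, by the Poisson kernel. -/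
structure PKernel (k : ℝ → ℝ → ℝ) : Prop where
  meas : Measurable (Function.uncurry k)
  bound : ∀ x y : ℝ, 0 < y → |k x y| ≤ 6 * (1 + 1 / y ^ 2) * pk x y

lemma one_div_le_six_mul (y : ℝ) : 1 / y ≤ 6 * (1 + 1 / y ^ 2) := by
  have : 1 / y ^ 2 = (1 / y) ^ 2 := by simp
  rw [this]; nlinarith [sq_nonneg (1 / y - 1)]

lemma pKernel_pk : PKernel pk where
  meas := by unfold Function.uncurry pk; fun_prop
  bound x y hy := by
    rw [abs_of_pos (pk_pos x hy)]
    have : 0 ≤ 1 / y ^ 2 := by positivity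
    nlinarith [pk_pos x hy]

lemma pKernel_pkx : PKernel pkx where
  meas := by unfold Function.uncurry pkx; fun_prop
  bound x y hy := (abs_pkx_le x hy).trans
    (mul_le_mul_of_nonneg_right (one_div_le_six_mul y) (pk_pos x hy).le)

lemma pKernel_pky : PKernel pky where
  meas := by unfold Function.uncurry pky; fun_prop
  bound x y hy := (abs_pky_le x hy).trans
    (mul_le_mul_of_nonneg_right (one_div_le_six_mul y) (pk_pos x hy).le)

lemma pKernel_pkyy : PKernel pkyy where
  meas := by unfold Function.uncurry pkyy; fun_prop
  bound x y hy := (abs_pkyy_le x hy).trans (by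
    have := pk_pos x hy
    gcongr
    have : 6 / y ^ 2 = 6 * (1 / y ^ 2) := by ring
    rw [this]; linarith)

lemma PKernel.neg {k : ℝ → ℝ → ℝ} (hk : PKernel k) : PKernel (fun x y => -k x y) where
  meas := hk.meas.neg
  bound x y hy := by simpa using hk.bound x y hy

lemma integral_pk {y : ℝ} (hy : 0 < y) : ∫ x, pk x y = 1 := by
  have hp := Real.pi_pos
  have e : ∀ x, pk x y = (1 / (Real.pi * y)) * (1 + (x / y) ^ 2)⁻¹ := by
    intro x; unfold pk; have := sq_add_sq_pos x hy; field_simp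
    ring
  simp_rw [e]
  rw [integral_const_mul, Measure.integral_comp_div (fun x : ℝ => (1 + x ^ 2)⁻¹) y,
    integral_univ_inv_one_add_sq, abs_of_pos hy]
  simp only [smul_eq_mul]; field_simp

lemma integrable_pk {y : ℝ} (hy : 0 < y) : Integrable (fun x => pk x y) :=
  .of_integral_ne_zero (by rw [integral_pk hy]; norm_num)

lemma pk_harnack {x x0 y y0 : ℝ} (h0 : 0 < y0) (hx : |x - x0| ≤ y0 / 2) (hy1 : y0 / 2 ≤ y)
    (hy2 : y ≤ 3 * y0 / 2) : pk x y ≤ 10 * pk x0 y0 := by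
  have hy : 0 < y := by linarith
  have h := sq_add_sq_pos x hy
  have h' := sq_add_sq_pos x0 h0
  have hp := Real.pi_pos
  unfold pk
  rw [mul_div_assoc', div_le_div_iff₀ (by positivity) (by positivity)]
  have h1 : (x - x0) ^ 2 ≤ (y0 / 2) ^ 2 := by
    rw [← sq_abs]; gcongr
  have h2 : x0 ^ 2 + y0 ^ 2 ≤ 6 * (x ^ 2 + y ^ 2) := by
    nlinarith [sq_nonneg (x + (x - x0)), sq_nonneg x]
  have h3 : y * (x0 ^ 2 + y0 ^ 2) ≤ 10 * y0 * (x ^ 2 + y ^ 2) := by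
    calc y * (x0 ^ 2 + y0 ^ 2) ≤ (3 * y0 / 2) * (6 * (x ^ 2 + y ^ 2)) := by gcongr
      _ ≤ _ := by nlinarith
  nlinarith

variable {E : Type*} [NormedAddCommGroup E] [NormedSpace ℝ E]

/-- Bounded strongly measurable functions. -/
def BM (f : ℝ → E) : Prop := StronglyMeasurable f ∧ ∃ C, ∀ x, ‖f x‖ ≤ C

/-- Extension of a function to the upper half-plane by convolution with a kernel. -/
noncomputable def ext (k : ℝ → ℝ → ℝ) (f : ℝ → E) (x y : ℝ) : E := ∫ t, k (x - t) y • f t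

lemma PKernel.integrable_shift {k : ℝ → ℝ → ℝ} (hk : PKernel k) (x : ℝ) {y : ℝ} (hy : 0 < y) :
    Integrable (fun t => k (x - t) y) := by
  have h1 : Integrable (fun t => 6 * (1 + 1 / y ^ 2) * pk (x - t) y) :=
    ((integrable_pk hy).comp_sub_left x).const_mul _
  refine h1.mono' ?_ (ae_of_all _ fun t => hk.bound _ _ hy)
  exact (hk.meas.comp (by fun_prop : Measurable fun t : ℝ => (x - t, y))).aestronglyMeasurable

lemma PKernel.integrable_ext {k : ℝ → ℝ → ℝ} (hk : PKernel k) {f : ℝ → E} (hf : BM f) (x : ℝ)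
    {y : ℝ} (hy : 0 < y) : Integrable (fun t => k (x - t) y • f t) := by
  obtain ⟨hm, C, hC⟩ := hf
  exact (hk.integrable_shift x hy).smul_bdd _ hm.aestronglyMeasurable (ae_of_all _ hC)

lemma BM.norm {E : Type*} [NormedAddCommGroup E] {f : ℝ → E} (hf : BM f) : BM (fun t => ‖f t‖) :=
  ⟨hf.1.norm, by obtain ⟨C, hC⟩ := hf.2; exact ⟨C, by simpa using hC⟩⟩

lemma norm_ext_le {k : ℝ → ℝ → ℝ} {f : ℝ → E} (hf : BM f) (x : ℝ)
    {y c : ℝ} (hy : 0 < y) (hc : ∀ t, |k t y| ≤ c * pk t y) :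
    ‖ext k f x y‖ ≤ c * ext pk (fun t => ‖f t‖) x y := by
  unfold ext
  rw [← integral_const_mul]
  refine norm_integral_le_of_norm_le ((pKernel_pk.integrable_ext hf.norm x hy).const_mul c)
    (ae_of_all _ fun t => ?_)
  rw [norm_smul, Real.norm_eq_abs, smul_eq_mul, ← mul_assoc]
  gcongr
  exact hc _

lemma hasDerivAt_ext_x {k k' : ℝ → ℝ → ℝ} (hk : PKernel k) (hk' : PKernel k')
    (hd : ∀ x y, 0 < y → HasDerivAt (fun x => k x y) (k' x y) x) {f : ℝ → E} (hf : BM f)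
    (x : ℝ) {y : ℝ} (hy : 0 < y) :
    HasDerivAt (fun x => ext k f x y) (ext k' f x y) x := by
  have hI := ((pKernel_pk.integrable_ext hf.norm x hy).const_mul (6 * (1 + 1 / y ^ 2) * 10))
  refine (hasDerivAt_integral_of_dominated_loc_of_deriv_le
    (F := fun x t => k (x - t) y • f t) (F' := fun x t => k' (x - t) y • f t)
    (Metric.ball_mem_nhds x (by positivity : 0 < y / 2))
    (Eventually.of_forall fun z => (hk.integrable_ext hf z hy).1)
    (hk.integrable_ext hf x hy) (hk'.integrable_ext hf x hy).1
    (ae_of_all _ fun t z hz => ?_) hI (ae_of_all _ fun t z _ => ?_)).2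
  · rw [norm_smul, smul_eq_mul, ← mul_assoc]
    gcongr
    refine (hk'.bound _ _ hy).trans ?_
    rw [mul_assoc (6 * (1 + 1 / y ^ 2))]
    gcongr
    refine pk_harnack hy ?_ (by linarith) (by linarith)
    rw [Metric.mem_ball, Real.dist_eq] at hz
    simpa using hz.le
  · have := (hd (z - t) y hy).comp z ((hasDerivAt_id z).sub_const t)
    simp only [mul_one] at this
    exact this.smul_const (f t)

lemma hasDerivAt_ext_y {k k' : ℝ → ℝ → ℝ} (hk : PKernel k) (hk' : PKernel k')
    (hd : ∀ x y, 0 < y → HasDerivAt (fun y => k x y) (k' x y) y) {f : ℝ → E} (hf : BM f)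
    (x : ℝ) {y : ℝ} (hy : 0 < y) :
    HasDerivAt (fun y => ext k f x y) (ext k' f x y) y := by
  have hI := ((pKernel_pk.integrable_ext hf.norm x hy).const_mul (6 * (1 + 1 / (y / 2) ^ 2) * 10))
  have hpos : ∀ z ∈ Metric.ball y (y / 2), y / 2 < z ∧ z < 3 * y / 2 := by
    intro z hz
    rw [Metric.mem_ball, Real.dist_eq, abs_lt] at hz
    constructor <;> linarith [hz.1, hz.2]
  have hb : Metric.ball y (y / 2) ∈ 𝓝 y := Metric.ball_mem_nhds y (by positivity : 0 < y / 2)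
  refine (hasDerivAt_integral_of_dominated_loc_of_deriv_le
    (F := fun y t => k (x - t) y • f t) (F' := fun y t => k' (x - t) y • f t) hb
    ?_
    (hk.integrable_ext hf x hy) (hk'.integrable_ext hf x hy).1
    (ae_of_all _ fun t z hz => ?_) hI (ae_of_all _ fun t z hz => ?_)).2
  · filter_upwards [hb] with z hz
    exact (hk.integrable_ext hf x (by linarith [(hpos z hz).1])).1
  · obtain ⟨h1, h2⟩ := hpos z hz
    rw [norm_smul, smul_eq_mul, ← mul_assoc]
    gcongr
    refine (hk'.bound _ _ (by linarith)).trans ?_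
    rw [mul_assoc (6 * (1 + 1 / (y / 2) ^ 2))]
    gcongr
    · exact (pk_pos _ (by linarith)).le
    · exact pk_harnack hy (by simp; linarith) h1.le h2.le
  · exact (hd (x - t) z (by linarith [(hpos z hz).1])).smul_const (f t)

lemma stronglyMeasurable_ext {k : ℝ → ℝ → ℝ} (hk : PKernel k) {f : ℝ → E} (hf : BM f) :
    StronglyMeasurable (fun z : ℝ × ℝ => ext k f z.1 z.2) := by
  unfold ext
  have : StronglyMeasurable (fun w : (ℝ × ℝ) × ℝ => k (w.1.1 - w.2) w.1.2 • f w.2) := by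
    refine StronglyMeasurable.smul ?_ (hf.1.comp_measurable measurable_snd)
    exact (hk.meas.comp (by fun_prop : Measurable
      fun w : (ℝ × ℝ) × ℝ => (w.1.1 - w.2, w.1.2))).stronglyMeasurable
  exact this.integral_prod_right'

end PoissonLP

namespace PoissonLP
open Filter Topology

lemma rpow_le_tangent {a A γ : ℝ} (ha : 0 ≤ a) (hA : 0 < A) (h0 : 0 ≤ γ) (h1 : γ ≤ 1) :
    a ^ γ ≤ A ^ γ + γ * A ^ γ / A * (a - A) := by
  have h := rpow_one_add_le_one_add_mul_self (s := a / A - 1) (by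
    have : 0 ≤ a / A := by positivity
    linarith) h0 h1
  have e : 1 + (a / A - 1) = a / A := by ring
  rw [e, Real.div_rpow ha hA.le, div_le_iff₀ (by positivity)] at h
  refine h.trans (le_of_eq ?_)
  field_simp

lemma tangent_le_rpow {a A κ : ℝ} (ha : 0 ≤ a) (hA : 0 < A) (h1 : 1 ≤ κ) :
    A ^ κ + κ * A ^ κ / A * (a - A) ≤ a ^ κ := by
  have h := one_add_mul_self_le_rpow_one_add (s := a / A - 1) (by
    have : 0 ≤ a / A := by positivity
    linarith) h1
  have e : 1 + (a / A - 1) = a / A := by ring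
  rw [e, Real.div_rpow ha hA.le, le_div_iff₀ (by positivity)] at h
  refine (le_of_eq ?_).trans h
  field_simp

/-- A positive bounded weight whose `κ`-th power is integrable. -/
structure Weight (κ : ℝ) (w : ℝ → ℝ) : Prop where
  bm : BM w
  pos : ∀ t, 0 < w t
  int : Integrable (fun t => w t ^ κ)

lemma BM.rpow {w : ℝ → ℝ} (hw : BM w) (h0 : ∀ t, 0 ≤ w t) {γ : ℝ} (hγ : 0 ≤ γ) :
    BM (fun t => w t ^ γ) := by
  obtain ⟨hm, C, hC⟩ := hw
  refine ⟨(hm.measurable.pow_const γ).stronglyMeasurable, C ^ γ, fun x => ?_⟩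
  rw [Real.norm_eq_abs, abs_of_nonneg (by have := h0 x; positivity)]
  have := hC x
  rw [Real.norm_eq_abs, abs_of_nonneg (h0 x)] at this
  exact Real.rpow_le_rpow (h0 x) this hγ

lemma ext_pk_mono {f g : ℝ → ℝ} (hf : BM f) (hg : BM g) (h : ∀ t, f t ≤ g t) (x : ℝ) {y : ℝ}
    (hy : 0 < y) : ext pk f x y ≤ ext pk g x y := by
  refine integral_mono (pKernel_pk.integrable_ext hf x hy) (pKernel_pk.integrable_ext hg x hy) ?_
  intro t
  simp only [smul_eq_mul]
  have := (pk_pos (x - t) hy).le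
  gcongr
  exact h t

lemma ext_pk_pos {w : ℝ → ℝ} (hw : BM w) (hpos : ∀ t, 0 < w t) (x : ℝ) {y : ℝ} (hy : 0 < y) :
    0 < ext pk w x y := by
  refine (integral_pos_iff_support_of_nonneg ?_ (pKernel_pk.integrable_ext hw x hy)).2 ?_
  · intro t; exact mul_nonneg (pk_pos _ hy).le (hpos t).le
  · have : Function.support (fun t => pk (x - t) y • w t) = univ := by
      ext t; simp [(pk_pos (x - t) hy).ne', (hpos t).ne']
    rw [this]; simp

lemma integral_pk_shift (x : ℝ) {y : ℝ} (hy : 0 < y) : ∫ t, pk (x - t) y = 1 := by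
  rw [integral_sub_left_eq_self (fun t => pk t y), integral_pk hy]

lemma ext_affine {w : ℝ → ℝ} (hw : BM w) (x : ℝ) {y : ℝ} (hy : 0 < y) (a b : ℝ) :
    Integrable (fun t => pk (x - t) y * (a + b * (w t - ext pk w x y))) ∧
    ∫ t, pk (x - t) y * (a + b * (w t - ext pk w x y)) = a := by
  have h1 := pKernel_pk.integrable_shift x hy
  have h2 := pKernel_pk.integrable_ext hw x hy
  have e : (fun t => pk (x - t) y * (a + b * (w t - ext pk w x y))) =
      fun t => (a - b * ext pk w x y) * pk (x - t) y + b * (pk (x - t) y • w t) := by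
    ext t; simp only [smul_eq_mul]; ring
  rw [e]
  refine ⟨(h1.const_mul _).add (h2.const_mul _), ?_⟩
  rw [integral_add (h1.const_mul _) (h2.const_mul _), integral_const_mul, integral_const_mul,
    integral_pk_shift x hy]
  change _ + b * ext pk w x y = a
  ring

lemma ext_rpow_le {w : ℝ → ℝ} (hw : BM w) (hpos : ∀ t, 0 < w t) {γ : ℝ} (h0 : 0 ≤ γ)
    (h1 : γ ≤ 1) (x : ℝ) {y : ℝ} (hy : 0 < y) :
    ext pk (fun t => w t ^ γ) x y ≤ ext pk w x y ^ γ := by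
  have hA := ext_pk_pos hw hpos x hy
  obtain ⟨hi, he⟩ := ext_affine hw x hy (ext pk w x y ^ γ) (γ * ext pk w x y ^ γ / ext pk w x y)
  rw [← he]
  conv_lhs => rw [ext]
  refine integral_mono
    (pKernel_pk.integrable_ext (hw.rpow (fun t => (hpos t).le) h0) x hy) hi fun t => ?_
  exact mul_le_mul_of_nonneg_left (rpow_le_tangent (hpos t).le hA h0 h1) (pk_pos _ hy).le

lemma rpow_ext_le {w : ℝ → ℝ} (hw : BM w) (hpos : ∀ t, 0 < w t) {κ : ℝ}
    (h1 : 1 ≤ κ) (x : ℝ) {y : ℝ} (hy : 0 < y) :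
    ext pk w x y ^ κ ≤ ext pk (fun t => w t ^ κ) x y := by
  have hA := ext_pk_pos hw hpos x hy
  obtain ⟨hi, he⟩ := ext_affine hw x hy (ext pk w x y ^ κ) (κ * ext pk w x y ^ κ / ext pk w x y)
  rw [← he]
  conv_rhs => rw [ext]
  refine integral_mono hi
    (pKernel_pk.integrable_ext (hw.rpow (fun t => (hpos t).le) (by linarith)) x hy) fun t => ?_
  exact mul_le_mul_of_nonneg_left (tangent_le_rpow (hpos t).le hA h1) (pk_pos _ hy).le

lemma integral_ext_pk {g : ℝ → ℝ} (hg : Integrable g) {y : ℝ} (hy : 0 < y) :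
    Integrable (fun x => ext pk g x y) ∧ ∫ x, ext pk g x y = ∫ t, g t := by
  have e : (fun x => ext pk g x y) =
      convolution g (fun t => pk t y) (ContinuousLinearMap.mul ℝ ℝ) volume := by
    ext x; simp [ext, convolution_def, mul_comm]
  rw [e]
  refine ⟨hg.integrable_convolution _ (integrable_pk hy), ?_⟩
  rw [integral_convolution _ hg (integrable_pk hy), integral_pk hy]
  simp

lemma Weight.integrable_ext_rpow {w : ℝ → ℝ} {κ : ℝ} (hw : Weight κ w) (h1 : 1 ≤ κ) {y : ℝ}
    (hy : 0 < y) : Integrable (fun x => ext pk w x y ^ κ) ∧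
      ∫ x, ext pk w x y ^ κ ≤ ∫ t, w t ^ κ := by
  obtain ⟨hi, he⟩ := integral_ext_pk hw.int hy
  have hI : Integrable (fun x => ext pk w x y ^ κ) := by
    refine hi.mono' ?_ (ae_of_all _ fun x => ?_)
    · have := (stronglyMeasurable_ext pKernel_pk hw.bm).measurable.comp
        (by fun_prop : Measurable fun x : ℝ => (x, y))
      exact (this.pow_const κ).aestronglyMeasurable
    · rw [Real.norm_eq_abs, abs_of_nonneg
        (Real.rpow_nonneg (ext_pk_pos hw.bm hw.pos x hy).le _)]
      exact rpow_ext_le hw.bm hw.pos h1 x hy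
  refine ⟨hI, ?_⟩
  rw [← he]
  exact integral_mono hI hi fun x => rpow_ext_le hw.bm hw.pos h1 x hy

lemma ext_pk_harnack {w : ℝ → ℝ} (hw : BM w) (hpos : ∀ t, 0 ≤ w t) (x : ℝ) {y y0 : ℝ}
    (h0 : 0 < y0) (hy1 : y0 / 2 ≤ y) (hy2 : y ≤ 3 * y0 / 2) :
    ext pk w x y ≤ 10 * ext pk w x y0 := by
  unfold ext
  rw [← integral_const_mul]
  refine integral_mono (pKernel_pk.integrable_ext hw x (by linarith))
    ((pKernel_pk.integrable_ext hw x h0).const_mul 10) fun t => ?_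
  simp only [smul_eq_mul, ← mul_assoc]
  exact mul_le_mul_of_nonneg_right (pk_harnack h0 (by simp; linarith) hy1 hy2) (hpos t)

/-- A bounded nonnegative convex function `I` on the half-line satisfies
`∫ y I''(y) dy ≤ 3 sup I`. -/
lemma lintegral_mul_deriv2_le {I I1 I2 : ℝ → ℝ} {B : ℝ}
    (h1 : ∀ y, 0 < y → HasDerivAt I (I1 y) y) (h2 : ∀ y, 0 < y → HasDerivAt I1 (I2 y) y)
    (hpos : ∀ y, 0 < y → 0 ≤ I2 y) (h0 : ∀ y, 0 < y → 0 ≤ I y) (hB : ∀ y, 0 < y → I y ≤ B) :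
    ∫⁻ y in Ioi 0, ENNReal.ofReal (y * I2 y) ≤ ENNReal.ofReal (3 * B) := by
  have mono : MonotoneOn I1 (Ioi 0) := by
    refine monotoneOn_of_deriv_nonneg (convex_Ioi 0)
      (fun y hy => (h2 y hy).continuousAt.continuousWithinAt) ?_ ?_
    · rw [interior_Ioi]; exact fun y hy => (h2 y hy).differentiableAt.differentiableWithinAt
    · rw [interior_Ioi]; intro y hy; rw [(h2 y hy).deriv]; exact hpos y hy
  have mvt : ∀ a b, 0 < a → a < b → ∃ c ∈ Ioo a b, I b - I a = I1 c * (b - a) := by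
    intro a b ha hab
    obtain ⟨c, hc, e⟩ := exists_hasDerivAt_eq_slope I I1 hab
      (fun y hy => (h1 y (ha.trans_le hy.1)).continuousAt.continuousWithinAt)
      (fun y hy => h1 y (ha.trans hy.1))
    refine ⟨c, hc, ?_⟩
    rw [e]; field_simp [(sub_pos.2 hab).ne']
  have neg : ∀ y, 0 < y → I1 y ≤ 0 := by
    intro y hy
    by_contra! hc
    obtain ⟨c, hc1, e⟩ := mvt y (y + (B + 1) / I1 y) hy (by
      have : 0 ≤ B := (h0 y hy).trans (hB y hy)
      have : 0 < (B + 1) / I1 y := by positivity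
      linarith)
    have hB0 : 0 ≤ B := (h0 y hy).trans (hB y hy)
    have hz : 0 < (B + 1) / I1 y := by positivity
    have m := mono (mem_Ioi.2 hy) (mem_Ioi.2 (hy.trans hc1.1)) hc1.1.le
    have e2 : I1 y * ((B + 1) / I1 y) = B + 1 := by field_simp
    have : I1 y * ((B + 1) / I1 y) ≤ I1 c * ((B + 1) / I1 y) := by gcongr
    have h3 := hB (y + (B + 1) / I1 y) (by linarith)
    have h4 := h0 y hy
    have e' : I1 c * (y + (B + 1) / I1 y - y) = I1 c * ((B + 1) / I1 y) := by ring
    linarith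
  have low : ∀ y, 0 < y → -(2 * B) ≤ y * I1 y := by
    intro y hy
    obtain ⟨c, hc1, e⟩ := mvt (y / 2) y (by positivity) (by linarith)
    have m := mono (mem_Ioi.2 (by linarith [hc1.1] : 0 < c)) (mem_Ioi.2 hy) hc1.2.le
    have h3 := hB (y / 2) (by positivity)
    have h4 := h0 y hy
    have : I1 c * (y - y / 2) ≤ I1 y * (y - y / 2) := by
      apply mul_le_mul_of_nonneg_right m; linarith
    nlinarith
  have hd : ∀ y, 0 < y → HasDerivAt (fun y => y * I1 y - I y) (y * I2 y) y := by
    intro y hy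
    have := ((hasDerivAt_id y).mul (h2 y hy)).sub (h1 y hy)
    refine this.congr_deriv ?_
    simp
  have key : ∀ a b, 0 < a → a ≤ b →
      ∫⁻ y in Ioc a b, ENNReal.ofReal (y * I2 y) ≤ ENNReal.ofReal (3 * B) := by
    intro a b ha hab
    have hcont : ContinuousOn (fun y => y * I1 y - I y) (Icc a b) :=
      fun y hy => (hd y (ha.trans_le hy.1)).continuousAt.continuousWithinAt
    have hint : IntegrableOn (fun y => y * I2 y) (Ioc a b) :=
      intervalIntegral.integrableOn_deriv_of_nonneg hcont (fun y hy => hd y (ha.trans hy.1))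
        (fun y hy => mul_nonneg (ha.trans hy.1).le (hpos y (ha.trans hy.1)))
    rw [← ofReal_integral_eq_lintegral_ofReal hint]
    · apply ENNReal.ofReal_le_ofReal
      rw [← intervalIntegral.integral_of_le hab,
        intervalIntegral.integral_eq_sub_of_hasDerivAt_of_le hab hcont
          (fun y hy => hd y (ha.trans hy.1))
          ((intervalIntegrable_iff_integrableOn_Ioc_of_le hab).2 hint)]
      have hb := ha.trans_le hab
      have := low a ha
      have := mul_nonpos_of_nonneg_of_nonpos hb.le (neg b hb)
      have := h0 b hb
      have := hB a ha
      linarith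
    · filter_upwards [ae_restrict_mem measurableSet_Ioc] with y hy
      exact mul_nonneg (ha.trans hy.1).le (hpos y (ha.trans hy.1))
  have hU : Ioi (0 : ℝ) = ⋃ n : ℕ, Ioc (1 / ((n : ℝ) + 1)) (n + 1) := by
    ext y; simp only [mem_Ioi, mem_iUnion, mem_Ioc]
    constructor
    · intro hy
      obtain ⟨n, hn⟩ := exists_nat_one_div_lt hy
      obtain ⟨m, hm⟩ := exists_nat_ge y
      refine ⟨max n m, lt_of_le_of_lt ?_ hn, hm.trans ?_⟩
      · apply one_div_le_one_div_of_le (by positivity); push_cast; gcongr; exact le_max_left _ _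
      · push_cast; linarith [le_max_right (n : ℝ) (m : ℝ)]
    · rintro ⟨n, hn, -⟩; exact lt_trans (by positivity) hn
  rw [hU, setLIntegral_iUnion_of_directed]
  · refine iSup_le fun n => key _ _ (by positivity) ?_
    rw [div_le_iff₀ (by positivity)]; nlinarith [(Nat.cast_nonneg n : (0 : ℝ) ≤ n)]
  · refine directed_of_isDirected_le ?_
    intro n m hnm
    have : (n : ℝ) ≤ m := by exact_mod_cast hnm
    apply Ioc_subset_Ioc
    · apply one_div_le_one_div_of_le (by positivity); linarith
    · linarith

/-- Green's formula estimate on the upper half-plane. -/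
lemma lintegral_laplacian_le {Ψ Ψx Ψxx Ψy Ψyy e b : ℝ → ℝ → ℝ} {B : ℝ}
    (hxx : ∀ x y, 0 < y → HasDerivAt (fun x => Ψx x y) (Ψxx x y) x)
    (hy : ∀ x y, 0 < y → HasDerivAt (fun y => Ψ x y) (Ψy x y) y)
    (hyy : ∀ x y, 0 < y → HasDerivAt (fun y => Ψy x y) (Ψyy x y) y)
    (hm : ∀ y, 0 < y → Measurable (fun x => Ψ x y) ∧ Measurable (fun x => Ψx x y) ∧
      Measurable (fun x => Ψxx x y) ∧ Measurable (fun x => Ψy x y) ∧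
      Measurable (fun x => Ψyy x y))
    (hb : ∀ y, 0 < y → Integrable (fun x => b x y))
    (bd : ∀ y0, 0 < y0 → ∀ y, y0 / 2 ≤ y → y ≤ 3 * y0 / 2 → ∀ x, |Ψ x y| ≤ b x y0 ∧
      |Ψx x y| ≤ b x y0 ∧ |Ψxx x y| ≤ b x y0 ∧ |Ψy x y| ≤ b x y0 ∧ |Ψyy x y| ≤ b x y0)
    (hpos : ∀ x y, 0 < y → 0 ≤ Ψ x y) (hB : ∀ y, 0 < y → ∫ x, Ψ x y ≤ B)
    (he0 : ∀ x y, 0 < y → 0 ≤ e x y) (he : ∀ x y, 0 < y → e x y ≤ Ψxx x y + Ψyy x y) :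
    ∫⁻ y in Ioi 0, ∫⁻ x, ENNReal.ofReal (y * e x y) ≤ ENNReal.ofReal (3 * B) := by
  have bd' : ∀ y, 0 < y → ∀ x, |Ψ x y| ≤ b x y ∧
      |Ψx x y| ≤ b x y ∧ |Ψxx x y| ≤ b x y ∧ |Ψy x y| ≤ b x y ∧ |Ψyy x y| ≤ b x y :=
    fun y h => bd y h y (by linarith) (by linarith)
  have i0 : ∀ y, 0 < y → Integrable (fun x => Ψ x y) := fun y h =>
    (hb y h).mono' (hm y h).1.aestronglyMeasurable (ae_of_all _ fun x => (bd' y h x).1)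
  have ix : ∀ y, 0 < y → Integrable (fun x => Ψx x y) := fun y h =>
    (hb y h).mono' (hm y h).2.1.aestronglyMeasurable (ae_of_all _ fun x => (bd' y h x).2.1)
  have ixx : ∀ y, 0 < y → Integrable (fun x => Ψxx x y) := fun y h =>
    (hb y h).mono' (hm y h).2.2.1.aestronglyMeasurable (ae_of_all _ fun x => (bd' y h x).2.2.1)
  have iy : ∀ y, 0 < y → Integrable (fun x => Ψy x y) := fun y h =>
    (hb y h).mono' (hm y h).2.2.2.1.aestronglyMeasurable
      (ae_of_all _ fun x => (bd' y h x).2.2.2.1)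
  have iyy : ∀ y, 0 < y → Integrable (fun x => Ψyy x y) := fun y h =>
    (hb y h).mono' (hm y h).2.2.2.2.aestronglyMeasurable
      (ae_of_all _ fun x => (bd' y h x).2.2.2.2)
  have hball : ∀ y, 0 < y → Metric.ball y (y / 2) ∈ 𝓝 y := fun y h =>
    Metric.ball_mem_nhds y (by positivity)
  have hmem : ∀ y, 0 < y → ∀ z ∈ Metric.ball y (y / 2), y / 2 ≤ z ∧ z ≤ 3 * y / 2 ∧ 0 < z := by
    intro y h z hz
    rw [Metric.mem_ball, Real.dist_eq, abs_lt] at hz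
    refine ⟨?_, ?_, ?_⟩ <;> linarith [hz.1, hz.2]
  have d1 : ∀ y, 0 < y → HasDerivAt (fun y => ∫ x, Ψ x y) (∫ x, Ψy x y) y := by
    intro y h
    refine (hasDerivAt_integral_of_dominated_loc_of_deriv_le (F := fun y x => Ψ x y)
      (F' := fun y x => Ψy x y) (hball y h) ?_ (i0 y h) (iy y h).1
      (ae_of_all _ fun x z hz => ?_) (hb y h) (ae_of_all _ fun x z hz => ?_)).2
    · filter_upwards [hball y h] with z hz using (i0 z (hmem y h z hz).2.2).1
    · exact (bd y h z (hmem y h z hz).1 (hmem y h z hz).2.1 x).2.2.2.1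
    · exact hy x z (hmem y h z hz).2.2
  have d2 : ∀ y, 0 < y → HasDerivAt (fun y => ∫ x, Ψy x y) (∫ x, Ψyy x y) y := by
    intro y h
    refine (hasDerivAt_integral_of_dominated_loc_of_deriv_le (F := fun y x => Ψy x y)
      (F' := fun y x => Ψyy x y) (hball y h) ?_ (iy y h) (iyy y h).1
      (ae_of_all _ fun x z hz => ?_) (hb y h) (ae_of_all _ fun x z hz => ?_)).2
    · filter_upwards [hball y h] with z hz using (iy z (hmem y h z hz).2.2).1
    · exact (bd y h z (hmem y h z hz).1 (hmem y h z hz).2.1 x).2.2.2.2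
    · exact hyy x z (hmem y h z hz).2.2
  have zero : ∀ y, 0 < y → ∫ x, Ψxx x y = 0 := fun y h =>
    integral_eq_zero_of_hasDerivAt_of_integrable (fun x => hxx x y h) (ixx y h) (ix y h)
  have e2 : ∀ y, 0 < y → ∫ x, Ψyy x y = ∫ x, (Ψxx x y + Ψyy x y) := by
    intro y h
    rw [integral_add (ixx y h) (iyy y h), zero y h, zero_add]
  have nn : ∀ x y, 0 < y → 0 ≤ Ψxx x y + Ψyy x y := fun x y h => (he0 x y h).trans (he x y h)
  refine le_trans (setLIntegral_mono' (g := fun y => ENNReal.ofReal (y * ∫ x, Ψyy x y))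
    measurableSet_Ioi fun y h => ?_) (lintegral_mul_deriv2_le d1 d2 (fun y h => ?_)
      (fun y h => integral_nonneg fun x => hpos x y h) hB)
  · have h' : 0 < y := h
    have hI : Integrable (fun x => y * (Ψxx x y + Ψyy x y)) :=
      ((ixx y h).add (iyy y h)).const_mul y
    rw [e2 y h, ← integral_const_mul, ofReal_integral_eq_lintegral_ofReal hI
      (ae_of_all _ fun x => mul_nonneg h'.le (nn x y h))]
    refine lintegral_mono fun x => ENNReal.ofReal_le_ofReal ?_
    have := he x y h
    gcongr
  · rw [e2 y h]; exact integral_nonneg fun x => nn x y h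

end PoissonLP

namespace PoissonLP
open Filter Topology

variable {E : Type*} [NormedAddCommGroup E] [InnerProductSpace ℝ E]

/-- The function `‖u‖²W^β + M W^κ`. -/
noncomputable def bel (β κ M : ℝ) (u : E) (W : ℝ) : ℝ := ‖u‖ ^ 2 * W ^ β + M * W ^ κ

lemma bel_nonneg {E : Type*} [NormedAddCommGroup E] {β κ M W : ℝ} {u : E} (hW : 0 < W)
    (hM : 0 ≤ M) : 0 ≤ bel β κ M u W := by
  unfold bel; positivity

/-- First directional derivative of `bel` along `(u₁, W₁)`. -/
noncomputable def bel1 (β κ M : ℝ) (u u₁ : E) (W W₁ : ℝ) : ℝ :=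
  W ^ β * (2 * inner ℝ u u₁ + β * ‖u‖ ^ 2 * (W₁ / W)) + M * κ * W ^ κ * (W₁ / W)

/-- Second derivative of `bel` along a curve with velocity `(u₁, W₁)` and acceleration
`(u₂, W₂)`. -/
noncomputable def bel2 (β κ M : ℝ) (u u₁ u₂ : E) (W W₁ W₂ : ℝ) : ℝ :=
  W ^ β * (2 * ‖u₁‖ ^ 2 + 2 * inner ℝ u u₂ + 4 * β * inner ℝ u u₁ * (W₁ / W) +
    ‖u‖ ^ 2 * (β * (β - 1) * (W₁ / W) ^ 2 + β * (W₂ / W))) +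
  M * W ^ κ * (κ * (κ - 1) * (W₁ / W) ^ 2 + κ * (W₂ / W))

lemma hasDerivAt_rpow' {W : ℝ → ℝ} {W₁ s : ℝ} (β : ℝ) (hW : HasDerivAt W W₁ s) (h0 : 0 < W s) :
    HasDerivAt (fun s => W s ^ β) (β * W s ^ β * (W₁ / W s)) s := by
  convert hW.rpow_const (p := β) (Or.inl h0.ne') using 1
  rw [Real.rpow_sub_one h0.ne']; ring

lemma hasDerivAt_bel (β κ M : ℝ) {u : ℝ → E} {W : ℝ → ℝ} {u₁ : E} {W₁ s : ℝ}
    (hu : HasDerivAt u u₁ s) (hW : HasDerivAt W W₁ s) (h0 : 0 < W s) :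
    HasDerivAt (fun s => bel β κ M (u s) (W s)) (bel1 β κ M (u s) u₁ (W s) W₁) s := by
  unfold bel bel1
  refine ((hu.norm_sq.mul (hasDerivAt_rpow' β hW h0)).add
    ((hasDerivAt_rpow' κ hW h0).const_mul M)).congr_deriv ?_
  ring

lemma hasDerivAt_bel1 (β κ M : ℝ) {u u₁ : ℝ → E} {W W₁ : ℝ → ℝ} {u₂ : E} {W₂ s : ℝ}
    (hu : HasDerivAt u (u₁ s) s) (hu1 : HasDerivAt u₁ u₂ s) (hW : HasDerivAt W (W₁ s) s)
    (hW1 : HasDerivAt W₁ W₂ s) (h0 : 0 < W s) :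
    HasDerivAt (fun s => bel1 β κ M (u s) (u₁ s) (W s) (W₁ s))
      (bel2 β κ M (u s) (u₁ s) u₂ (W s) (W₁ s) W₂) s := by
  unfold bel1 bel2
  have hr := hW1.div hW h0.ne'
  refine (((hasDerivAt_rpow' β hW h0).mul (((hu.inner ℝ hu1).const_mul 2).add
    ((hu.norm_sq.const_mul β).mul hr))).add
    (((hasDerivAt_rpow' κ hW h0).const_mul (M * κ)).mul hr)).congr_deriv ?_
  simp only [Pi.div_apply, Pi.add_apply, Pi.mul_apply, real_inner_self_eq_norm_sq]
  field_simp
  ring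

section bounds

variable {β κ M γ c W W₁ W₂ : ℝ} {u u₁ u₂ : E}

lemma rpow_mul_sq (hβ : κ = β + 2 * γ) (hW : 0 < W) : W ^ β * (W ^ γ) ^ 2 = W ^ κ := by
  rw [← Real.rpow_natCast (W ^ γ), ← Real.rpow_mul hW.le, ← Real.rpow_add hW, hβ]
  congr 1; push_cast; ring

lemma bel_le {E : Type*} [NormedAddCommGroup E] {u : E} (hβ : κ = β + 2 * γ) (hW : 0 < W)
    (hu : ‖u‖ ≤ W ^ γ) :
    bel β κ M u W ≤ (1 + M) * W ^ κ := by
  unfold bel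
  have : ‖u‖ ^ 2 * W ^ β ≤ (W ^ γ) ^ 2 * W ^ β := by gcongr
  rw [mul_comm (_ ^ 2) (W ^ β), mul_comm (_ ^ 2) (W ^ β), rpow_mul_sq hβ hW] at this
  linarith

lemma abs_inner_le {G d : ℝ} (hu : ‖u‖ ≤ G) (h1 : ‖u₁‖ ≤ d * G) :
    |inner ℝ u u₁| ≤ d * G ^ 2 := by
  have hG : 0 ≤ G := (norm_nonneg _).trans hu
  calc _ ≤ ‖u‖ * ‖u₁‖ := abs_real_inner_le_norm _ _
    _ ≤ G * (d * G) := by gcongr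
    _ = _ := by ring

lemma abs_div_le_of (hW : 0 < W) (h : |W₁| ≤ c * W) : |W₁ / W| ≤ c := by
  rw [abs_div, abs_of_pos hW, div_le_iff₀ hW]; exact h

lemma abs_bel1_le (hβ : κ = β + 2 * γ) (hW : 0 < W)
    (hu : ‖u‖ ≤ W ^ γ) (hu1 : ‖u₁‖ ≤ c * W ^ γ) (hW1 : |W₁| ≤ c * W) :
    |bel1 β κ M u u₁ W W₁| ≤ (2 + |β| + |M| * |κ|) * c * W ^ κ := by
  have hr := abs_div_le_of hW hW1
  have hi := abs_inner_le hu hu1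
  have hP : 0 < W ^ β := by positivity
  unfold bel1
  set r := W₁ / W
  calc _ ≤ W ^ β * (2 * |inner ℝ u u₁| + |β| * ‖u‖ ^ 2 * |r|) + |M| * |κ| * W ^ κ * |r| := by
        refine (abs_add_le _ _).trans ?_
        rw [abs_mul, abs_of_pos hP, abs_mul, abs_mul, abs_mul,
          abs_of_pos (Real.rpow_pos_of_pos hW κ)]
        gcongr
        refine (abs_add_le _ _).trans ?_
        simp [abs_mul]
    _ ≤ W ^ β * (2 * (c * (W ^ γ) ^ 2) + |β| * (W ^ γ) ^ 2 * c) + |M| * |κ| * W ^ κ * c := by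
        gcongr
    _ = (2 + |β|) * c * (W ^ β * (W ^ γ) ^ 2) + |M| * |κ| * W ^ κ * c := by ring
    _ = _ := by rw [rpow_mul_sq hβ hW]; ring

lemma abs_bel2_le (hβ : κ = β + 2 * γ) (hW : 0 < W) (hc : 1 ≤ c)
    (hu : ‖u‖ ≤ W ^ γ) (hu1 : ‖u₁‖ ≤ c * W ^ γ) (hu2 : ‖u₂‖ ≤ c * W ^ γ)
    (hW1 : |W₁| ≤ c * W) (hW2 : |W₂| ≤ c * W) :
    |bel2 β κ M u u₁ u₂ W W₁ W₂| ≤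
      (4 + 5 * |β| + |β * (β - 1)| + |M| * (|κ * (κ - 1)| + |κ|)) * c ^ 2 * W ^ κ := by
  have hr := abs_div_le_of hW hW1
  have hr2 : |W₂ / W| ≤ c ^ 2 := (abs_div_le_of hW hW2).trans (by nlinarith)
  have hi := abs_inner_le hu hu1
  have hi2 := abs_inner_le hu hu2
  have hP : 0 < W ^ β := by positivity
  unfold bel2
  set r := W₁ / W
  set s := W₂ / W
  have hcc : c ≤ c ^ 2 := by nlinarith
  have hK : 0 < W ^ κ := by positivity
  calc _ ≤ W ^ β * (2 * ‖u₁‖ ^ 2 + 2 * |inner ℝ u u₂| + 4 * |β| * |inner ℝ u u₁| * |r| +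
        ‖u‖ ^ 2 * (|β * (β - 1)| * |r| ^ 2 + |β| * |s|)) +
        |M| * W ^ κ * (|κ * (κ - 1)| * |r| ^ 2 + |κ| * |s|) := by
        refine (abs_add_le _ _).trans ?_
        rw [abs_mul (W ^ β), abs_of_pos hP, abs_mul (M * W ^ κ), abs_mul M, abs_of_pos hK]
        gcongr
        · refine (abs_add_le _ _).trans (add_le_add ((abs_add_le _ _).trans (add_le_add
            ((abs_add_le _ _).trans (add_le_add ?_ ?_)) ?_)) ?_)
          · simp
          · simp [abs_mul]
          · simp [abs_mul]
          · rw [abs_mul, abs_of_nonneg (by positivity : 0 ≤ ‖u‖ ^ 2)]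
            gcongr
            refine (abs_add_le _ _).trans (le_of_eq ?_)
            simp [abs_mul]
        · refine (abs_add_le _ _).trans (le_of_eq ?_)
          simp [abs_mul]
    _ ≤ W ^ β * (2 * (c * W ^ γ) ^ 2 + 2 * (c ^ 2 * (W ^ γ) ^ 2) +
        4 * |β| * (c * (W ^ γ) ^ 2) * c +
        (W ^ γ) ^ 2 * (|β * (β - 1)| * c ^ 2 + |β| * c ^ 2)) +
        |M| * W ^ κ * (|κ * (κ - 1)| * c ^ 2 + |κ| * c ^ 2) := by
        gcongr
        exact hi2.trans (by gcongr)
    _ = (4 + 5 * |β| + |β * (β - 1)|) * c ^ 2 * (W ^ β * (W ^ γ) ^ 2) +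
        |M| * W ^ κ * (|κ * (κ - 1)| * c ^ 2 + |κ| * c ^ 2) := by ring
    _ = _ := by rw [rpow_mul_sq hβ hW]; ring

/-- Lower bound for the second derivative of `bel`, up to the terms that cancel in the
Laplacian of harmonic functions. -/
lemma le_bel2 (hβ : κ = β + 2 * γ) (hW : 0 < W)
    (hM : 4 * β ^ 2 + |β * (β - 1)| ≤ M * (κ * (κ - 1))) (hu : ‖u‖ ≤ W ^ γ) :
    W ^ β * ‖u₁‖ ^ 2 + (W ^ β * (2 * inner ℝ u u₂ + ‖u‖ ^ 2 * β * (W₂ / W)) +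
      M * κ * W ^ κ * (W₂ / W)) ≤ bel2 β κ M u u₁ u₂ W W₁ W₂ := by
  have hP : 0 < W ^ β := by positivity
  rw [bel2, ← rpow_mul_sq hβ hW]
  set r := W₁ / W
  set s := W₂ / W
  set P := W ^ β
  set G := W ^ γ
  have hi : |inner ℝ u u₁| ≤ ‖u‖ * ‖u₁‖ := abs_real_inner_le_norm _ _
  have h1 : -(4 * β * inner ℝ u u₁ * r) ≤ ‖u₁‖ ^ 2 + 4 * β ^ 2 * ‖u‖ ^ 2 * r ^ 2 := by
    calc _ ≤ |4 * β * inner ℝ u u₁ * r| := neg_le_abs _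
      _ = 4 * |β| * |inner ℝ u u₁| * |r| := by simp [abs_mul]
      _ ≤ 4 * |β| * (‖u‖ * ‖u₁‖) * |r| := by gcongr
      _ ≤ ‖u₁‖ ^ 2 + 4 * |β| ^ 2 * ‖u‖ ^ 2 * |r| ^ 2 := by
          nlinarith [sq_nonneg (‖u₁‖ - 2 * |β| * ‖u‖ * |r|)]
      _ = _ := by simp
  have h2 : -(‖u‖ ^ 2 * (β * (β - 1) * r ^ 2)) ≤ |β * (β - 1)| * G ^ 2 * r ^ 2 := by
    calc _ ≤ |‖u‖ ^ 2 * (β * (β - 1) * r ^ 2)| := neg_le_abs _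
      _ = ‖u‖ ^ 2 * (|β * (β - 1)| * r ^ 2) := by simp [abs_mul]
      _ ≤ G ^ 2 * (|β * (β - 1)| * r ^ 2) := by gcongr
      _ = _ := by ring
  have h3 : 4 * β ^ 2 * ‖u‖ ^ 2 * r ^ 2 ≤ 4 * β ^ 2 * G ^ 2 * r ^ 2 := by gcongr
  have h4 : (4 * β ^ 2 + |β * (β - 1)|) * (G ^ 2 * r ^ 2) ≤
    M * (κ * (κ - 1)) * (G ^ 2 * r ^ 2) := by gcongr
  have h5 : 0 ≤ P * (‖u₁‖ ^ 2 + 4 * β * inner ℝ u u₁ * r + ‖u‖ ^ 2 * (β * (β - 1) * r ^ 2) +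
    M * (κ * (κ - 1)) * (G ^ 2 * r ^ 2)) := mul_nonneg hP.le (by linarith)
  linarith

end bounds

lemma PKernel.norm_ext_le_rpow {k : ℝ → ℝ → ℝ} (hk : PKernel k) {f : ℝ → E} {w : ℝ → ℝ} {γ : ℝ}
    (hf : BM f) (hw : BM w) (hpos : ∀ t, 0 < w t) (h0 : 0 ≤ γ) (h1 : γ ≤ 1)
    (hfw : ∀ t, ‖f t‖ ≤ w t ^ γ) (x : ℝ) {y : ℝ} (hy : 0 < y) :
    ‖ext k f x y‖ ≤ 6 * (1 + 1 / y ^ 2) * ext pk w x y ^ γ := by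
  refine (norm_ext_le hf x hy fun t => hk.bound t y hy).trans ?_
  gcongr
  exact (ext_pk_mono hf.norm (hw.rpow (fun t => (hpos t).le) h0) hfw x hy).trans
    (ext_rpow_le hw hpos h0 h1 x hy)

lemma PKernel.abs_ext_le {k : ℝ → ℝ → ℝ} (hk : PKernel k) {w : ℝ → ℝ}
    (hw : BM w) (hpos : ∀ t, 0 < w t) (x : ℝ) {y : ℝ} (hy : 0 < y) :
    |ext k w x y| ≤ 6 * (1 + 1 / y ^ 2) * ext pk w x y := by
  have := hk.norm_ext_le_rpow hw hw hpos zero_le_one le_rfl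
    (fun t => by rw [Real.rpow_one, Real.norm_eq_abs, abs_of_pos (hpos t)]) x hy
  simpa using this

lemma ext_neg {k : ℝ → ℝ → ℝ} {f : ℝ → E} (x y : ℝ) :
    ext (fun x y => -k x y) f x y = -ext k f x y := by
  simp [ext, integral_neg]

lemma norm_ext_pk_le_rpow {f : ℝ → E} {w : ℝ → ℝ} {γ : ℝ}
    (hf : BM f) (hw : BM w) (hpos : ∀ t, 0 < w t) (h0 : 0 ≤ γ) (h1 : γ ≤ 1)
    (hfw : ∀ t, ‖f t‖ ≤ w t ^ γ) (x : ℝ) {y : ℝ} (hy : 0 < y) :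
    ‖ext pk f x y‖ ≤ ext pk w x y ^ γ := by
  refine (norm_ext_le (c := 1) hf x hy fun t => ?_).trans ?_
  · rw [one_mul, abs_of_pos (pk_pos t hy)]
  · rw [one_mul]
    exact (ext_pk_mono hf.norm (hw.rpow (fun t => (hpos t).le) h0) hfw x hy).trans
      (ext_rpow_le hw hpos h0 h1 x hy)

lemma stronglyMeasurable_ext_slice {F : Type*} [NormedAddCommGroup F] [NormedSpace ℝ F]
    {k : ℝ → ℝ → ℝ} {g : ℝ → F} (hk : PKernel k) (hg : BM g) (y : ℝ) :
    StronglyMeasurable (fun x => ext k g x y) :=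
  (stronglyMeasurable_ext hk hg).comp_measurable (measurable_id.prodMk measurable_const)

/-- The constant in the weighted Littlewood–Paley estimate. -/
noncomputable def belConst (κ γ : ℝ) : ℝ :=
  (4 * (κ - 2 * γ) ^ 2 + |(κ - 2 * γ) * (κ - 2 * γ - 1)|) / (κ * (κ - 1))

lemma belConst_nonneg {κ γ : ℝ} (hκ : 1 < κ) : 0 ≤ belConst κ γ := by
  have : 0 < κ * (κ - 1) := mul_pos (by linarith) (by linarith)
  unfold belConst; positivity

set_option maxHeartbeats 1000000 in
/-- Weighted Littlewood–Paley estimate: the gradient of the harmonic extension of `f` is controlled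
in terms of a weight dominating `f`. -/
theorem lintegral_grad_sq_le {κ γ : ℝ} (hκ : 1 < κ) (h0 : 0 ≤ γ) (h1 : γ ≤ 1) {f : ℝ → E}
    {w : ℝ → ℝ} (hf : BM f) (hw : Weight κ w) (hfw : ∀ t, ‖f t‖ ≤ w t ^ γ) :
    ∫⁻ y in Ioi 0, ∫⁻ x, ENNReal.ofReal (y * (ext pk w x y ^ (κ - 2 * γ) *
      (‖ext pkx f x y‖ ^ 2 + ‖ext pky f x y‖ ^ 2))) ≤
      ENNReal.ofReal (3 * ((1 + belConst κ γ) * ∫ t, w t ^ κ)) := by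
  set M := belConst κ γ with hMdef
  set β := κ - 2 * γ with hβ'
  have hβ : κ = β + 2 * γ := by ring
  have hM0 : 0 ≤ M := belConst_nonneg hκ
  have hM : 4 * β ^ 2 + |β * (β - 1)| ≤ M * (κ * (κ - 1)) := by
    have : 0 < κ * (κ - 1) := mul_pos (by linarith) (by linarith)
    rw [hMdef, belConst, div_mul_cancel₀ _ this.ne']
  have hwb := hw.bm
  have hp := hw.pos
  have W0 : ∀ x y, 0 < y → 0 < ext pk w x y := fun x y h => ext_pk_pos hwb hp x h
  have hu : ∀ x y, 0 < y → ‖ext pk f x y‖ ≤ ext pk w x y ^ γ := fun x y h =>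
    norm_ext_pk_le_rpow hf hwb hp h0 h1 hfw x h
  have nyy := pKernel_pkyy.neg
  set c : ℝ → ℝ := fun y => 6 * (1 + 1 / y ^ 2) with hcdef
  have c1 : ∀ y, 0 < y → 1 ≤ c (y / 2) := fun y h => by
    have : 0 ≤ 1 / (y / 2) ^ 2 := by positivity
    simp only [hcdef]; linarith
  have cmono : ∀ y0 y, 0 < y0 → y0 / 2 ≤ y → c y ≤ c (y0 / 2) := fun y0 y h h' => by
    simp only [hcdef]; gcongr
  set K : ℝ → ℝ := fun c => (1 + M) + (2 + |β| + |M| * |κ|) * c +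
    (4 + 5 * |β| + |β * (β - 1)| + |M| * (|κ * (κ - 1)| + |κ|)) * c ^ 2 with hK
  refine lintegral_laplacian_le
    (Ψ := fun x y => bel β κ M (ext pk f x y) (ext pk w x y))
    (Ψx := fun x y => bel1 β κ M (ext pk f x y) (ext pkx f x y) (ext pk w x y) (ext pkx w x y))
    (Ψxx := fun x y => bel2 β κ M (ext pk f x y) (ext pkx f x y)
      (ext (fun x y => -pkyy x y) f x y) (ext pk w x y) (ext pkx w x y)
      (ext (fun x y => -pkyy x y) w x y))
    (Ψy := fun x y => bel1 β κ M (ext pk f x y) (ext pky f x y) (ext pk w x y) (ext pky w x y))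
    (Ψyy := fun x y => bel2 β κ M (ext pk f x y) (ext pky f x y)
      (ext pkyy f x y) (ext pk w x y) (ext pky w x y) (ext pkyy w x y))
    (b := fun x y => K (c (y / 2)) * (10 * ext pk w x y) ^ κ)
    ?_ ?_ ?_ ?_ ?_ ?_ ?_ ?_ ?_ ?_
  · intro x y h
    exact hasDerivAt_bel1 β κ M (u := fun x => ext pk f x y) (W := fun x => ext pk w x y)
      (hasDerivAt_ext_x pKernel_pk pKernel_pkx (fun x y h => hasDerivAt_pk_x x h) hf x h)
      (hasDerivAt_ext_x pKernel_pkx nyy (fun x y h => hasDerivAt_pkx x h) hf x h)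
      (hasDerivAt_ext_x pKernel_pk pKernel_pkx (fun x y h => hasDerivAt_pk_x x h) hwb x h)
      (hasDerivAt_ext_x pKernel_pkx nyy (fun x y h => hasDerivAt_pkx x h) hwb x h) (W0 x y h)
  · intro x y h
    exact hasDerivAt_bel β κ M (u := fun y => ext pk f x y) (W := fun y => ext pk w x y)
      (hasDerivAt_ext_y pKernel_pk pKernel_pky (fun x y h => hasDerivAt_pk_y x h) hf x h)
      (hasDerivAt_ext_y pKernel_pk pKernel_pky (fun x y h => hasDerivAt_pk_y x h) hwb x h)
      (W0 x y h)
  · intro x y h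
    exact hasDerivAt_bel1 β κ M (u := fun y => ext pk f x y) (W := fun y => ext pk w x y)
      (hasDerivAt_ext_y pKernel_pk pKernel_pky (fun x y h => hasDerivAt_pk_y x h) hf x h)
      (hasDerivAt_ext_y pKernel_pky pKernel_pkyy (fun x y h => hasDerivAt_pky x h) hf x h)
      (hasDerivAt_ext_y pKernel_pk pKernel_pky (fun x y h => hasDerivAt_pk_y x h) hwb x h)
      (hasDerivAt_ext_y pKernel_pky pKernel_pkyy (fun x y h => hasDerivAt_pky x h) hwb x h)
      (W0 x y h)
  · intro y _
    have u0 := stronglyMeasurable_ext_slice pKernel_pk hf y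
    have ux := stronglyMeasurable_ext_slice pKernel_pkx hf y
    have uy := stronglyMeasurable_ext_slice pKernel_pky hf y
    have uyy := stronglyMeasurable_ext_slice pKernel_pkyy hf y
    have uxx := stronglyMeasurable_ext_slice nyy hf y
    have v0 := (stronglyMeasurable_ext_slice pKernel_pk hwb y).measurable
    have vx := (stronglyMeasurable_ext_slice pKernel_pkx hwb y).measurable
    have vy := (stronglyMeasurable_ext_slice pKernel_pky hwb y).measurable
    have vyy := (stronglyMeasurable_ext_slice pKernel_pkyy hwb y).measurable
    have vxx := (stronglyMeasurable_ext_slice nyy hwb y).measurable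
    have n0 := u0.norm.measurable
    have nx := ux.norm.measurable
    have ny := uy.norm.measurable
    have ix := (u0.inner (𝕜 := ℝ) ux).measurable
    have iy := (u0.inner (𝕜 := ℝ) uy).measurable
    have ixx := (u0.inner (𝕜 := ℝ) uxx).measurable
    have iyy := (u0.inner (𝕜 := ℝ) uyy).measurable
    unfold bel bel1 bel2
    refine ⟨?_, ?_, ?_, ?_, ?_⟩ <;> fun_prop
  · intro y h
    have := ((hw.integrable_ext_rpow hκ.le h).1.const_mul (10 ^ κ)).const_mul (K (c (y / 2)))
    refine this.congr (ae_of_all _ fun x => ?_)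
    simp only
    rw [Real.mul_rpow (by norm_num) (W0 x y h).le]
  · intro y0 hy0 y hy1 hy2 x
    have h : 0 < y := by linarith
    have hW := W0 x y h
    have hc := c1 y0 hy0
    have hm := cmono y0 y hy0 hy1
    have hh : ext pk w x y ^ κ ≤ (10 * ext pk w x y0) ^ κ := by
      have := ext_pk_harnack hwb (fun t => (hp t).le) x hy0 hy1 hy2
      gcongr
    have hG : 0 ≤ ext pk w x y ^ γ := by positivity
    have hf' : ∀ k, PKernel k → ‖ext k f x y‖ ≤ c (y0 / 2) * ext pk w x y ^ γ := fun k hk =>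
      (hk.norm_ext_le_rpow hf hwb hp h0 h1 hfw x h).trans (by gcongr)
    have hw' : ∀ k, PKernel k → |ext k w x y| ≤ c (y0 / 2) * ext pk w x y := fun k hk =>
      (hk.abs_ext_le hwb hp x h).trans (by gcongr)
    have b0 := bel_le (M := M) hβ hW (hu x y h)
    have bx := abs_bel1_le (M := M) hβ hW (hu x y h) (hf' _ pKernel_pkx) (hw' _ pKernel_pkx)
    have by' := abs_bel1_le (M := M) hβ hW (hu x y h) (hf' _ pKernel_pky) (hw' _ pKernel_pky)
    have bxx := abs_bel2_le (M := M) hβ hW hc (hu x y h) (hf' _ pKernel_pkx) (hf' _ nyy)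
      (hw' _ pKernel_pkx) (hw' _ nyy)
    have byy := abs_bel2_le (M := M) hβ hW hc (hu x y h) (hf' _ pKernel_pky) (hf' _ pKernel_pkyy)
      (hw' _ pKernel_pky) (hw' _ pKernel_pkyy)
    have p0 : 0 ≤ 1 + M := by linarith
    have p1 : 0 ≤ (2 + |β| + |M| * |κ|) * c (y0 / 2) := by positivity
    have p2 : 0 ≤ (4 + 5 * |β| + |β * (β - 1)| + |M| * (|κ * (κ - 1)| + |κ|)) *
      c (y0 / 2) ^ 2 := by positivity
    have fin : ∀ {A B : ℝ}, A ≤ B * ext pk w x y ^ κ → B ≤ K (c (y0 / 2)) →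
        A ≤ K (c (y0 / 2)) * (10 * ext pk w x y0) ^ κ := fun h1 h2 => h1.trans (by
      have hK0 : 0 ≤ K (c (y0 / 2)) := by simp only [hK]; linarith
      gcongr)
    refine ⟨?_, fin bx ?_, fin bxx ?_, fin by' ?_, fin byy ?_⟩
    · rw [abs_of_nonneg (bel_nonneg hW hM0)]
      exact fin b0 (by simp only [hK]; linarith)
    all_goals simp only [hK]; linarith
  · intro x y h
    exact bel_nonneg (W0 x y h) hM0
  · intro y h
    obtain ⟨hi, hle⟩ := hw.integrable_ext_rpow hκ.le h
    calc _ ≤ ∫ x, (1 + M) * ext pk w x y ^ κ := by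
          refine integral_mono_of_nonneg (ae_of_all _ fun x => bel_nonneg (W0 x y h) hM0)
            (hi.const_mul _) (ae_of_all _ fun x => bel_le hβ (W0 x y h) (hu x y h))
      _ ≤ _ := by rw [integral_const_mul]; gcongr
  · intro x y h
    have := W0 x y h
    positivity
  · intro x y h
    have hx := le_bel2 (M := M) (u₁ := ext pkx f x y) (W₁ := ext pkx w x y)
      (u₂ := ext (fun x y => -pkyy x y) f x y) (W₂ := ext (fun x y => -pkyy x y) w x y)
      hβ (W0 x y h) hM (hu x y h)
    have hy := le_bel2 (M := M) (u₁ := ext pky f x y) (W₁ := ext pky w x y)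
      (u₂ := ext pkyy f x y) (W₂ := ext pkyy w x y) hβ (W0 x y h) hM (hu x y h)
    refine le_trans (le_of_eq ?_) (add_le_add hx hy)
    simp only [ext_neg, inner_neg_right, neg_div]
    ring

end PoissonLP

namespace PoissonLP
open Filter Topology

variable {E : Type*} [NormedAddCommGroup E] [InnerProductSpace ℝ E]
variable {E' : Type*} [NormedAddCommGroup E'] [InnerProductSpace ℝ E']

/-- The squared length of the gradient of the harmonic extension. -/
noncomputable def gradSq (f : ℝ → E) (x y : ℝ) : ℝ :=
  ‖ext pkx f x y‖ ^ 2 + ‖ext pky f x y‖ ^ 2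

lemma gradSq_nonneg (f : ℝ → E) (x y : ℝ) : 0 ≤ gradSq f x y := by
  unfold gradSq; positivity

lemma measurable_gradSq {f : ℝ → E} (hf : BM f) :
    Measurable (fun z : ℝ × ℝ => gradSq f z.1 z.2) :=
  ((stronglyMeasurable_ext pKernel_pkx hf).norm.measurable.pow_const 2).add
    ((stronglyMeasurable_ext pKernel_pky hf).norm.measurable.pow_const 2)

lemma BM.add {f g : ℝ → ℝ} (hf : BM f) (hg : BM g) : BM (fun t => f t + g t) := by
  obtain ⟨C, hC⟩ := hf.2
  obtain ⟨D, hD⟩ := hg.2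
  exact ⟨hf.1.add hg.1, C + D, fun x => (norm_add_le _ _).trans (add_le_add (hC x) (hD x))⟩

lemma add_add_rpow_le {a b c κ : ℝ} (ha : 0 ≤ a) (hb : 0 ≤ b) (hc : 0 ≤ c) (hκ : 0 ≤ κ) :
    (a + b + c) ^ κ ≤ 3 ^ κ * (a ^ κ + b ^ κ + c ^ κ) := by
  have hA : 0 ≤ a ^ κ := by positivity
  have hB : 0 ≤ b ^ κ := by positivity
  have hC : 0 ≤ c ^ κ := by positivity
  have key : ∀ m, 0 ≤ m → a ≤ m → b ≤ m → c ≤ m → (a + b + c) ^ κ ≤ 3 ^ κ * m ^ κ := by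
    intro m hm h1 h2 h3
    rw [← Real.mul_rpow (by norm_num) hm]
    gcongr
    linarith
  rcases le_total a b with h1 | h1 <;> rcases le_total b c with h2 | h2 <;>
    rcases le_total a c with h3 | h3
  all_goals first
    | exact (key a ha (by linarith) (by linarith) (by linarith)).trans (by gcongr; linarith)
    | exact (key b hb (by linarith) (by linarith) (by linarith)).trans (by gcongr; linarith)
    | exact (key c hc (by linarith) (by linarith) (by linarith)).trans (by gcongr; linarith)

/-- A weight dominating powers of two given functions. -/
lemma exists_weight {E E' : Type*} [NormedAddCommGroup E] [NormedAddCommGroup E'] {p q κ : ℝ}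
    (hp : 1 < p) (hq : 1 < q) (hκ : 1 ≤ κ) {f : ℝ → E} {g : ℝ → E'}
    (hf : BM f) (hg : BM g) (hfi : Integrable (fun t => ‖f t‖ ^ p))
    (hgi : Integrable (fun t => ‖g t‖ ^ q)) (hf1 : ∫ t, ‖f t‖ ^ p ≤ 1)
    (hg1 : ∫ t, ‖g t‖ ^ q ≤ 1) :
    ∃ w, Weight κ w ∧ (∀ t, ‖f t‖ ≤ w t ^ (κ / p)) ∧ (∀ t, ‖g t‖ ≤ w t ^ (κ / q)) ∧
      ∫ t, w t ^ κ ≤ 3 ^ κ * (2 + Real.pi) := by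
  have hκ0 : 0 < κ := by linarith
  have hp0 : 0 < p := by linarith
  have hq0 : 0 < q := by linarith
  set w : ℝ → ℝ := fun t => ‖f t‖ ^ (p / κ) + ‖g t‖ ^ (q / κ) + (1 + t ^ 2)⁻¹ with hw
  have n1 : ∀ t, 0 ≤ ‖f t‖ ^ (p / κ) := fun t => by positivity
  have n2 : ∀ t, 0 ≤ ‖g t‖ ^ (q / κ) := fun t => by positivity
  have n3 : ∀ t : ℝ, 0 < (1 + t ^ 2)⁻¹ := fun t => by positivity
  have bw : BM w := by
    refine ((hf.norm.rpow (fun t => norm_nonneg _) (by positivity)).add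
      (hg.norm.rpow (fun t => norm_nonneg _) (by positivity))).add
      ⟨Measurable.stronglyMeasurable (by fun_prop), 1, fun t => ?_⟩
    rw [Real.norm_eq_abs, abs_of_pos (n3 t)]
    exact inv_le_one_of_one_le₀ (by nlinarith [sq_nonneg t])
  have pw : ∀ t, 0 < w t := fun t => by have := n1 t; have := n2 t; have := n3 t; positivity
  have bd : ∀ t, w t ^ κ ≤ 3 ^ κ * (‖f t‖ ^ p + ‖g t‖ ^ q + (1 + t ^ 2)⁻¹) := by
    intro t
    refine (add_add_rpow_le (n1 t) (n2 t) (n3 t).le hκ0.le).trans ?_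
    rw [← Real.rpow_mul (norm_nonneg _), ← Real.rpow_mul (norm_nonneg _),
      div_mul_cancel₀ _ hκ0.ne', div_mul_cancel₀ _ hκ0.ne']
    gcongr
    exact Real.rpow_le_self_of_le_one (n3 t).le
      (inv_le_one_of_one_le₀ (by nlinarith [sq_nonneg t])) hκ
  have ia : Integrable (fun t => ‖f t‖ ^ p + ‖g t‖ ^ q) := hfi.add hgi
  have ib : Integrable (fun t => 3 ^ κ * (‖f t‖ ^ p + ‖g t‖ ^ q + (1 + t ^ 2)⁻¹)) :=
    (ia.add integrable_inv_one_add_sq).const_mul (3 ^ κ)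
  have iw : Integrable (fun t => w t ^ κ) := by
    refine ib.mono' (bw.1.measurable.pow_const κ).aestronglyMeasurable (ae_of_all _ fun t => ?_)
    rw [Real.norm_eq_abs, abs_of_nonneg (by have := pw t; positivity)]
    exact bd t
  refine ⟨w, ⟨bw, pw, iw⟩, fun t => ?_, fun t => ?_, ?_⟩
  · calc ‖f t‖ = (‖f t‖ ^ (p / κ)) ^ (κ / p) := by
          rw [← Real.rpow_mul (norm_nonneg _)]; field_simp; simp
      _ ≤ _ := by
          have : ‖f t‖ ^ (p / κ) ≤ w t := by
            simp only [hw]; linarith [n1 t, n2 t, n3 t]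
          have := n1 t
          gcongr
  · calc ‖g t‖ = (‖g t‖ ^ (q / κ)) ^ (κ / q) := by
          rw [← Real.rpow_mul (norm_nonneg _)]; field_simp; simp
      _ ≤ _ := by
          have : ‖g t‖ ^ (q / κ) ≤ w t := by
            simp only [hw]; linarith [n1 t, n2 t, n3 t]
          have := n2 t
          gcongr
  · calc _ ≤ ∫ t, 3 ^ κ * (‖f t‖ ^ p + ‖g t‖ ^ q + (1 + t ^ 2)⁻¹) := integral_mono iw ib bd
      _ = 3 ^ κ * ((∫ t, ‖f t‖ ^ p) + (∫ t, ‖g t‖ ^ q) + Real.pi) := by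
          rw [integral_const_mul, integral_add ia integrable_inv_one_add_sq,
            integral_add hfi hgi, integral_univ_inv_one_add_sq]
      _ ≤ _ := by gcongr; linarith

/-- Bilinear Littlewood–Paley estimate for normalized functions. -/
theorem exists_lintegral_grad_mul_grad_le {p q : ℝ} (hpq : p.HolderConjugate q) :
    ∃ C : ℝ, 0 < C ∧ ∀ (E E' : Type) [NormedAddCommGroup E] [InnerProductSpace ℝ E]
      [NormedAddCommGroup E'] [InnerProductSpace ℝ E'] (f : ℝ → E) (g : ℝ → E'), BM f → BM g →
      Integrable (fun t => ‖f t‖ ^ p) → Integrable (fun t => ‖g t‖ ^ q) →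
      ∫ t, ‖f t‖ ^ p ≤ 1 → ∫ t, ‖g t‖ ^ q ≤ 1 →
      ∫⁻ y in Ioi 0, ∫⁻ x, ENNReal.ofReal (y * (√(gradSq f x y) * √(gradSq g x y))) ≤
        ENNReal.ofReal C := by
  have hp := hpq.lt
  have hq := hpq.symm.lt
  set κ := min p q with hκd
  have hκ : 1 < κ := lt_min hp hq
  have hp0 : 0 < p := by linarith
  have hq0 : 0 < q := by linarith
  have hκ0 : 0 < κ := by linarith
  have hγ1 : κ / p ≤ 1 := (div_le_one hp0).2 (min_le_left _ _)
  have hγ2 : κ / q ≤ 1 := (div_le_one hq0).2 (min_le_right _ _)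
  have hsum : (κ - 2 * (κ / p)) + (κ - 2 * (κ / q)) = 0 := by
    have := hpq.inv_add_inv_eq_one
    calc _ = 2 * κ * (1 - (p⁻¹ + q⁻¹)) := by field_simp; ring
      _ = 0 := by rw [this]; ring
  have b1 := belConst_nonneg (γ := κ / p) hκ
  have b2 := belConst_nonneg (γ := κ / q) hκ
  set D : ℝ := 3 * ((1 + belConst κ (κ / p)) * (3 ^ κ * (2 + Real.pi))) +
    3 * ((1 + belConst κ (κ / q)) * (3 ^ κ * (2 + Real.pi))) with hD
  have hpi := Real.pi_pos
  refine ⟨D, by positivity, fun E E' _ _ _ _ f g hf hg hfi hgi hf1 hg1 => ?_⟩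
  obtain ⟨w, hw, h1, h2, h3⟩ := exists_weight hp hq hκ.le hf hg hfi hgi hf1 hg1
  have e1 := lintegral_grad_sq_le hκ (by positivity) hγ1 hf hw h1
  have e2 := lintegral_grad_sq_le hκ (by positivity) hγ2 hg hw h2
  have hm : Measurable (fun z : ℝ × ℝ => ENNReal.ofReal
      (z.1 * (ext pk w z.2 z.1 ^ (κ - 2 * (κ / p)) * gradSq f z.2 z.1))) := by
    have m1 := ((stronglyMeasurable_ext pKernel_pk hw.bm).measurable.comp
      measurable_swap).pow_const (κ - 2 * (κ / p))
    have m2 := (measurable_gradSq hf).comp measurable_swap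
    exact (measurable_fst.mul (m1.mul m2)).ennreal_ofReal
  calc _ ≤ ∫⁻ y in Ioi 0, ((∫⁻ x, ENNReal.ofReal (y * (ext pk w x y ^ (κ - 2 * (κ / p)) *
        gradSq f x y))) + ∫⁻ x, ENNReal.ofReal (y * (ext pk w x y ^ (κ - 2 * (κ / q)) *
        gradSq g x y))) := by
        refine setLIntegral_mono' measurableSet_Ioi fun y h => ?_
        have h' : 0 < y := h
        have hm' : Measurable fun x => ENNReal.ofReal (y * (ext pk w x y ^ (κ - 2 * (κ / p)) *
          gradSq f x y)) := hm.comp measurable_prodMk_left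
        rw [← lintegral_add_left hm']
        refine lintegral_mono fun x => ?_
        have hW := ext_pk_pos hw.bm hw.pos x h
        have g1 := gradSq_nonneg f x y
        have g2 := gradSq_nonneg g x y
        rw [← ENNReal.ofReal_add (by positivity) (by positivity), ← mul_add]
        refine ENNReal.ofReal_le_ofReal ?_
        gcongr
        set β := κ - 2 * (κ / p)
        have hβ : κ - 2 * (κ / q) = -β := by linarith
        rw [hβ]
        have hP : 0 < ext pk w x y ^ β := by positivity
        rw [Real.rpow_neg hW.le]
        set P := ext pk w x y ^ β
        rw [← Real.sqrt_mul g1]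
        have : gradSq f x y * gradSq g x y = (P * gradSq f x y) * (P⁻¹ * gradSq g x y) := by
          field_simp
        rw [this]
        have q1 : 0 ≤ P * gradSq f x y := by positivity
        have q2 : 0 ≤ P⁻¹ * gradSq g x y := by positivity
        refine Real.sqrt_le_iff.2 ⟨by positivity, by nlinarith⟩
    _ ≤ ENNReal.ofReal (3 * ((1 + belConst κ (κ / p)) * ∫ t, w t ^ κ)) +
        ENNReal.ofReal (3 * ((1 + belConst κ (κ / q)) * ∫ t, w t ^ κ)) := by
        rw [lintegral_add_left (Measurable.lintegral_prod_right' hm)]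
        exact add_le_add e1 e2
    _ ≤ _ := by
        have hn : 0 ≤ ∫ t, w t ^ κ := integral_nonneg fun t => by have := hw.pos t; positivity
        rw [← ENNReal.ofReal_add (by positivity) (by positivity), hD]
        refine ENNReal.ofReal_le_ofReal ?_
        gcongr

end PoissonLP

namespace PoissonLP
open Filter Topology FourierTransform

lemma norm_eChar (t x : ℝ) : ‖eChar t x‖ = 1 := by
  have : (2 * Real.pi * Complex.I * t * x : ℂ) = ((2 * Real.pi * t * x : ℝ) : ℂ) * Complex.I := by
    push_cast; ring
  rw [eChar, this, Complex.norm_exp_ofReal_mul_I]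

lemma eChar_comm (t x : ℝ) : eChar t x = eChar x t := by
  unfold eChar; congr 1; ring

lemma eChar_add (s t x : ℝ) : eChar (s + t) x = eChar s x * eChar t x := by
  unfold eChar; rw [← Complex.exp_add]; congr 1; push_cast; ring

lemma eChar_zero (x : ℝ) : eChar 0 x = 1 := by simp [eChar]

lemma eChar_neg_mul (s x : ℝ) : eChar (-s) x * eChar s x = 1 := by
  rw [← eChar_add, neg_add_cancel, eChar_zero]

lemma eChar_neg_right (s x : ℝ) : eChar s (-x) = eChar (-s) x := by
  unfold eChar; congr 1; push_cast; ring

lemma continuous_eChar : Continuous (fun z : ℝ × ℝ => eChar z.1 z.2) := by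
  unfold eChar; fun_prop

lemma continuous_eChar_left (x : ℝ) : Continuous (fun t => eChar t x) := by
  unfold eChar; fun_prop

lemma continuous_eChar_right (t : ℝ) : Continuous (fun x => eChar t x) := by
  unfold eChar; fun_prop

/-- The inverse Fourier transform. -/
noncomputable def ift (F : ℝ → ℂ) (x : ℝ) : ℂ := ∫ ξ, F ξ * eChar ξ x

lemma ift_eq_fourierInv (F : ℝ → ℂ) : ift F = 𝓕⁻ F := by
  ext x
  rw [Real.fourierInv_eq']
  refine integral_congr_ae (ae_of_all _ fun v => ?_)
  simp only [eChar, smul_eq_mul, RCLike.inner_apply, conj_trivial]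
  rw [mul_comm]; congr 2; push_cast; ring

lemma fourierT_eq_fourier (f : ℝ → ℂ) : fourierT f = 𝓕 f := by
  ext x
  rw [Real.fourier_eq']
  refine integral_congr_ae (ae_of_all _ fun v => ?_)
  simp only [eChar, smul_eq_mul, RCLike.inner_apply, conj_trivial]
  rw [mul_comm]; congr 2; push_cast; ring

lemma Integrable.mul_eChar {F : ℝ → ℂ} (hF : Integrable F) (x : ℝ) :
    Integrable (fun ξ => F ξ * eChar ξ x) :=
  hF.mul_bdd (c := 1) (continuous_eChar_left x).aestronglyMeasurable
    (ae_of_all _ fun ξ => (norm_eChar ξ x).le)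

lemma norm_ift_le {F : ℝ → ℂ} (x : ℝ) : ‖ift F x‖ ≤ ∫ ξ, ‖F ξ‖ := by
  refine (norm_integral_le_integral_norm _).trans (le_of_eq ?_)
  simp [norm_eChar]

lemma continuous_ift {F : ℝ → ℂ} (hF : Integrable F) : Continuous (ift F) := by
  refine continuous_of_dominated (bound := fun ξ => ‖F ξ‖)
    (fun x => (Integrable.mul_eChar hF x).1) (fun x => ae_of_all _ fun ξ => ?_) hF.norm
    (ae_of_all _ fun ξ => (continuous_eChar_right ξ).const_mul _)
  simp [norm_eChar]

lemma bm_ift {F : ℝ → ℂ} (hF : Integrable F) : BM (ift F) :=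
  ⟨(continuous_ift hF).stronglyMeasurable, _, norm_ift_le⟩

lemma integral_mul_ift {ψ F : ℝ → ℂ} (hψ : Integrable ψ) (hF : Integrable F) :
    ∫ x, ψ x * ift F x = ∫ ξ, F ξ * ift ψ ξ := by
  have h : Integrable (fun z : ℝ × ℝ => ψ z.1 * F z.2 * eChar z.2 z.1) (volume.prod volume) :=
    (hψ.mul_prod hF).mul_bdd (c := 1)
      (continuous_eChar.comp continuous_swap).aestronglyMeasurable
      (ae_of_all _ fun z => (norm_eChar _ _).le)
  have := integral_integral_swap (f := fun x ξ => ψ x * F ξ * eChar ξ x) h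
  simp only [ift, ← integral_const_mul]
  rw [show (∫ x, ∫ ξ, ψ x * (F ξ * eChar ξ x)) = ∫ x, ∫ ξ, ψ x * F ξ * eChar ξ x by
    simp only [mul_assoc], this]
  refine integral_congr_ae (ae_of_all _ fun ξ => integral_congr_ae (ae_of_all _ fun x => ?_))
  simp only [eChar_comm ξ x]; ring

/-- Convolution with the inverse Fourier transform of an integrable symbol. -/
lemma integral_conv_ift {κ F : ℝ → ℂ} (hc : Continuous κ) (hκ : Integrable κ)
    (hk : Integrable (ift κ)) (hF : Integrable F) (x : ℝ) :
    ∫ t, ift κ (x - t) * ift F t = ift (fun ξ => κ ξ * F ξ) x := by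
  have hkt : Integrable (fun t => ift κ (x - t)) := hk.comp_sub_left x
  rw [integral_mul_ift hkt hF, ift]
  have hinv : 𝓕 (ift κ) = κ := by
    rw [ift_eq_fourierInv] at hk ⊢
    refine hc.fourier_fourierInv_eq hκ (hk.comp_neg.congr (ae_of_all _ fun t => ?_))
    change 𝓕⁻ κ (-t) = 𝓕 κ t
    rw [Real.fourierInv_eq_fourier_neg, neg_neg]
  refine integral_congr_ae (ae_of_all _ fun ξ => ?_)
  have : ift (fun t => ift κ (x - t)) ξ = κ ξ * eChar ξ x := by
    rw [← congrFun hinv ξ, ← fourierT_eq_fourier]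
    unfold fourierT
    conv_lhs => rw [ift]
    rw [← integral_sub_left_eq_self _ _ x, ← integral_mul_const]
    refine integral_congr_ae (ae_of_all _ fun t => ?_)
    simp only [sub_sub_cancel, eChar_comm (x - t) ξ, mul_assoc]
    congr 1
    rw [← eChar_neg_right, eChar_comm ξ, eChar_comm ξ, eChar_comm ξ, ← eChar_add]
    congr 1; ring
  simp only [this]; ring

/-- The symbol of `∂ₓ - i ∂_y` acting on harmonic extensions. -/
noncomputable def symD (y ξ : ℝ) : ℂ :=
  4 * Real.pi * Complex.I * ((max ξ 0 * Real.exp (-(2 * Real.pi * y * ξ)) : ℝ) : ℂ)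

lemma continuous_symD (y : ℝ) : Continuous (symD y) := by
  unfold symD; fun_prop

lemma symD_eq_indicator (y : ℝ) : (fun ξ : ℝ => max ξ 0 * Real.exp (-(2 * Real.pi * y * ξ))) =
    indicator (Ioi 0) (fun ξ => ξ * Real.exp (-(2 * Real.pi * y * ξ))) := by
  ext ξ
  by_cases h : 0 < ξ
  · simp [indicator, h, h.le]
  · simp [indicator, h, not_lt.1 h]

lemma integrable_symD {y : ℝ} (hy : 0 < y) : Integrable (symD y) := by
  unfold symD
  refine Integrable.const_mul (Integrable.ofReal ?_) _
  change Integrable (fun ξ : ℝ => max ξ 0 * Real.exp (-(2 * Real.pi * y * ξ)))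
  rw [symD_eq_indicator, integrable_indicator_iff measurableSet_Ioi]
  have := integrableOn_rpow_mul_exp_neg_mul_rpow (s := 1) (p := 1) (b := 2 * Real.pi * y)
    (by norm_num) one_pos (by have := Real.pi_pos; positivity)
  refine this.congr_fun (fun ξ _ => ?_) measurableSet_Ioi
  simp

lemma integral_mul_cexp {r : ℂ} (hr : 0 < r.re) :
    ∫ t : ℝ in Ioi 0, (t : ℂ) * Complex.exp (-r * t) = (1 / r) ^ 2 := by
  have hr0 : r ≠ 0 := by rintro rfl; simp at hr
  have hn : ∀ t : ℝ, ‖Complex.exp (-r * t)‖ = Real.exp (-r.re * t) := fun t => by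
    rw [Complex.norm_exp]; simp
  have e1 : Tendsto (fun t : ℝ => (t : ℂ) * Complex.exp (-r * t)) atTop (𝓝 0) := by
    rw [tendsto_zero_iff_norm_tendsto_zero]
    have := tendsto_rpow_mul_exp_neg_mul_atTop_nhds_zero 1 r.re hr
    refine this.congr' ?_
    filter_upwards [eventually_ge_atTop 0] with t ht
    rw [norm_mul, hn, Complex.norm_real, Real.norm_eq_abs, abs_of_nonneg ht, Real.rpow_one]
  have e2 : Tendsto (fun t : ℝ => Complex.exp (-r * t)) atTop (𝓝 0) := by
    rw [tendsto_zero_iff_norm_tendsto_zero]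
    have := tendsto_rpow_mul_exp_neg_mul_atTop_nhds_zero 0 r.re hr
    refine this.congr fun t => ?_
    rw [hn, Real.rpow_zero, one_mul]
  have hd : ∀ t ∈ Ici (0 : ℝ), HasDerivAt (fun t : ℝ => -(1 / r) * ((t : ℂ) *
      Complex.exp (-r * t)) - (1 / r) ^ 2 * Complex.exp (-r * t))
      ((t : ℂ) * Complex.exp (-r * t)) t := by
    intro t _
    have a1 : HasDerivAt (fun t : ℝ => (t : ℂ)) 1 t := (hasDerivAt_id t).ofReal_comp
    have a2 : HasDerivAt (fun t : ℝ => Complex.exp (-r * t)) (Complex.exp (-r * t) * (-r * 1)) t :=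
      (a1.const_mul (-r)).cexp
    refine (((a1.mul a2).const_mul (-(1 / r))).sub (a2.const_mul ((1 / r) ^ 2))).congr_deriv ?_
    field_simp; ring
  have hi : IntegrableOn (fun t : ℝ => (t : ℂ) * Complex.exp (-r * t)) (Ioi 0) := by
    have := integrableOn_rpow_mul_exp_neg_mul_rpow (s := 1) (p := 1) (b := r.re)
      (by norm_num) one_pos hr
    refine this.mono' (by fun_prop) ?_
    filter_upwards [ae_restrict_mem measurableSet_Ioi] with t ht
    rw [norm_mul, hn, Complex.norm_real, Real.norm_eq_abs, abs_of_pos ht]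
    simp
  have hl := (e1.const_mul (-(1 / r))).sub (e2.const_mul ((1 / r) ^ 2))
  rw [integral_Ioi_of_hasDerivAt_of_tendsto' hd hi hl]
  simp

lemma ift_symD {y : ℝ} (hy : 0 < y) (x : ℝ) :
    ift (symD y) x = (pkx x y : ℂ) - Complex.I * (pky x y : ℂ) := by
  have hpi := Real.pi_pos
  have hpi' : (Real.pi : ℂ) ≠ 0 := by exact_mod_cast hpi.ne'
  set r : ℂ := 2 * Real.pi * (y - Complex.I * x) with hr
  have hre : 0 < r.re := by simp [hr]; positivity
  have h1 : ift (symD y) x = 4 * Real.pi * Complex.I *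
      ∫ t : ℝ in Ioi 0, (t : ℂ) * Complex.exp (-r * t) := by
    rw [ift, ← integral_const_mul, ← integral_indicator measurableSet_Ioi]
    refine integral_congr_ae (ae_of_all _ fun ξ => ?_)
    simp only [symD]
    rw [congrFun (symD_eq_indicator y) ξ]
    by_cases h : 0 < ξ
    · simp only [indicator, mem_Ioi, h, if_true]
      push_cast
      rw [eChar, mul_assoc, mul_assoc (ξ : ℂ), ← Complex.exp_add]
      congr 4
      rw [hr]; ring
    · simp [indicator, h]
  have hz : (y - Complex.I * x : ℂ) ≠ 0 := by
    intro h0; rw [hr, h0] at hre; simp at hre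
  have hzz : ((x : ℂ) ^ 2 + y ^ 2) = (y - Complex.I * x) * (y + Complex.I * x) := by
    ring_nf; simp
  have hz2 : (y + Complex.I * x : ℂ) ≠ 0 := by
    intro h0
    have := congrArg Complex.re h0
    simp at this; exact hy.ne' this
  rw [h1, integral_mul_cexp hre, hr, pkx, pky]
  push_cast
  rw [hzz]
  field_simp
  linear_combination (4 * Complex.I * x ^ 2 + 8 * y * x) * Complex.I_sq

end PoissonLP

namespace PoissonLP
open Filter Topology FourierTransform

lemma norm_symD_le {y : ℝ} (hy : 0 < y) (ξ : ℝ) : ‖symD y ξ‖ ≤ 2 / y := by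
  have hpi := Real.pi_pos
  have h : max ξ 0 * Real.exp (-(2 * Real.pi * y * ξ)) ≤ 1 / (2 * Real.pi * y) := by
    rcases le_or_gt ξ 0 with h | h
    · rw [max_eq_right h, zero_mul]; positivity
    · rw [max_eq_left h.le, Real.exp_neg, ← div_eq_mul_inv, div_le_div_iff₀ (Real.exp_pos _)
        (by positivity)]
      have := Real.add_one_le_exp (2 * Real.pi * y * ξ)
      nlinarith
  have h0 : 0 ≤ max ξ 0 * Real.exp (-(2 * Real.pi * y * ξ)) := by positivity
  rw [symD, norm_mul, Complex.norm_real, Real.norm_eq_abs, abs_of_nonneg h0]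
  simp only [norm_mul, Complex.norm_I, Complex.norm_real, Real.norm_eq_abs, abs_of_pos hpi]
  calc _ ≤ ‖(4 : ℂ)‖ * Real.pi * 1 * (1 / (2 * Real.pi * y)) := by gcongr
    _ = 2 / y := by simp; field_simp; norm_num

lemma integrable_symD_mul {y : ℝ} (hy : 0 < y) {F : ℝ → ℂ} (hF : Integrable F) :
    Integrable (fun ξ => symD y ξ * F ξ) :=
  hF.bdd_mul (continuous_symD y).aestronglyMeasurable (ae_of_all _ (norm_symD_le hy))

lemma integrable_pKernel {k : ℝ → ℝ → ℝ} (hk : PKernel k) {y : ℝ} (hy : 0 < y) :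
    Integrable (fun x => k x y) := by
  have := (hk.integrable_shift 0 hy).comp_neg
  simpa using this

lemma integrable_ift_symD {y : ℝ} (hy : 0 < y) : Integrable (ift (symD y)) := by
  have : ift (symD y) = fun x => (pkx x y : ℂ) - Complex.I * (pky x y : ℂ) :=
    funext (ift_symD hy)
  rw [this]
  exact (integrable_pKernel pKernel_pkx hy).ofReal.sub
    ((integrable_pKernel pKernel_pky hy).ofReal.const_mul _)

lemma ext_sub_I_mul_ext {F : ℝ → ℂ} (hF : Integrable F) (x : ℝ) {y : ℝ} (hy : 0 < y) :
    ext pkx (ift F) x y - Complex.I * ext pky (ift F) x y = ift (fun ξ => symD y ξ * F ξ) x := by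
  rw [← integral_conv_ift (continuous_symD y) (integrable_symD hy) (integrable_ift_symD hy) hF x]
  have hb := bm_ift hF
  have h1 := pKernel_pkx.integrable_ext hb x hy
  have h2 := pKernel_pky.integrable_ext hb x hy
  rw [ext, ext, ← integral_const_mul, ← integral_sub h1 (h2.const_mul _)]
  refine integral_congr_ae (ae_of_all _ fun t => ?_)
  simp only [ift_symD hy, Complex.real_smul]; ring

lemma ext_add_I_mul_ext {ψ : ℝ → ℂ} (hψ : BM ψ) (x : ℝ) {y : ℝ} (hy : 0 < y) :
    ext pkx ψ x y + Complex.I * ext pky ψ x y = -∫ t, ψ t * ift (symD y) (t - x) := by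
  have h1 := pKernel_pkx.integrable_ext hψ x hy
  have h2 := pKernel_pky.integrable_ext hψ x hy
  rw [ext, ext, ← integral_const_mul, ← integral_add h1 (h2.const_mul _), ← integral_neg]
  refine integral_congr_ae (ae_of_all _ fun t => ?_)
  have e1 : pkx (x - t) y = -pkx (t - x) y := by unfold pkx; ring
  have e2 : pky (x - t) y = pky (t - x) y := by unfold pky; ring
  simp only [ift_symD hy, Complex.real_smul, e1, e2]; push_cast; ring

lemma integrable_conv_symD {ψ : ℝ → ℂ} (hψ : Integrable ψ) {y : ℝ} (hy : 0 < y) :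
    Integrable (fun z : ℝ × ℝ => ψ z.2 * ift (symD y) (z.2 - z.1)) (volume.prod volume) := by
  have := hψ.convolution_integrand (ContinuousLinearMap.mul ℝ ℂ) (integrable_ift_symD hy).comp_neg
  simpa using this

lemma integrable_ext_add {ψ : ℝ → ℂ} (hψ : BM ψ) (hi : Integrable ψ) {y : ℝ} (hy : 0 < y) :
    Integrable (fun x => ext pkx ψ x y + Complex.I * ext pky ψ x y) := by
  refine (integrable_conv_symD hi hy).integral_prod_left.neg.congr (ae_of_all _ fun x => ?_)
  exact (ext_add_I_mul_ext hψ x hy).symm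

lemma integral_ift_mul_ext {F ψ : ℝ → ℂ} (hF : Integrable F) (hψ : BM ψ) (hi : Integrable ψ)
    {y : ℝ} (hy : 0 < y) :
    ∫ x, ift (fun ξ => symD y ξ * F ξ) x * (ext pkx ψ x y + Complex.I * ext pky ψ x y) =
      -∫ ξ, symD y ξ ^ 2 * F ξ * ift ψ ξ := by
  have hF1 := integrable_symD_mul hy hF
  have hF2 := integrable_symD_mul hy hF1
  set h := ift (fun ξ => symD y ξ * F ξ)
  have hb : BM h := bm_ift hF1
  have e1 : ∀ ξ, symD y ξ ^ 2 * F ξ * ift ψ ξ = symD y ξ * (symD y ξ * F ξ) * ift ψ ξ := fun ξ => by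
    ring
  simp only [e1]
  rw [← integral_mul_ift hi hF2, ← integral_neg]
  obtain ⟨C, hC⟩ := hb.2
  have hI : Integrable (fun z : ℝ × ℝ => -(h z.1 * (ψ z.2 * ift (symD y) (z.2 - z.1))))
      (volume.prod volume) :=
    ((integrable_conv_symD hi hy).bdd_mul
      (hb.1.comp_measurable measurable_fst).aestronglyMeasurable (ae_of_all _ fun z => hC _)).neg
  have hs := integral_integral_swap (f := fun x t => -(h x * (ψ t * ift (symD y) (t - x)))) hI
  calc _ = ∫ x, ∫ t, -(h x * (ψ t * ift (symD y) (t - x))) := by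
        refine integral_congr_ae (ae_of_all _ fun x => ?_)
        simp only [ext_add_I_mul_ext hψ x hy, integral_neg, integral_const_mul, mul_neg]
    _ = _ := hs
    _ = _ := by
        refine integral_congr_ae (ae_of_all _ fun t => ?_)
        simp only [← integral_conv_ift (continuous_symD y) (integrable_symD hy)
          (integrable_ift_symD hy) hF1 t, ← integral_const_mul, ← integral_neg]
        refine integral_congr_ae (ae_of_all _ fun x => ?_)
        change -(h x * _) = -(_ * (_ * h x))
        ring

/-- The density on the frequency side of the vertical integral at height `y`. -/
noncomputable def dens (y ξ : ℝ) : ℝ :=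
  y * (16 * Real.pi ^ 2 * max ξ 0 ^ 2 * Real.exp (-(4 * Real.pi * y * ξ)))

lemma continuous_dens : Continuous (fun z : ℝ × ℝ => dens z.2 z.1) := by
  unfold dens; fun_prop

lemma symD_sq {y : ℝ} (ξ : ℝ) : (y : ℂ) * -(symD y ξ ^ 2) = dens y ξ := by
  have : Real.exp (-(4 * Real.pi * y * ξ)) = Real.exp (-(2 * Real.pi * y * ξ)) ^ 2 := by
    rw [← Real.exp_nat_mul]; congr 1; push_cast; ring
  rw [dens, this, symD]; push_cast
  linear_combination (-16 * (y : ℂ) * Real.pi ^ 2 * ((max ξ 0 : ℝ) : ℂ) ^ 2 *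
    Complex.exp (-(2 * Real.pi * y * ξ)) ^ 2) * Complex.I_sq

lemma dens_nonneg {y : ℝ} (hy : 0 ≤ y) (ξ : ℝ) : 0 ≤ dens y ξ := by
  unfold dens; positivity

lemma dens_of_nonpos {ξ : ℝ} (h : ξ ≤ 0) (y : ℝ) : dens y ξ = 0 := by
  simp [dens, max_eq_right h]

lemma integrableOn_dens (ξ : ℝ) : IntegrableOn (fun y => dens y ξ) (Ioi 0) := by
  rcases le_or_gt ξ 0 with h | h
  · simp [dens_of_nonpos h]
  · have hpi := Real.pi_pos
    have := integrableOn_rpow_mul_exp_neg_mul_rpow (s := 1) (p := 1) (b := 4 * Real.pi * ξ)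
      (by norm_num) one_pos (by positivity)
    refine (Integrable.const_mul this (16 * Real.pi ^ 2 * max ξ 0 ^ 2)).congr
      (ae_of_all _ fun y => ?_)
    simp only [Real.rpow_one, dens]
    rw [show -(4 * Real.pi * ξ) * y = -(4 * Real.pi * y * ξ) by ring]; ring

lemma integral_dens {ξ : ℝ} (h : 0 < ξ) : ∫ y in Ioi 0, dens y ξ = 1 := by
  have hpi := Real.pi_pos
  have := Real.integral_rpow_mul_exp_neg_mul_Ioi (a := 2) (r := 4 * Real.pi * ξ) two_pos
    (by positivity)
  have h2 : ∀ y, dens y ξ = (4 * Real.pi * ξ) ^ 2 *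
      (y ^ ((2 : ℝ) - 1) * Real.exp (-(4 * Real.pi * ξ * y))) := fun y => by
    rw [show (2 : ℝ) - 1 = 1 by norm_num, Real.rpow_one, dens, max_eq_left h.le,
      show 4 * Real.pi * ξ * y = 4 * Real.pi * y * ξ by ring]; ring
  simp only [h2]
  rw [integral_const_mul, this, Real.Gamma_two, Real.rpow_two]
  field_simp

/-- The symbol obtained by restricting the vertical integral to heights in `A`. -/
noncomputable def theta (A : Set ℝ) (ξ : ℝ) : ℝ := ∫ y in A, dens y ξ

lemma integral_theta_mul {A : Set ℝ} (hA : MeasurableSet A) (hA0 : A ⊆ Ioi 0) {F ψ : ℝ → ℂ}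
    (hF : Integrable F) (hψ : BM ψ) (hi : Integrable ψ) :
    IntegrableOn (fun y : ℝ => (y : ℂ) * ∫ x, ift (fun ξ => symD y ξ * F ξ) x *
      (ext pkx ψ x y + Complex.I * ext pky ψ x y)) A ∧
    ∫ ξ, (theta A ξ : ℂ) * F ξ * ift ψ ξ = ∫ y : ℝ in A, (y : ℂ) *
      ∫ x, ift (fun ξ => symD y ξ * F ξ) x * (ext pkx ψ x y + Complex.I * ext pky ψ x y) := by
  have hb := bm_ift hi
  obtain ⟨C, hC⟩ := hb.2
  have hG : Integrable (fun ξ => F ξ * ift ψ ξ) :=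
    hF.mul_bdd hb.1.aestronglyMeasurable (ae_of_all _ hC)
  have hm : AEStronglyMeasurable (fun z : ℝ × ℝ => (dens z.2 z.1 : ℂ) * (F z.1 * ift ψ z.1))
      (volume.prod (volume.restrict A)) :=
    (Complex.continuous_ofReal.comp continuous_dens).aestronglyMeasurable.mul hG.1.comp_fst
  have hdA : ∀ ξ, IntegrableOn (fun y => dens y ξ) A := fun ξ => (integrableOn_dens ξ).mono_set hA0
  have hdA1 : ∀ ξ, ∫ y in A, dens y ξ ≤ 1 := fun ξ => by
    refine (setIntegral_mono_set (integrableOn_dens ξ) ?_ hA0.eventuallyLE).trans ?_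
    · filter_upwards [ae_restrict_mem measurableSet_Ioi] with y hy using dens_nonneg (le_of_lt hy) ξ
    · rcases le_or_gt ξ 0 with h | h
      · simp [dens_of_nonpos h]
      · exact (integral_dens h).le
  have hI : Integrable (fun z : ℝ × ℝ => (dens z.2 z.1 : ℂ) * (F z.1 * ift ψ z.1))
      (volume.prod (volume.restrict A)) := by
    rw [integrable_prod_iff hm]
    refine ⟨ae_of_all _ fun ξ =>
      (Integrable.ofReal (𝕜 := ℂ) (hdA ξ)).mul_const (F ξ * ift ψ ξ), ?_⟩
    refine hG.norm.mono' hm.norm.integral_prod_right' (ae_of_all _ fun ξ => ?_)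
    have e : ∫ y in A, ‖(dens y ξ : ℂ) * (F ξ * ift ψ ξ)‖ =
        (∫ y in A, dens y ξ) * ‖F ξ * ift ψ ξ‖ := by
      rw [← integral_mul_const]
      refine setIntegral_congr_fun hA fun y hy => ?_
      simp only [norm_mul (dens y ξ : ℂ), Complex.norm_real, Real.norm_eq_abs,
        abs_of_nonneg (dens_nonneg (le_of_lt (hA0 hy)) ξ)]
    have h0 : 0 ≤ ∫ y in A, dens y ξ :=
      setIntegral_nonneg hA fun y hy => dens_nonneg (le_of_lt (hA0 hy)) ξ
    simp only [e]
    rw [Real.norm_eq_abs, abs_of_nonneg (by positivity)]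
    exact mul_le_of_le_one_left (norm_nonneg _) (hdA1 ξ)
  have hy : ∀ y ∈ A, (∫ ξ, (dens y ξ : ℂ) * (F ξ * ift ψ ξ)) = (y : ℂ) *
      ∫ x, ift (fun ξ => symD y ξ * F ξ) x * (ext pkx ψ x y + Complex.I * ext pky ψ x y) := by
    intro y hyA
    rw [integral_ift_mul_ext hF hψ hi (hA0 hyA), ← integral_neg, ← integral_const_mul]
    refine integral_congr_ae (ae_of_all _ fun ξ => ?_)
    simp only [← symD_sq]; ring
  refine ⟨(integrableOn_congr_fun hy hA).1 hI.integral_prod_right, ?_⟩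
  rw [← setIntegral_congr_fun hA hy]
  have := integral_integral_swap
    (f := fun ξ y => (dens y ξ : ℂ) * (F ξ * ift ψ ξ)) hI
  rw [← this]
  refine integral_congr_ae (ae_of_all _ fun ξ => ?_)
  simp only [theta, mul_assoc]
  rw [integral_mul_const, integral_complex_ofReal]

end PoissonLP

namespace PoissonLP
open Filter Topology

variable {ι : Type}

/-- The Hilbert space valued function with given components. -/
noncomputable def vec (f : ι → ℝ → ℂ) (x : ℝ) : EuclideanSpace ℂ ι :=
  WithLp.toLp 2 (fun i => f i x)

variable [Fintype ι]

lemma stronglyMeasurable_vec {f : ι → ℝ → ℂ} (hf : ∀ i, StronglyMeasurable (f i)) :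
    StronglyMeasurable (vec f) := by
  have : StronglyMeasurable (fun x => fun i => f i x) :=
    (measurable_pi_lambda _ fun i => (hf i).measurable).stronglyMeasurable
  exact (PiLp.continuous_toLp 2 (fun _ : ι => ℂ)).comp_stronglyMeasurable this

lemma norm_vec_le (f : ι → ℝ → ℂ) (x : ℝ) : ‖vec f x‖ ≤ ∑ i, ‖f i x‖ := by
  rw [EuclideanSpace.norm_eq]
  refine Real.sqrt_le_iff.2 ⟨by positivity, ?_⟩
  exact Finset.sum_sq_le_sq_sum_of_nonneg fun i _ => norm_nonneg _

lemma norm_le_norm_vec (f : ι → ℝ → ℂ) (x : ℝ) (i : ι) : ‖f i x‖ ≤ ‖vec f x‖ :=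
  PiLp.norm_apply_le (vec f x) i

lemma bm_vec {f : ι → ℝ → ℂ} (hf : ∀ i, BM (f i)) : BM (vec f) := by
  choose C hC using fun i => (hf i).2
  exact ⟨stronglyMeasurable_vec fun i => (hf i).1, ∑ i, C i, fun x =>
    (norm_vec_le f x).trans (Finset.sum_le_sum fun i _ => hC i x)⟩

lemma ext_vec_apply {k : ℝ → ℝ → ℝ} (hk : PKernel k) {f : ι → ℝ → ℂ} (hf : ∀ i, BM (f i)) (x : ℝ)
    {y : ℝ} (hy : 0 < y) (i : ι) : ext k (vec f) x y i = ext k (f i) x y := by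
  have h := hk.integrable_ext (bm_vec hf) x hy
  have := ((EuclideanSpace.proj i : EuclideanSpace ℂ ι →L[ℂ] ℂ).restrictScalars
    ℝ).integral_comp_comm h
  exact this.symm

lemma norm_vec_add_smul_le {f : ι → ℝ → ℂ} (hf : ∀ i, BM (f i)) (x : ℝ) {y : ℝ} (hy : 0 < y)
    {c : ℂ} (hc : ‖c‖ = 1) :
    ‖(WithLp.toLp 2 fun i => ext pkx (f i) x y + c * ext pky (f i) x y : EuclideanSpace ℂ ι)‖ ≤
      2 * √(gradSq (vec f) x y) := by
  have : (WithLp.toLp 2 fun i => ext pkx (f i) x y + c * ext pky (f i) x y :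
      EuclideanSpace ℂ ι) = ext pkx (vec f) x y + c • ext pky (vec f) x y := by
    ext i
    simp [ext_vec_apply pKernel_pkx hf x hy, ext_vec_apply pKernel_pky hf x hy]
  rw [this]
  refine (norm_add_le _ _).trans ?_
  rw [norm_smul, hc, one_mul, two_mul]
  refine add_le_add (Real.le_sqrt_of_sq_le ?_) (Real.le_sqrt_of_sq_le ?_)
  · exact le_add_of_nonneg_right (sq_nonneg _)
  · exact le_add_of_nonneg_left (sq_nonneg _)

/-- Vector-valued Littlewood–Paley pairing for normalized functions. -/
theorem exists_norm_integral_theta_le {p q : ℝ} (hpq : p.HolderConjugate q) :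
    ∃ C : ℝ, 0 < C ∧ ∀ (ι κ I : Type) [Fintype ι] [Fintype κ] [Fintype I] (r : I → ι) (s : I → κ)
      (A : I → Set ℝ), (∀ i, MeasurableSet (A i)) → (∀ i, A i ⊆ Ioi 0) →
      (∀ y, ∀ (u : EuclideanSpace ℂ ι) (v : EuclideanSpace ℂ κ),
        ∑ i, (A i).indicator (fun _ => ‖u (r i)‖ * ‖v (s i)‖) y ≤ ‖u‖ * ‖v‖) →
      ∀ (F : ι → ℝ → ℂ) (ψ : κ → ℝ → ℂ), (∀ i, Integrable (F i)) → (∀ k, BM (ψ k)) →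
      (∀ k, Integrable (ψ k)) → Integrable (fun t => ‖vec (fun i => ift (F i)) t‖ ^ p) →
      Integrable (fun t => ‖vec ψ t‖ ^ q) → ∫ t, ‖vec (fun i => ift (F i)) t‖ ^ p ≤ 1 →
      ∫ t, ‖vec ψ t‖ ^ q ≤ 1 →
      ‖∑ i, ∫ ξ, (theta (A i) ξ : ℂ) * F (r i) ξ * ift (ψ (s i)) ξ‖ ≤ C := by
  obtain ⟨C, hC, h⟩ := exists_lintegral_grad_mul_grad_le hpq
  refine ⟨4 * C, by positivity, ?_⟩
  intro ι κ I _ _ _ r s A hA hA0 hAe F ψ hF hψ hi hFp hψq hF1 hψ1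
  have hb : ∀ i, BM (ift (F i)) := fun i => bm_ift (hF i)
  have key := h _ _ (vec fun i => ift (F i)) (vec ψ) (bm_vec hb) (bm_vec hψ) hFp hψq hF1 hψ1
  set D : ι → ℝ → ℝ → ℂ := fun i y x => ift (fun ξ => symD y ξ * F i ξ) x with hD
  set V : κ → ℝ → ℝ → ℂ := fun k y x => ext pkx (ψ k) x y + Complex.I * ext pky (ψ k) x y with hV
  have hth := fun i => integral_theta_mul (hA i) (hA0 i) (hF (r i)) (hψ (s i)) (hi (s i))
  have hint : ∀ i, Integrable ((A i).indicator fun y : ℝ =>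
      (y : ℂ) * ∫ x, D (r i) y x * V (s i) y x) :=
    fun i => (integrable_indicator_iff (hA i)).2 (hth i).1
  have e1 : ∑ i, ∫ ξ, (theta (A i) ξ : ℂ) * F (r i) ξ * ift (ψ (s i)) ξ =
      ∫ y, ∑ i, (A i).indicator (fun y : ℝ => (y : ℂ) * ∫ x, D (r i) y x * V (s i) y x) y := by
    rw [integral_finsetSum _ fun i _ => hint i]
    refine Finset.sum_congr rfl fun i _ => ?_
    rw [(hth i).2, integral_indicator (hA i)]
  have e2 : ∫ y, ∑ i, (A i).indicator (fun y : ℝ => (y : ℂ) * ∫ x, D (r i) y x * V (s i) y x) y =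
      ∫ y in Ioi 0,
        ∑ i, (A i).indicator (fun y : ℝ => (y : ℂ) * ∫ x, D (r i) y x * V (s i) y x) y := by
    rw [setIntegral_eq_integral_of_forall_compl_eq_zero]
    intro y hy
    exact Finset.sum_eq_zero fun i _ => indicator_of_notMem (fun h => hy (hA0 i h)) _
  have hbd : ‖∫ y in Ioi 0,
      ∑ i, (A i).indicator (fun y : ℝ => (y : ℂ) * ∫ x, D (r i) y x * V (s i) y x) y‖ₑ ≤
      ENNReal.ofReal (4 * C) := by
    refine (enorm_integral_le_lintegral_enorm _).trans ?_
    rw [ENNReal.ofReal_mul (by norm_num)]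
    refine le_trans ?_ (mul_le_mul_right key _)
    rw [← lintegral_const_mul' _ _ ENNReal.ofReal_ne_top]
    refine setLIntegral_mono' measurableSet_Ioi fun y hy => ?_
    have hy0 : 0 < y := hy
    rw [← lintegral_const_mul' _ _ ENNReal.ofReal_ne_top]
    have hDV : ∀ i k, Integrable (fun x => D i y x * V k y x) := fun i k => by
      obtain ⟨B, hB⟩ := (bm_ift (integrable_symD_mul hy0 (hF i))).2
      exact (integrable_ext_add (hψ k) (hi k) hy0).bdd_mul
        (continuous_ift (integrable_symD_mul hy0 (hF i))).aestronglyMeasurable (ae_of_all _ hB)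
    have e3 : ∑ i, (A i).indicator (fun y : ℝ => (y : ℂ) * ∫ x, D (r i) y x * V (s i) y x) y =
        ∫ x, (y : ℂ) * ∑ i, (A i).indicator (fun y => D (r i) y x * V (s i) y x) y := by
      rw [integral_const_mul, integral_finsetSum, Finset.mul_sum]
      · refine Finset.sum_congr rfl fun i _ => ?_
        by_cases hyA : y ∈ A i <;> simp [hyA]
      · intro i _
        by_cases hyA : y ∈ A i <;> simp [hyA, hDV]
    rw [e3]
    refine (enorm_integral_le_lintegral_enorm _).trans (lintegral_mono fun x => ?_)
    rw [← ENNReal.ofReal_mul (by norm_num), ← ofReal_norm]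
    refine ENNReal.ofReal_le_ofReal ?_
    set u : EuclideanSpace ℂ ι := WithLp.toLp 2 fun i => D i y x
    set v : EuclideanSpace ℂ κ := WithLp.toLp 2 fun k => V k y x
    have hu : ‖u‖ ≤ 2 * √(gradSq (vec fun i => ift (F i)) x y) := by
      have := norm_vec_add_smul_le hb x hy0 (c := -Complex.I) (by simp)
      simp only [neg_mul, ← sub_eq_add_neg, ext_sub_I_mul_ext (hF _) x hy0] at this
      exact this
    have hv : ‖v‖ ≤ 2 * √(gradSq (vec ψ) x y) :=
      norm_vec_add_smul_le hψ x hy0 (by simp)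
    rw [norm_mul, Complex.norm_real, Real.norm_eq_abs, abs_of_pos hy0]
    calc _ ≤ y * (‖u‖ * ‖v‖) := by
          gcongr
          refine (norm_sum_le _ _).trans (le_trans (le_of_eq ?_) (hAe y u v))
          refine Finset.sum_congr rfl fun i _ => ?_
          by_cases hyA : y ∈ A i <;> simp [hyA, u, v]
      _ ≤ y * ((2 * √(gradSq (vec fun i => ift (F i)) x y)) * (2 * √(gradSq (vec ψ) x y))) := by
          gcongr
      _ = _ := by ring
  rw [e1, e2]
  rw [← ofReal_norm] at hbd
  exact (ENNReal.ofReal_le_ofReal_iff (by positivity)).1 hbd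

end PoissonLP

namespace PoissonLP
open Filter Topology

lemma eLpNorm_le_ofReal_iff {E : Type*} [NormedAddCommGroup E] {f : ℝ → E} {p a : ℝ} (hp : 0 < p)
    (ha : 0 ≤ a) : eLpNorm f (ENNReal.ofReal p) volume ≤ ENNReal.ofReal a ↔
      ∫⁻ x, ‖f x‖ₑ ^ p ≤ ENNReal.ofReal (a ^ p) := by
  rw [eLpNorm_eq_lintegral_rpow_enorm_toReal (by simpa using hp) ENNReal.ofReal_ne_top,
    ENNReal.toReal_ofReal hp.le, one_div, ENNReal.rpow_inv_le_iff hp,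
    ENNReal.ofReal_rpow_of_nonneg ha hp.le]

lemma integrable_norm_rpow_of_eLpNorm_le {E : Type*} [NormedAddCommGroup E] {f : ℝ → E} {p a : ℝ}
    (hp : 0 < p) (ha : 0 ≤ a) (hf : StronglyMeasurable f)
    (h : eLpNorm f (ENNReal.ofReal p) volume ≤ ENNReal.ofReal a) :
    Integrable (fun t => ‖f t‖ ^ p) ∧ ∫ t, ‖f t‖ ^ p ≤ a ^ p := by
  have h1 := (eLpNorm_le_ofReal_iff hp ha).1 h
  have e : ∀ x, ‖f x‖ₑ ^ p = ENNReal.ofReal (‖f x‖ ^ p) := fun x => by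
    rw [← ENNReal.ofReal_rpow_of_nonneg (norm_nonneg _) hp.le, ofReal_norm]
  simp only [e] at h1
  have hm : AEStronglyMeasurable (fun t => ‖f t‖ ^ p) volume :=
    (hf.norm.measurable.pow_const p).aestronglyMeasurable
  have hn : 0 ≤ᵐ[volume] (fun t => ‖f t‖ ^ p) := ae_of_all _ fun t => by positivity
  refine ⟨⟨hm, ?_⟩, ?_⟩
  · rw [hasFiniteIntegral_iff_ofReal hn]
    exact h1.trans_lt ENNReal.ofReal_lt_top
  · rw [integral_eq_lintegral_of_nonneg_ae hn hm]
    exact ENNReal.toReal_le_of_le_ofReal (by positivity) h1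

variable {ι κ : Type} [Fintype ι] [Fintype κ]

lemma norm_sum_mul_le (u v : EuclideanSpace ℂ κ) : ∑ k, ‖u k‖ * ‖v k‖ ≤ ‖u‖ * ‖v‖ := by
  rw [EuclideanSpace.norm_eq, EuclideanSpace.norm_eq]
  exact Real.sum_mul_le_sqrt_mul_sqrt _ _ _

lemma sum_integral_mul_ift {G ψ : κ → ℝ → ℂ} (hG : ∀ k, Integrable (G k))
    (hψ : ∀ k, Integrable (ψ k)) :
    ∑ k, ∫ ξ, G k ξ * ift (ψ k) ξ = ∫ x, ∑ k, ψ k x * ift (G k) x := by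
  rw [integral_finsetSum]
  · exact Finset.sum_congr rfl fun k _ => (integral_mul_ift (hψ k) (hG k)).symm
  · intro k _
    obtain ⟨B, hB⟩ := (bm_ift (hG k)).2
    exact (hψ k).mul_bdd (bm_ift (hG k)).1.aestronglyMeasurable (ae_of_all _ hB)

lemma norm_sum_integral_le {p q a b : ℝ} (hpq : p.HolderConjugate q) {G ψ : κ → ℝ → ℂ}
    (hG : ∀ k, Integrable (G k)) (hb : ∀ k, BM (ψ k)) (hψ : ∀ k, Integrable (ψ k)) (ha : 0 ≤ a)
    (hb0 : 0 ≤ b)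
    (h1 : eLpNorm (vec fun k => ift (G k)) (ENNReal.ofReal p) volume ≤ ENNReal.ofReal a)
    (h2 : eLpNorm (vec ψ) (ENNReal.ofReal q) volume ≤ ENNReal.ofReal b) :
    ‖∑ k, ∫ ξ, G k ξ * ift (ψ k) ξ‖ ≤ a * b := by
  have hm1 := (bm_vec fun k => bm_ift (hG k)).1
  have hm2 := (bm_vec hb).1
  rw [sum_integral_mul_ift hG hψ]
  have : ‖∫ x, ∑ k, ψ k x * ift (G k) x‖ₑ ≤ ENNReal.ofReal (a * b) := by
    refine (enorm_integral_le_lintegral_enorm _).trans ?_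
    calc _ ≤ ∫⁻ x, ((fun x => ‖vec (fun k => ift (G k)) x‖ₑ) * (fun x => ‖vec ψ x‖ₑ)) x := by
          refine lintegral_mono fun x => ?_
          simp only [Pi.mul_apply, ← ofReal_norm]
          rw [← ENNReal.ofReal_mul (norm_nonneg _)]
          refine ENNReal.ofReal_le_ofReal ((norm_sum_le _ _).trans ?_)
          refine le_trans (le_of_eq ?_) (norm_sum_mul_le _ _)
          refine Finset.sum_congr rfl fun k _ => ?_
          rw [norm_mul, mul_comm]; rfl
      _ ≤ _ :=
        ENNReal.lintegral_mul_le_Lp_mul_Lq _ hpq hm1.enorm.aemeasurable hm2.enorm.aemeasurable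
      _ ≤ _ := by
          rw [ENNReal.ofReal_mul ha]
          rw [eLpNorm_eq_lintegral_rpow_enorm_toReal (by simpa using hpq.pos) ENNReal.ofReal_ne_top,
            ENNReal.toReal_ofReal hpq.pos.le] at h1
          rw [eLpNorm_eq_lintegral_rpow_enorm_toReal (by simpa using hpq.symm.pos)
            ENNReal.ofReal_ne_top, ENNReal.toReal_ofReal hpq.symm.pos.le] at h2
          exact mul_le_mul' h1 h2
  rw [← ofReal_norm] at this
  exact (ENNReal.ofReal_le_ofReal_iff (by positivity)).1 this

/-- Converse of Hölder's inequality for vector-valued inverse Fourier transforms. -/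
lemma eLpNorm_le_of_pairing {p q B : ℝ} (hpq : p.HolderConjugate q) (hB : 0 ≤ B) {G : κ → ℝ → ℂ}
    (hG : ∀ k, Integrable (G k))
    (h : ∀ ψ : κ → ℝ → ℂ, (∀ k, BM (ψ k)) → (∀ k, Integrable (ψ k)) → ∀ b, 0 < b →
      eLpNorm (vec ψ) (ENNReal.ofReal q) volume ≤ ENNReal.ofReal b →
      ‖∑ k, ∫ ξ, G k ξ * ift (ψ k) ξ‖ ≤ B * b) :
    eLpNorm (vec fun k => ift (G k)) (ENNReal.ofReal p) volume ≤ ENNReal.ofReal B := by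
  have hp0 := hpq.pos
  have hq0 := hpq.symm.pos
  have hp1 := hpq.lt
  set Φ : ℝ → EuclideanSpace ℂ κ := vec fun k => ift (G k) with hΦ
  have hbΦ : BM Φ := bm_vec fun k => bm_ift (hG k)
  obtain ⟨M, hM⟩ := hbΦ.2
  have hM0 : 0 ≤ M := (norm_nonneg _).trans (hM 0)
  rw [eLpNorm_le_ofReal_iff hp0 hB]
  have hU : (⋃ n : ℕ, Icc (-(n : ℝ)) n) = univ := by
    refine eq_univ_of_forall fun x => ?_
    obtain ⟨n, hn⟩ := exists_nat_ge |x|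
    exact mem_iUnion.2 ⟨n, abs_le.1 hn⟩
  have hdir : Directed (· ⊆ ·) (fun n : ℕ => Icc (-(n : ℝ)) n) := by
    refine Monotone.directed_le fun m n hmn => ?_
    have : (m : ℝ) ≤ n := by exact_mod_cast hmn
    exact Icc_subset_Icc (by linarith) this
  rw [← setLIntegral_univ, ← hU, setLIntegral_iUnion_of_directed _ hdir]
  refine iSup_le fun n => ?_
  set s := Icc (-(n : ℝ)) n
  have hs : MeasurableSet s := measurableSet_Icc
  have hsv : volume s ≠ ∞ := by simp [s]
  have e : ∀ x, ‖Φ x‖ₑ ^ p = ENNReal.ofReal (‖Φ x‖ ^ p) := fun x => by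
    rw [← ENNReal.ofReal_rpow_of_nonneg (norm_nonneg _) hp0.le, ofReal_norm]
  have hΦp : IntegrableOn (fun x => ‖Φ x‖ ^ p) s := by
    refine Measure.integrableOn_of_bounded (M := M ^ p) hsv
      (hbΦ.1.norm.measurable.pow_const p).aestronglyMeasurable (ae_of_all _ fun x => ?_)
    rw [Real.norm_eq_abs, abs_of_nonneg (by positivity)]
    exact Real.rpow_le_rpow (norm_nonneg _) (hM x) hp0.le
  set S := ∫ x in s, ‖Φ x‖ ^ p with hS
  have hS0 : 0 ≤ S := integral_nonneg fun x => by positivity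
  have hSl : ∫⁻ x in s, ‖Φ x‖ₑ ^ p = ENNReal.ofReal S := by
    simp only [e]
    rw [hS, ofReal_integral_eq_lintegral_ofReal hΦp (ae_of_all _ fun x => by positivity)]
  rw [hSl]
  refine ENNReal.ofReal_le_ofReal ?_
  rcases hS0.eq_or_lt with h0 | h0
  · rw [← h0]; positivity
  set ψ : κ → ℝ → ℂ := fun k => s.indicator fun x => star (Φ x k) * ((‖Φ x‖ ^ (p - 2) : ℝ) : ℂ)
  have hcomp : ∀ k, StronglyMeasurable fun x => Φ x k := fun k => (bm_ift (hG k)).1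
  have hψm : ∀ k, StronglyMeasurable (ψ k) := fun k => by
    refine StronglyMeasurable.indicator (StronglyMeasurable.mul ?_ ?_) hs
    · exact continuous_star.comp_stronglyMeasurable (hcomp k)
    · exact Complex.continuous_ofReal.comp_stronglyMeasurable
        (hbΦ.1.norm.measurable.pow_const (p - 2)).stronglyMeasurable
  have hvec : ∀ x, ‖vec ψ x‖ = s.indicator (fun x => ‖Φ x‖ ^ (p - 1)) x := fun x => by
    by_cases hx : x ∈ s
    · have : vec ψ x = ((‖Φ x‖ ^ (p - 2) : ℝ) : ℂ) • WithLp.toLp 2 (fun k => star (Φ x k)) := by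
        ext k; simp [vec, ψ, hx, mul_comm]
      rw [this, norm_smul, Complex.norm_real, Real.norm_eq_abs, abs_of_nonneg (by positivity)]
      have h2 : ‖(WithLp.toLp 2 (fun k => star (Φ x k)) : EuclideanSpace ℂ κ)‖ = ‖Φ x‖ := by
        rw [EuclideanSpace.norm_eq, EuclideanSpace.norm_eq]; simp
      rw [h2, indicator_of_mem hx]
      rcases (norm_nonneg (Φ x)).eq_or_lt with hz | hz
      · rw [← hz, mul_zero, Real.zero_rpow (by linarith)]
      · rw [← Real.rpow_add_one hz.ne']; congr 1; ring
    · have : vec ψ x = 0 := by ext k; simp [vec, ψ, hx]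
      rw [this, indicator_of_notMem hx, norm_zero]
  have hψb : ∀ k x, ‖ψ k x‖ ≤ M ^ (p - 1) := fun k x => by
    refine (norm_le_norm_vec ψ x k).trans ?_
    rw [hvec]
    by_cases hx : x ∈ s
    · rw [indicator_of_mem hx]
      exact Real.rpow_le_rpow (norm_nonneg _) (hM x) (by linarith)
    · rw [indicator_of_notMem hx]; positivity
  have hψi : ∀ k, Integrable (ψ k) := fun k => by
    have : IntegrableOn (ψ k) s :=
      Measure.integrableOn_of_bounded hsv (hψm k).aestronglyMeasurable (ae_of_all _ (hψb k))
    refine (integrable_indicator_iff hs).2 (this.congr_fun (fun x hx => ?_) hs)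
    exact indicator_of_mem hx _
  have hb : 0 < S ^ (1 / q) := by positivity
  have hq : eLpNorm (vec ψ) (ENNReal.ofReal q) volume ≤ ENNReal.ofReal (S ^ (1 / q)) := by
    rw [eLpNorm_le_ofReal_iff hq0 hb.le, ← Real.rpow_mul hS0, one_div, inv_mul_cancel₀ hq0.ne',
      Real.rpow_one, ← hSl, ← lintegral_indicator hs]
    refine lintegral_mono fun x => ?_
    rw [← ofReal_norm, hvec]
    by_cases hx : x ∈ s
    · rw [indicator_of_mem hx, indicator_of_mem hx, e,
        ENNReal.ofReal_rpow_of_nonneg (by positivity) hq0.le, ← Real.rpow_mul (norm_nonneg _),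
        hpq.sub_one_mul_conj]
    · simp [indicator_of_notMem hx, ENNReal.zero_rpow_of_pos hq0]
  have key := h ψ (fun k => ⟨hψm k, _, hψb k⟩) hψi _ hb hq
  rw [sum_integral_mul_ift hG hψi] at key
  have hval : ∫ x, ∑ k, ψ k x * ift (G k) x = (S : ℂ) := by
    rw [hS, ← integral_complex_ofReal, ← integral_indicator hs]
    refine integral_congr_ae (ae_of_all _ fun x => ?_)
    by_cases hx : x ∈ s
    · simp only [ψ, indicator_of_mem hx]
      have h2 : ∑ k, star (Φ x k) * ift (G k) x = ((‖Φ x‖ ^ 2 : ℝ) : ℂ) := by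
        rw [EuclideanSpace.norm_sq_eq]; push_cast
        refine Finset.sum_congr rfl fun k _ => ?_
        exact Complex.conj_mul' _
      calc _ = ((‖Φ x‖ ^ (p - 2) : ℝ) : ℂ) * ∑ k, star (Φ x k) * ift (G k) x := by
            rw [Finset.mul_sum]; exact Finset.sum_congr rfl fun k _ => by ring
        _ = _ := by
            rw [h2, ← Complex.ofReal_mul]; congr 1
            rcases (norm_nonneg (Φ x)).eq_or_lt with hz | hz
            · rw [← hz, Real.zero_rpow hp0.ne']; norm_num
            · rw [← Real.rpow_two, ← Real.rpow_add hz]; congr 1; ring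
    · simp [ψ, indicator_of_notMem hx]
  rw [hval, Complex.norm_real, Real.norm_eq_abs, abs_of_pos h0] at key
  have h3 : S ^ (1 / p) ≤ B := by
    have : S = S ^ (1 / p) * S ^ (1 / q) := by
      rw [← Real.rpow_add h0, one_div, one_div, hpq.inv_add_inv_eq_one, Real.rpow_one]
    rw [this] at key
    nth_rewrite 2 [← this] at key
    exact le_of_mul_le_mul_right key hb
  calc S = (S ^ (1 / p)) ^ p := by
        rw [← Real.rpow_mul h0.le, one_div, inv_mul_cancel₀ hp0.ne', Real.rpow_one]
    _ ≤ B ^ p := by gcongr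

end PoissonLP

namespace PoissonLP
open Filter Topology

lemma stronglyMeasurable_theta (A : Set ℝ) : StronglyMeasurable (theta A) := by
  unfold theta
  exact StronglyMeasurable.integral_prod_right (f := fun ξ y => dens y ξ)
    continuous_dens.stronglyMeasurable

lemma theta_nonneg {A : Set ℝ} (hA : MeasurableSet A) (hA0 : A ⊆ Ioi 0) (ξ : ℝ) :
    0 ≤ theta A ξ :=
  setIntegral_nonneg hA fun _ hy => dens_nonneg (le_of_lt (hA0 hy)) ξ

lemma theta_le_one {A : Set ℝ} (hA0 : A ⊆ Ioi 0) (ξ : ℝ) : theta A ξ ≤ 1 := by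
  refine (setIntegral_mono_set (integrableOn_dens ξ) ?_ hA0.eventuallyLE).trans ?_
  · filter_upwards [ae_restrict_mem measurableSet_Ioi] with _ hy using dens_nonneg (le_of_lt hy) ξ
  · rcases le_or_gt ξ 0 with h | h
    · simp [dens_of_nonpos h]
    · exact (integral_dens h).le

lemma theta_Ioi (ξ : ℝ) : theta (Ioi 0) ξ = (Ioi 0).indicator 1 ξ := by
  by_cases h : 0 < ξ
  · simp [theta, integral_dens h, h]
  · simp [theta, dens_of_nonpos (not_lt.1 h), h]

lemma integrable_theta_mul {A : Set ℝ} (hA : MeasurableSet A) (hA0 : A ⊆ Ioi 0) {F : ℝ → ℂ}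
    (hF : Integrable F) : Integrable (fun ξ => (theta A ξ : ℂ) * F ξ) := by
  refine hF.bdd_mul (c := 1) (Complex.continuous_ofReal.comp_stronglyMeasurable
    (stronglyMeasurable_theta A)).aestronglyMeasurable (ae_of_all _ fun ξ => ?_)
  rw [Complex.norm_real, Real.norm_eq_abs, abs_of_nonneg (theta_nonneg hA hA0 ξ)]
  exact theta_le_one hA0 ξ

section
variable {ι κ l : Type} [Fintype ι] [Fintype κ] [Fintype l]

/-- The operator `T` on Fourier transforms is bounded on vector-valued `L^p` with constant `C`. -/
def MB (p C : ℝ) (T : (ι → ℝ → ℂ) → κ → ℝ → ℂ) : Prop :=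
  ∀ F : ι → ℝ → ℂ, (∀ i, Integrable (F i)) → (∀ k, Integrable (T F k)) ∧ ∀ a, 0 < a →
    eLpNorm (vec fun i => ift (F i)) (ENNReal.ofReal p) volume ≤ ENNReal.ofReal a →
    eLpNorm (vec fun k => ift (T F k)) (ENNReal.ofReal p) volume ≤ ENNReal.ofReal (C * a)

lemma MB.comp {p C D : ℝ} (hD : 0 < D) {T : (κ → ℝ → ℂ) → l → ℝ → ℂ} {S : (ι → ℝ → ℂ) → κ → ℝ → ℂ}
    (hT : MB p C T) (hS : MB p D S) : MB p (C * D) (fun F => T (S F)) := fun F hF =>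
  ⟨(hT _ (hS F hF).1).1, fun a ha h => by
    rw [mul_assoc]; exact (hT _ (hS F hF).1).2 _ (by positivity) ((hS F hF).2 a ha h)⟩

lemma ift_sub {F G : ℝ → ℂ} (hF : Integrable F) (hG : Integrable G) (x : ℝ) :
    ift (fun ξ => F ξ - G ξ) x = ift F x - ift G x := by
  rw [ift, ift, ift, ← integral_sub (Integrable.mul_eChar hF x) (Integrable.mul_eChar hG x)]
  simp only [sub_mul]

lemma ift_const_mul (c : ℂ) (F : ℝ → ℂ) (x : ℝ) : ift (fun ξ => c * F ξ) x = c * ift F x := by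
  rw [ift, ift, ← integral_const_mul]; simp only [mul_assoc]

lemma ift_finset_sum {J : Type} (s : Finset J) {F : J → ℝ → ℂ} (hF : ∀ j, Integrable (F j))
    (x : ℝ) :
    ift (fun ξ => ∑ j ∈ s, F j ξ) x = ∑ j ∈ s, ift (F j) x := by
  simp only [ift, Finset.sum_mul]
  exact integral_finsetSum _ fun j _ => Integrable.mul_eChar (hF j) x

lemma eLpNorm_vec_sub_le {p a b : ℝ} (hp : 1 ≤ p) (ha : 0 ≤ a) (hb : 0 ≤ b) {f g : κ → ℝ → ℂ}
    (hf : ∀ k, StronglyMeasurable (f k)) (hg : ∀ k, StronglyMeasurable (g k))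
    (h1 : eLpNorm (vec f) (ENNReal.ofReal p) volume ≤ ENNReal.ofReal a)
    (h2 : eLpNorm (vec g) (ENNReal.ofReal p) volume ≤ ENNReal.ofReal b) :
    eLpNorm (vec fun k x => f k x - g k x) (ENNReal.ofReal p) volume ≤ ENNReal.ofReal (a + b) := by
  have : (vec fun k x => f k x - g k x) = vec f - vec g := by
    ext x k; simp [vec]
  rw [this, ENNReal.ofReal_add ha hb]
  exact (eLpNorm_sub_le (stronglyMeasurable_vec hf).aestronglyMeasurable
    (stronglyMeasurable_vec hg).aestronglyMeasurable (by simpa using hp)).trans (add_le_add h1 h2)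

lemma MB.sub {p C D : ℝ} (hp : 1 ≤ p) (hC : 0 ≤ C) (hD : 0 ≤ D) {T S : (ι → ℝ → ℂ) → κ → ℝ → ℂ}
    (hT : MB p C T) (hS : MB p D S) : MB p (C + D) (fun F k ξ => T F k ξ - S F k ξ) :=
  fun F hF => by
  have h1 := (hT F hF).1
  have h2 := (hS F hF).1
  refine ⟨fun k => (h1 k).sub (h2 k), fun a ha h => ?_⟩
  have e : (vec fun k => ift fun ξ => T F k ξ - S F k ξ) =
      vec fun k x => ift (T F k) x - ift (S F k) x := by
    ext x k; exact ift_sub (h1 k) (h2 k) x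
  rw [e, add_mul]
  exact eLpNorm_vec_sub_le hp (by positivity) (by positivity) (fun k => (bm_ift (h1 k)).1)
    (fun k => (bm_ift (h2 k)).1) ((hT F hF).2 a ha h) ((hS F hF).2 a ha h)

end

lemma eLpNorm_vec_const_mul {κ : Type} [Fintype κ] (c : ℂ) (f : κ → ℝ → ℂ) (p : ℝ≥0∞) :
    eLpNorm (vec fun k x => c * f k x) p volume = ‖c‖ₑ * eLpNorm (vec f) p volume := by
  have : (vec fun k x => c * f k x) = c • vec f := by ext x k; simp [vec]
  rw [this, eLpNorm_const_smul]

lemma eLpNorm_vec_inv_mul_le {κ : Type} [Fintype κ] {a : ℝ} (ha : 0 < a) {f : κ → ℝ → ℂ}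
    {p : ℝ≥0∞} (h : eLpNorm (vec f) p volume ≤ ENNReal.ofReal a) :
    eLpNorm (vec fun k x => ((a⁻¹ : ℝ) : ℂ) * f k x) p volume ≤ ENNReal.ofReal 1 := by
  rw [eLpNorm_vec_const_mul, ← ofReal_norm, Complex.norm_real, Real.norm_eq_abs,
    abs_of_pos (inv_pos.2 ha)]
  refine (mul_le_mul_right h _).trans ?_
  rw [← ENNReal.ofReal_mul (inv_pos.2 ha).le, inv_mul_cancel₀ ha.ne']

/-- Boundedness of the operators whose symbols are built from the `theta (A i)`. -/
theorem exists_mb_theta {p q : ℝ} (hpq : p.HolderConjugate q) :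
    ∃ C : ℝ, 0 < C ∧ ∀ (ι κ I : Type) [Fintype ι] [Fintype κ] [DecidableEq κ] [Fintype I]
      (r : I → ι) (s : I → κ)
      (A : I → Set ℝ), (∀ i, MeasurableSet (A i)) → (∀ i, A i ⊆ Ioi 0) →
      (∀ y, ∀ (u : EuclideanSpace ℂ ι) (v : EuclideanSpace ℂ κ),
        ∑ i, (A i).indicator (fun _ => ‖u (r i)‖ * ‖v (s i)‖) y ≤ ‖u‖ * ‖v‖) →
      MB p C (fun (F : ι → ℝ → ℂ) k ξ =>
        ∑ i, if s i = k then (theta (A i) ξ : ℂ) * F (r i) ξ else 0)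
      := by
  obtain ⟨C, hC, h⟩ := exists_norm_integral_theta_le hpq
  refine ⟨C, hC, ?_⟩
  intro ι κ I _ _ _ _ r s A hA hA0 hAe F hF
  have hi : ∀ i k, Integrable (fun ξ =>
      if s i = k then (theta (A i) ξ : ℂ) * F (r i) ξ else 0) := by
    intro i k
    by_cases hk : s i = k
    · simpa [hk] using integrable_theta_mul (hA i) (hA0 i) (hF (r i))
    · simp [hk]
  have hi' := fun k => integrable_finsetSum Finset.univ fun i _ => hi i k
  refine ⟨hi', fun a ha hFa => ?_⟩
  refine eLpNorm_le_of_pairing hpq (by positivity) hi' fun ψ hψ hψi b hb hψb => ?_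
  have e : ∑ k, ∫ ξ, (∑ i, if s i = k then (theta (A i) ξ : ℂ) * F (r i) ξ else 0) * ift (ψ k) ξ =
      ∑ i, ∫ ξ, (theta (A i) ξ : ℂ) * F (r i) ξ * ift (ψ (s i)) ξ := by
    have : ∀ k, ∫ ξ, (∑ i, if s i = k then (theta (A i) ξ : ℂ) * F (r i) ξ else 0) * ift (ψ k) ξ =
        ∑ i, ∫ ξ, (if s i = k then (theta (A i) ξ : ℂ) * F (r i) ξ else 0) * ift (ψ k) ξ := by
      intro k
      obtain ⟨B, hB⟩ := (bm_ift (hψi k)).2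
      rw [← integral_finsetSum]
      · simp only [Finset.sum_mul]
      · exact fun i _ => (hi i k).mul_bdd (bm_ift (hψi k)).1.aestronglyMeasurable (ae_of_all _ hB)
    simp only [this]
    rw [Finset.sum_comm]
    refine Finset.sum_congr rfl fun i _ => ?_
    rw [Finset.sum_eq_single (s i)]
    · simp
    · intro k _ hk; simp [hk.symm]
    · simp
  rw [e]
  have hp0 := hpq.pos
  have hq0 := hpq.symm.pos
  set F' : ι → ℝ → ℂ := fun i ξ => ((a⁻¹ : ℝ) : ℂ) * F i ξ
  set ψ' : κ → ℝ → ℂ := fun i ξ => ((b⁻¹ : ℝ) : ℂ) * ψ i ξ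
  have hF' : ∀ i, Integrable (F' i) := fun i => (hF i).const_mul _
  have hψ' : ∀ k, Integrable (ψ' k) := fun i => (hψi i).const_mul _
  have hψbm : ∀ k, BM (ψ' k) := fun k => by
    obtain ⟨B, hB⟩ := (hψ k).2
    refine ⟨(hψ k).1.const_mul _, ‖((b⁻¹ : ℝ) : ℂ)‖ * B, fun x => ?_⟩
    simp only [ψ', norm_mul]
    exact mul_le_mul_of_nonneg_left (hB x) (norm_nonneg _)
  have n1 := eLpNorm_vec_inv_mul_le ha hFa
  have n2 := eLpNorm_vec_inv_mul_le hb hψb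
  have eF : (vec fun i => ift (F' i)) = vec fun i x => ((a⁻¹ : ℝ) : ℂ) * ift (F i) x := by
    ext x i; exact ift_const_mul _ _ _
  rw [← eF] at n1
  obtain ⟨a1, a2⟩ := integrable_norm_rpow_of_eLpNorm_le hp0 zero_le_one
    (bm_vec fun i => bm_ift (hF' i)).1 n1
  obtain ⟨b1, b2⟩ := integrable_norm_rpow_of_eLpNorm_le hq0 zero_le_one (bm_vec hψbm).1 n2
  rw [Real.one_rpow] at a2 b2
  have key := h ι κ I r s A hA hA0 hAe F' ψ' hF' hψbm hψ' a1 b1 a2 b2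
  have e2 : ∑ i, ∫ ξ, (theta (A i) ξ : ℂ) * F' (r i) ξ * ift (ψ' (s i)) ξ =
      ((a⁻¹ * b⁻¹ : ℝ) : ℂ) * ∑ i, ∫ ξ, (theta (A i) ξ : ℂ) * F (r i) ξ * ift (ψ (s i)) ξ := by
    rw [Finset.mul_sum]
    refine Finset.sum_congr rfl fun i _ => ?_
    rw [← integral_const_mul]
    refine integral_congr_ae (ae_of_all _ fun ξ => ?_)
    simp only [F', ψ', ift_const_mul]; push_cast; ring
  rw [e2, norm_mul, Complex.norm_real, Real.norm_eq_abs, abs_of_pos (by positivity)] at key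
  calc _ = a * b * (a⁻¹ * b⁻¹ * ‖∑ i, ∫ ξ, (theta (A i) ξ : ℂ) * F (r i) ξ * ift (ψ (s i)) ξ‖) := by
        field_simp
    _ ≤ a * b * C := by gcongr
    _ = C * a * b := by ring

lemma ift_shift (F : ℝ → ℂ) (s x : ℝ) :
    ift (fun ξ => F (ξ + s)) x = eChar (-s) x * ift F x := by
  rw [ift, ift, ← integral_add_right_eq_self (fun ξ => F ξ * eChar ξ x) s, ← integral_const_mul]
  refine integral_congr_ae (ae_of_all _ fun ξ => ?_)
  simp only [eChar_add]
  linear_combination (-F (ξ + s) * eChar ξ x) * eChar_neg_mul s x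

lemma norm_ift_shift (F : ℝ → ℂ) (s x : ℝ) : ‖ift (fun ξ => F (ξ + s)) x‖ = ‖ift F x‖ := by
  rw [ift_shift, norm_mul, norm_eChar, one_mul]

lemma eLpNorm_vec_congr_norm {κ : Type} [Fintype κ] {f g : κ → ℝ → ℂ} {p : ℝ≥0∞}
    (h : ∀ k x, ‖f k x‖ = ‖g k x‖) : eLpNorm (vec f) p volume = eLpNorm (vec g) p volume := by
  refine eLpNorm_congr_norm_ae (ae_of_all _ fun x => ?_)
  rw [EuclideanSpace.norm_eq, EuclideanSpace.norm_eq]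
  simp [vec, h]

/-- Vector-valued Riesz projections onto half-lines. -/
theorem exists_mb_Ioi {p q : ℝ} (hpq : p.HolderConjugate q) :
    ∃ C : ℝ, 0 < C ∧ ∀ (κ : Type) [Fintype κ] (s : κ → ℝ),
      MB p C (fun (F : κ → ℝ → ℂ) k ξ => (Ioi (s k)).indicator (F k) ξ) := by
  classical
  obtain ⟨C, hC, h⟩ := exists_mb_theta hpq
  refine ⟨C, hC, ?_⟩
  intro κ _ s F hF
  refine ⟨fun k => (hF k).indicator measurableSet_Ioi, fun a ha hFa => ?_⟩
  have h0 := h κ κ κ id id (fun _ => Ioi 0) (fun _ => measurableSet_Ioi) (fun _ => subset_rfl)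
    (fun y u v => by
      by_cases hy : 0 < y
      · simpa [indicator, hy] using norm_sum_mul_le u v
      · simp only [indicator, mem_Ioi, hy, if_false, Finset.sum_const_zero]; positivity)
  have h1 := (h0 (fun k ξ => F k (ξ + s k)) fun k => (hF k).comp_add_right _).2 a ha (by
    rwa [eLpNorm_vec_congr_norm fun k x => norm_ift_shift (F k) (s k) x])
  rw [eLpNorm_vec_congr_norm fun k x => ?_]
  · exact h1
  rw [← norm_ift_shift _ (s k)]
  congr 2
  ext ξ
  by_cases hξ : 0 < ξ <;> simp [theta_Ioi, indicator, hξ]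

lemma Ioc_indicator_eq (α β : ℝ) (F : ℝ → ℂ) (ξ : ℝ) : (Ioc α β).indicator F ξ =
    (Ioi α).indicator F ξ - (Ioi (max α β)).indicator F ξ := by
  simp only [indicator, mem_Ioc, mem_Ioi, max_lt_iff]
  by_cases h1 : α < ξ <;> by_cases h2 : β < ξ <;> simp [h1, h2, not_le.2, not_lt.1]

theorem exists_mb_Ioc {p q : ℝ} (hpq : p.HolderConjugate q) :
    ∃ C : ℝ, 0 < C ∧ ∀ (κ : Type) [Fintype κ] (α β : κ → ℝ),
      MB p C (fun (F : κ → ℝ → ℂ) k ξ => (Ioc (α k) (β k)).indicator (F k) ξ) := by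
  obtain ⟨C, hC, h⟩ := exists_mb_Ioi hpq
  refine ⟨C + C, by positivity, ?_⟩
  intro κ _ α β
  have := (h κ α).sub hpq.lt.le hC.le hC.le (h κ fun k => max (α k) (β k))
  simpa only [← Ioc_indicator_eq] using this

end PoissonLP

namespace PoissonLP
open Filter Topology

lemma integral_indicator_smooth {c0 c1 : ℝ} {μ μ' : ℝ → ℝ}
    (hμ : ∀ t ∈ Icc c0 c1, HasDerivAt μ (μ' t) t) (hμ' : ContinuousOn μ' (Icc c0 c1))
    {α β y : ℝ} (hy : 0 < y) (h0 : c0 ≤ y * α) (h1 : y * β ≤ c1) {H : ℝ → ℂ} (hH : Integrable H) :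
    IntegrableOn (fun s => (μ' s : ℂ) * ∫ ξ, (Ioc α (min β (s / y))).indicator H ξ) (Ioc c0 c1) ∧
    ∫ ξ, (Ioc α β).indicator (fun ξ => (μ (y * ξ) : ℂ) * H ξ) ξ =
      μ c1 * (∫ ξ, (Ioc α β).indicator H ξ) -
      ∫ s in Ioc c0 c1, (μ' s : ℂ) * ∫ ξ, (Ioc α (min β (s / y))).indicator H ξ := by
  have hi : IntegrableOn μ' (Ioc c0 c1) :=
    (hμ'.integrableOn_compact isCompact_Icc).mono_set Ioc_subset_Icc_self
  set S : Set (ℝ × ℝ) := {z | α < z.1 ∧ z.1 ≤ β ∧ y * z.1 ≤ z.2}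
  have hS : MeasurableSet S :=
    (measurableSet_lt measurable_const measurable_fst).inter
      ((measurableSet_le measurable_fst measurable_const).inter
        (measurableSet_le (measurable_fst.const_mul y) measurable_snd))
  have hF : Integrable (S.indicator fun z : ℝ × ℝ => H z.1 * (μ' z.2 : ℂ))
      (volume.prod (volume.restrict (Ioc c0 c1))) :=
    (hH.mul_prod (Integrable.ofReal (𝕜 := ℂ) hi)).indicator hS
  have es : ∀ ξ s, S.indicator (fun z : ℝ × ℝ => H z.1 * (μ' z.2 : ℂ)) (ξ, s) =
      (μ' s : ℂ) * (Ioc α (min β (s / y))).indicator H ξ := fun ξ s => by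
    simp only [indicator, S, mem_ofPred_eq, mem_Ioc, le_min_iff, le_div_iff₀ hy, mul_comm ξ y]
    split_ifs <;> ring
  have e1 : ∀ s, ∫ ξ, S.indicator (fun z : ℝ × ℝ => H z.1 * (μ' z.2 : ℂ)) (ξ, s) =
      (μ' s : ℂ) * ∫ ξ, (Ioc α (min β (s / y))).indicator H ξ := fun s => by
    simp only [es, integral_const_mul]
  have e2 : ∀ ξ, ∫ s in Ioc c0 c1, S.indicator (fun z : ℝ × ℝ => H z.1 * (μ' z.2 : ℂ)) (ξ, s) =
      (Ioc α β).indicator (fun ξ => ((μ c1 - μ (y * ξ) : ℝ) : ℂ) * H ξ) ξ := fun ξ => by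
    by_cases hξ : ξ ∈ Ioc α β
    · rw [indicator_of_mem hξ]
      have l0 : c0 < y * ξ := h0.trans_lt (mul_lt_mul_of_pos_left hξ.1 hy)
      have l1 : y * ξ ≤ c1 := (mul_le_mul_of_nonneg_left hξ.2 hy.le).trans h1
      have : ∀ s, S.indicator (fun z : ℝ × ℝ => H z.1 * (μ' z.2 : ℂ)) (ξ, s) =
          (Ici (y * ξ)).indicator (fun s => H ξ * (μ' s : ℂ)) s := fun s => by
        simp only [indicator, S, mem_ofPred_eq, mem_Ici, hξ.1, hξ.2, true_and]
      simp only [this]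
      rw [setIntegral_indicator measurableSet_Ici]
      have hset : Ioc c0 c1 ∩ Ici (y * ξ) = Icc (y * ξ) c1 := by
        ext s; simp only [mem_inter_iff, mem_Ioc, mem_Ici, mem_Icc]
        exact ⟨fun h => ⟨h.2, h.1.2⟩, fun h => ⟨⟨l0.trans_le h.1, h.2⟩, h.1⟩⟩
      rw [hset, integral_Icc_eq_integral_Ioc, integral_const_mul, integral_complex_ofReal,
        ← intervalIntegral.integral_of_le l1, intervalIntegral.integral_eq_sub_of_hasDerivAt]
      · ring
      · intro t ht
        rw [uIcc_of_le l1] at ht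
        exact hμ t ⟨l0.le.trans ht.1, ht.2⟩
      · refine ContinuousOn.intervalIntegrable (hμ'.mono ?_)
        rw [uIcc_of_le l1]
        exact Icc_subset_Icc l0.le le_rfl
    · rw [indicator_of_notMem hξ]
      have : ∀ s, S.indicator (fun z : ℝ × ℝ => H z.1 * (μ' z.2 : ℂ)) (ξ, s) = 0 := fun s =>
        indicator_of_notMem (fun h => hξ ⟨h.1, h.2.1⟩) _
      simp [this]
  have hsw := integral_integral_swap
    (f := fun ξ s => S.indicator (fun z : ℝ × ℝ => H z.1 * (μ' z.2 : ℂ)) (ξ, s)) hF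
  have hI1 := hF.integral_prod_left
  have hI2 := hF.integral_prod_right
  simp only [e1, e2] at hsw hI1 hI2
  refine ⟨hI2, ?_⟩
  rw [← hsw, ← integral_const_mul,
    ← integral_sub ((hH.indicator measurableSet_Ioc).const_mul _) hI1]
  refine integral_congr_ae (ae_of_all _ fun ξ => ?_)
  by_cases hξ : ξ ∈ Ioc α β
  · simp only [indicator_of_mem hξ]; push_cast; ring
  · simp only [indicator_of_notMem hξ]; ring

/-- Diagonal multipliers given by uniformly smooth symbols on rescaled intervals. -/
theorem exists_mb_smooth {p q : ℝ} (hpq : p.HolderConjugate q) {c0 c1 : ℝ} (hc : c0 ≤ c1)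
    {μ μ' : ℝ → ℝ}
    (hμ : ∀ t ∈ Icc c0 c1, HasDerivAt μ (μ' t) t) (hμ' : ContinuousOn μ' (Icc c0 c1)) :
    ∃ C : ℝ, 0 < C ∧ ∀ (κ : Type) [Fintype κ] (α β y : κ → ℝ), (∀ k, 0 < y k) →
      (∀ k, c0 ≤ y k * α k) → (∀ k, y k * β k ≤ c1) →
      MB p C (fun (F : κ → ℝ → ℂ) k ξ =>
        (Ioc (α k) (β k)).indicator (fun ξ => (μ (y k * ξ) : ℂ) * F k ξ) ξ) := by
  obtain ⟨C, hC, h⟩ := exists_mb_Ioc hpq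
  have hμc : ContinuousOn μ (Icc c0 c1) := fun t ht => (hμ t ht).continuousAt.continuousWithinAt
  obtain ⟨M, hM⟩ := isCompact_Icc.exists_bound_of_continuousOn hμc
  obtain ⟨M', hM'⟩ := isCompact_Icc.exists_bound_of_continuousOn hμ'
  have hM'0 : 0 ≤ M' := (norm_nonneg _).trans (hM' c0 ⟨le_rfl, hc⟩)
  have hcc : 0 ≤ c1 - c0 := sub_nonneg.2 hc
  refine ⟨(|μ c1| + M' * (c1 - c0) + 1) * C, by positivity, ?_⟩
  intro κ _ α β y hy h0 h1 F hF
  have hG : ∀ k, Integrable (fun ξ =>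
      (Ioc (α k) (β k)).indicator (fun ξ => (μ (y k * ξ) : ℂ) * F k ξ) ξ) := fun k => by
    refine (integrable_indicator_iff measurableSet_Ioc).2 ?_
    have hmem : ∀ ξ ∈ Ioc (α k) (β k), y k * ξ ∈ Icc c0 c1 := fun ξ hξ =>
      ⟨(h0 k).trans (mul_le_mul_of_nonneg_left hξ.1.le (hy k).le),
        (mul_le_mul_of_nonneg_left hξ.2 (hy k).le).trans (h1 k)⟩
    refine Integrable.bdd_mul (c := M) (hF k).integrableOn ?_ ?_
    · refine ContinuousOn.aestronglyMeasurable ?_ measurableSet_Ioc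
      exact Complex.continuous_ofReal.comp_continuousOn
        (hμc.comp (by fun_prop) fun ξ hξ => hmem ξ hξ)
    · filter_upwards [ae_restrict_mem measurableSet_Ioc] with ξ hξ
      rw [Complex.norm_real]
      exact hM _ (hmem ξ hξ)
  refine ⟨hG, fun a ha hFa => ?_⟩
  refine eLpNorm_le_of_pairing hpq (by positivity) hG fun ψ hψ hψi b hb hψb => ?_
  have hslice : ∀ β' : κ → ℝ,
      ‖∑ k, ∫ ξ, (Ioc (α k) (β' k)).indicator (F k) ξ * ift (ψ k) ξ‖ ≤ C * a * b := fun β' =>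
    norm_sum_integral_le hpq (h κ α β' F hF).1 hψ hψi (by positivity) hb.le
      ((h κ α β' F hF).2 a ha hFa) hψb
  have hH : ∀ k, Integrable (fun ξ => F k ξ * ift (ψ k) ξ) := fun k => by
    obtain ⟨B, hB⟩ := (bm_ift (hψi k)).2
    exact (hF k).mul_bdd (bm_ift (hψi k)).1.aestronglyMeasurable (ae_of_all _ hB)
  have hk := fun k => integral_indicator_smooth hμ hμ' (hy k) (h0 k) (h1 k) (hH k)
  have ei : ∀ (s : Set ℝ) (f g : ℝ → ℂ) ξ, s.indicator f ξ * g ξ =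
      s.indicator (fun ξ => f ξ * g ξ) ξ := fun s f g ξ => (indicator_mul_left s f g (i := ξ)).symm
  simp only [ei] at hslice ⊢
  have e1 : ∑ k, ∫ ξ, (Ioc (α k) (β k)).indicator
      (fun ξ => (μ (y k * ξ) : ℂ) * F k ξ * ift (ψ k) ξ) ξ =
      μ c1 * (∑ k, ∫ ξ, (Ioc (α k) (β k)).indicator (fun ξ => F k ξ * ift (ψ k) ξ) ξ) -
      ∫ s in Ioc c0 c1, (μ' s : ℂ) * ∑ k, ∫ ξ, (Ioc (α k) (min (β k) (s / y k))).indicator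
        (fun ξ => F k ξ * ift (ψ k) ξ) ξ := by
    simp only [mul_assoc, Finset.mul_sum]
    rw [integral_finsetSum _ fun k _ => (hk k).1, ← Finset.sum_sub_distrib]
    exact Finset.sum_congr rfl fun k _ => (hk k).2
  rw [e1]
  have e2 : ‖∫ s in Ioc c0 c1, (μ' s : ℂ) * ∑ k, ∫ ξ, (Ioc (α k) (min (β k) (s / y k))).indicator
        (fun ξ => F k ξ * ift (ψ k) ξ) ξ‖ ≤ (M' * (C * a * b)) * (c1 - c0) := by
    have := norm_setIntegral_le_of_norm_le_const (μ := volume) (s := Ioc c0 c1)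
      (C := M' * (C * a * b)) (f := fun s => (μ' s : ℂ) * ∑ k, ∫ ξ,
        (Ioc (α k) (min (β k) (s / y k))).indicator (fun ξ => F k ξ * ift (ψ k) ξ) ξ)
      (by simp) (fun s hs => by
        rw [norm_mul, Complex.norm_real]
        exact mul_le_mul (hM' s ⟨hs.1.le, hs.2⟩) (hslice _) (norm_nonneg _) hM'0)
    simpa [hcc] using this
  calc _ ≤ |μ c1| * (C * a * b) + (M' * (C * a * b)) * (c1 - c0) := by
        refine (norm_sub_le _ _).trans (add_le_add ?_ e2)
        rw [norm_mul, Complex.norm_real, Real.norm_eq_abs]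
        exact mul_le_mul_of_nonneg_left (hslice β) (abs_nonneg _)
    _ ≤ |μ c1| * (C * a * b) + (M' * (C * a * b)) * (c1 - c0) + C * a * b :=
        le_add_of_nonneg_right (by positivity)
    _ = _ := by ring

/-- The profile of `theta (Ioc y (2 * y))` on the positive half-line. -/
noncomputable def thetaProfile (t : ℝ) : ℝ :=
  (1 + 4 * Real.pi * t) * Real.exp (-(4 * Real.pi * t)) -
    (1 + 8 * Real.pi * t) * Real.exp (-(8 * Real.pi * t))

lemma thetaProfile_pos {t : ℝ} (ht : 0 < t) : 0 < thetaProfile t := by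
  have hpi := Real.pi_pos
  have hs : 0 < 4 * Real.pi * t := by positivity
  set s := 4 * Real.pi * t with hsd
  have h1 : Real.exp (-s) = Real.exp s * Real.exp (-(2 * s)) := by
    rw [← Real.exp_add]; congr 1; ring
  have h2 : thetaProfile t = ((1 + s) * Real.exp s - (1 + 2 * s)) * Real.exp (-(2 * s)) := by
    rw [thetaProfile, show 8 * Real.pi * t = 2 * s by rw [hsd]; ring, ← hsd, h1]; ring
  rw [h2]
  refine mul_pos ?_ (Real.exp_pos _)
  have := Real.add_one_le_exp s
  nlinarith

lemma contDiff_thetaProfile : ContDiff ℝ 1 thetaProfile := by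
  unfold thetaProfile; fun_prop

lemma theta_Ioc {y ξ : ℝ} (hy : 0 < y) (hξ : 0 < ξ) :
    theta (Ioc y (2 * y)) ξ = thetaProfile (y * ξ) := by
  have hd : ∀ s : ℝ, HasDerivAt (fun s => -((1 + 4 * Real.pi * s * ξ) *
      Real.exp (-(4 * Real.pi * s * ξ)))) (dens s ξ) s := fun s => by
    have h1 : HasDerivAt (fun s : ℝ => 4 * Real.pi * s * ξ) (4 * Real.pi * 1 * ξ) s :=
      ((hasDerivAt_id s).const_mul _).mul_const ξ
    refine ((h1.const_add 1).mul h1.neg.exp).neg.congr_deriv ?_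
    simp only [dens, max_eq_left hξ.le, Pi.neg_apply]; ring
  rw [theta, ← intervalIntegral.integral_of_le (by linarith),
    intervalIntegral.integral_eq_sub_of_hasDerivAt (fun s _ => hd s)]
  · rw [thetaProfile]; ring_nf
  · refine Continuous.intervalIntegrable ?_ _ _
    unfold dens; fun_prop

lemma sum_indicator_le {κ : Type} [Fintype κ] {A : κ → Set ℝ}
    (hA : Pairwise (Function.onFun Disjoint A))
    {b : κ → ℝ} {B : ℝ} (hB : ∀ k, b k ≤ B) (hB0 : 0 ≤ B) (y : ℝ) :
    ∑ k, (A k).indicator (fun _ => b k) y ≤ B := by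
  classical
  by_cases h : ∃ k, y ∈ A k
  · obtain ⟨k, hk⟩ := h
    rw [Finset.sum_eq_single k]
    · rw [indicator_of_mem hk]; exact hB k
    · intro j _ hj
      exact indicator_of_notMem (fun hy => disjoint_left.1 (hA hj) hy hk) _
    · simp
  · push Not at h
    rw [Finset.sum_eq_zero fun k _ => indicator_of_notMem (h k) _]
    exact hB0

/-- Square function estimate for smooth symbols on lacunary intervals, together with its dual. -/
theorem exists_mb_column_row {p q : ℝ} (hpq : p.HolderConjugate q) {c0 c1 : ℝ} (hc0 : 0 < c0)
    (hc : c0 ≤ c1) {ν : ℝ → ℝ} (hν : ContDiff ℝ 1 ν) :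
    ∃ C : ℝ, 0 < C ∧ ∀ (κ : Type) [Fintype κ] (α β y : κ → ℝ), (∀ k, 0 < y k) →
      (∀ k, c0 ≤ y k * α k) → (∀ k, y k * β k ≤ c1) →
      Pairwise (Function.onFun Disjoint fun k => Ioc (y k) (2 * y k)) →
      MB p C (fun (F : Unit → ℝ → ℂ) k ξ =>
        (Ioc (α k) (β k)).indicator (fun ξ => (ν (y k * ξ) : ℂ) * F () ξ) ξ) ∧
      MB p C (fun (F : κ → ℝ → ℂ) (_ : Unit) ξ =>
        ∑ k, (Ioc (α k) (β k)).indicator (fun ξ => (ν (y k * ξ) : ℂ) * F k ξ) ξ) := by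
  classical
  set μ : ℝ → ℝ := fun t => ν t / thetaProfile t with hμd
  have hd : ∀ t ∈ Icc c0 c1, HasDerivAt μ ((deriv ν t * thetaProfile t -
      ν t * deriv thetaProfile t) / thetaProfile t ^ 2) t := fun t ht =>
    ((hν.differentiable one_ne_zero t).hasDerivAt).div
      ((contDiff_thetaProfile.differentiable one_ne_zero t).hasDerivAt)
      (thetaProfile_pos (hc0.trans_le ht.1)).ne'
  have hd' : ContinuousOn (fun t => (deriv ν t * thetaProfile t -
      ν t * deriv thetaProfile t) / thetaProfile t ^ 2) (Icc c0 c1) := by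
    refine ContinuousOn.div ?_ ?_ fun t ht => (pow_pos (thetaProfile_pos (hc0.trans_le ht.1)) 2).ne'
    · exact (((hν.continuous_deriv le_rfl).mul contDiff_thetaProfile.continuous).sub
        (hν.continuous.mul (contDiff_thetaProfile.continuous_deriv le_rfl))).continuousOn
    · exact (contDiff_thetaProfile.continuous.pow 2).continuousOn
  obtain ⟨C, hC, h⟩ := exists_mb_smooth hpq hc hd hd'
  obtain ⟨D, hD, h'⟩ := exists_mb_theta hpq
  refine ⟨C * D, by positivity, ?_⟩
  intro κ _ α β y hy h0 h1 hdis
  have hα : ∀ k, ∀ ξ ∈ Ioc (α k) (β k), 0 < ξ := fun k ξ hξ =>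
    (pos_of_mul_pos_right (hc0.trans_le (h0 k)) (hy k).le).trans hξ.1
  have hA0 : ∀ k, Ioc (y k) (2 * y k) ⊆ Ioi 0 := fun k s hs => (hy k).trans hs.1
  have hid : ∀ k ξ, ξ ∈ Ioc (α k) (β k) →
      μ (y k * ξ) * theta (Ioc (y k) (2 * y k)) ξ = ν (y k * ξ) := fun k ξ hξ => by
    rw [theta_Ioc (hy k) (hα k ξ hξ), hμd]
    exact div_mul_cancel₀ _ (thetaProfile_pos (mul_pos (hy k) (hα k ξ hξ))).ne'
  have hsm := h κ α β y hy h0 h1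
  refine ⟨?_, ?_⟩
  · have hcol := h' Unit κ κ (fun _ => ()) id (fun k => Ioc (y k) (2 * y k))
      (fun _ => measurableSet_Ioc) hA0 (fun s u v =>
        sum_indicator_le hdis (fun k =>
          mul_le_mul (PiLp.norm_apply_le u _) (PiLp.norm_apply_le v _) (norm_nonneg _)
            (norm_nonneg _)) (by positivity) s)
    convert hsm.comp hD hcol using 4 with F k ξ
    by_cases hξ : ξ ∈ Ioc (α k) (β k)
    · simp only [indicator_of_mem hξ, ← hid k ξ hξ]; simp [mul_assoc]
    · simp only [indicator_of_notMem hξ]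
  · have hrow := h' κ Unit κ id (fun _ => ()) (fun k => Ioc (y k) (2 * y k))
      (fun _ => measurableSet_Ioc) hA0 (fun s u v =>
        sum_indicator_le hdis (fun k =>
          mul_le_mul (PiLp.norm_apply_le u _) (PiLp.norm_apply_le v _) (norm_nonneg _)
            (norm_nonneg _)) (by positivity) s)
    rw [mul_comm]
    convert hrow.comp hC hsm using 4 with F k ξ
    simp only [if_true]
    refine Finset.sum_congr rfl fun k _ => ?_
    by_cases hξ : ξ ∈ Ioc (α k) (β k)
    · simp only [indicator_of_mem hξ, ← hid k ξ hξ, id]; push_cast; ring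
    · simp only [indicator_of_notMem hξ, id, mul_zero]

end PoissonLP

namespace PoissonLP
open Filter Topology

/-- The weak type `(1,1)` bound behind the Hardy–Littlewood maximal theorem. -/
lemma mul_volume_le_of_forall_closedBall {f : ℝ → ℝ≥0∞} {t : ℝ} (ht : 0 < t) {S : Set ℝ}
    (hS : ∀ x ∈ S, ∃ r > 0,
      ENNReal.ofReal (t * (2 * r)) ≤ ∫⁻ y in Metric.closedBall x r, f y) :
    ENNReal.ofReal t * volume S ≤ 5 * ∫⁻ y, f y := by
  by_cases hf : ∫⁻ y, f y = ∞
  · simp [hf]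
  choose! r hr hrS using hS
  have hR : ∀ x ∈ S, r x ≤ (∫⁻ y, f y).toReal / (2 * t) := fun x hx => by
    have := (ENNReal.ofReal_le_iff_le_toReal hf).1
      ((hrS x hx).trans (setLIntegral_le_lintegral _ _))
    rw [le_div_iff₀ (by positivity)]
    linarith
  obtain ⟨u, huS, hdis, hu⟩ :=
    Vitali.exists_disjoint_subfamily_covering_enlargement_closedBall S id r _ hR 5 (by norm_num)
  have hcount : u.Countable := hdis.countable_of_nonempty_interior fun x hx => by
    refine ⟨x, ?_⟩
    exact Metric.ball_subset_interior_closedBall (Metric.mem_ball_self (hr x (huS hx)))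
  have hsub : S ⊆ ⋃ x ∈ u, Metric.closedBall x (5 * r x) := fun x hx => by
    obtain ⟨b, hb, hxb⟩ := hu x hx
    exact mem_biUnion hb (hxb (Metric.mem_closedBall_self (hr x hx).le))
  calc ENNReal.ofReal t * volume S
      ≤ ENNReal.ofReal t * ∑' x : u, volume (Metric.closedBall (x : ℝ) (5 * r x)) := by
        gcongr
        exact (measure_mono hsub).trans (measure_biUnion_le _ hcount _)
    _ = ∑' x : u, 5 * ENNReal.ofReal (t * (2 * r x)) := by
        rw [← ENNReal.tsum_mul_left]
        refine tsum_congr fun x => ?_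
        rw [Real.volume_closedBall, ← ENNReal.ofReal_mul ht.le,
          show (5 : ℝ≥0∞) = ENNReal.ofReal 5 by simp, ← ENNReal.ofReal_mul (by norm_num)]
        congr 1; ring
    _ ≤ ∑' x : u, 5 * ∫⁻ y in Metric.closedBall (x : ℝ) (r x), f y :=
        ENNReal.tsum_le_tsum fun x => by gcongr; exact hrS x (huS x.2)
    _ = 5 * ∫⁻ y in ⋃ x ∈ u, Metric.closedBall x (r x), f y := by
        rw [ENNReal.tsum_mul_left,
          lintegral_biUnion (s := fun x => Metric.closedBall x (r x)) hcount
            (fun _ _ => Metric.isClosed_closedBall.measurableSet) hdis]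
    _ ≤ _ := mul_le_mul_right (setLIntegral_le_lintegral _ _) _

/-- The Hardy–Littlewood maximal theorem, for a function `m` all of whose values are dominated by
averages of `g`. -/
theorem lintegral_rpow_le_of_forall_average {p : ℝ} (hp : 1 < p) {m g : ℝ → ℝ}
    (hm : Measurable m) (hm0 : ∀ x, 0 ≤ m x) (hg : Measurable g) (hg0 : ∀ x, 0 ≤ g x)
    (h : ∀ x t, 0 < t → t < m x → ∃ r > 0,
      ENNReal.ofReal (t * (2 * r)) ≤ ∫⁻ y in Metric.closedBall x r, ENNReal.ofReal (g y)) :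
    ∫⁻ x, ENNReal.ofReal (m x ^ p) ≤
      ENNReal.ofReal (10 * p / (p - 1) * 2 ^ (p - 1)) * ∫⁻ x, ENNReal.ofReal (g x ^ p) := by
  have hp1 : 0 < p - 1 := sub_pos.2 hp
  have hp0 : 0 < p := by linarith
  set μ : Measure ℝ := volume.withDensity fun x => ENNReal.ofReal (g x) with hμ
  have hgm : Measurable fun x => ENNReal.ofReal (g x) := hg.ennreal_ofReal
  have weak : ∀ t, 0 < t → volume {x | t < m x} * ENNReal.ofReal (t ^ (p - 1)) ≤
      10 * (μ {x | t < 2 * g x} * ENNReal.ofReal (t ^ (p - 1 - 1))) := fun t ht => by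
    have hA : MeasurableSet {x | t < 2 * g x} := measurableSet_lt measurable_const (hg.const_mul 2)
    have key := mul_volume_le_of_forall_closedBall (half_pos ht)
      (f := {x | t < 2 * g x}.indicator fun x => ENNReal.ofReal (g x)) (S := {x | t < m x})
      fun x hx => by
        obtain ⟨r, hr, hxr⟩ := h x t ht hx
        refine ⟨r, hr, ?_⟩
        have h1 : ∫⁻ y in Metric.closedBall x r, ENNReal.ofReal (g y) ≤
            (∫⁻ y in Metric.closedBall x r,
              {x | t < 2 * g x}.indicator (fun x => ENNReal.ofReal (g x)) y) +
            ENNReal.ofReal (t / 2 * (2 * r)) := by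
          rw [ENNReal.ofReal_mul (half_pos ht).le, ← Real.volume_closedBall x r,
            ← setLIntegral_const, ← lintegral_add_right _ measurable_const]
          refine lintegral_mono fun y => ?_
          by_cases hy : t < 2 * g y
          · simp only [indicator, mem_ofPred_eq, hy, if_true]; exact le_self_add
          · simp only [indicator, mem_ofPred_eq, hy, if_false, zero_add]
            exact ENNReal.ofReal_le_ofReal (by linarith)
        have h2 := hxr.trans h1
        rw [show t * (2 * r) = t / 2 * (2 * r) + t / 2 * (2 * r) by ring,
          ENNReal.ofReal_add (by positivity) (by positivity)] at h2
        exact (ENNReal.add_le_add_iff_right ENNReal.ofReal_ne_top).1 h2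
    rw [lintegral_indicator hA, ← withDensity_apply _ hA] at key
    have e : ENNReal.ofReal (t ^ (p - 1)) =
        2 * (ENNReal.ofReal (t / 2) * ENNReal.ofReal (t ^ (p - 1 - 1))) := by
      rw [show (2 : ℝ≥0∞) = ENNReal.ofReal 2 by simp, ← ENNReal.ofReal_mul (by positivity),
        ← ENNReal.ofReal_mul (by norm_num), Real.rpow_sub_one ht.ne' (p - 1)]
      congr 1; field_simp
    calc _ = 2 * (ENNReal.ofReal (t / 2) * volume {x | t < m x}) *
          ENNReal.ofReal (t ^ (p - 1 - 1)) := by rw [e]; ring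
      _ ≤ 2 * (5 * μ {x | t < 2 * g x}) * ENNReal.ofReal (t ^ (p - 1 - 1)) := by gcongr
      _ = _ := by rw [← mul_assoc, show (2 : ℝ≥0∞) * 5 = 10 by norm_num, mul_assoc]
  have hlay := lintegral_rpow_eq_lintegral_meas_lt_mul (f := fun x => 2 * g x) μ
    (ae_of_all _ fun x => mul_nonneg zero_le_two (hg0 x)) (hg.const_mul 2).aemeasurable hp1
  have hden : ∫⁻ x, ENNReal.ofReal ((2 * g x) ^ (p - 1)) ∂μ =
      ENNReal.ofReal (2 ^ (p - 1)) * ∫⁻ x, ENNReal.ofReal (g x ^ p) := by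
    rw [hμ, lintegral_withDensity_eq_lintegral_mul _ hgm
      (by fun_prop), ← lintegral_const_mul _ (by fun_prop)]
    refine lintegral_congr fun x => ?_
    rw [Pi.mul_apply, ← ENNReal.ofReal_mul (hg0 x), ← ENNReal.ofReal_mul (by positivity),
      Real.mul_rpow zero_le_two (hg0 x)]
    congr 1
    rcases (hg0 x).eq_or_lt with h0 | h0
    · rw [← h0, Real.zero_rpow hp0.ne']; simp
    · rw [Real.rpow_sub_one h0.ne']; field_simp
  rw [lintegral_rpow_eq_lintegral_meas_lt_mul volume (ae_of_all _ hm0) hm.aemeasurable hp0]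
  calc _ ≤ ENNReal.ofReal p * ∫⁻ t in Ioi 0,
        10 * (μ {x | t < 2 * g x} * ENNReal.ofReal (t ^ (p - 1 - 1))) := by
        gcongr 1
        exact setLIntegral_mono' measurableSet_Ioi fun t ht => weak t ht
    _ = ENNReal.ofReal (10 * p / (p - 1)) * (ENNReal.ofReal (p - 1) * ∫⁻ t in Ioi 0,
        μ {x | t < 2 * g x} * ENNReal.ofReal (t ^ (p - 1 - 1))) := by
        rw [lintegral_const_mul' _ _ (by norm_num), ← mul_assoc, ← mul_assoc,
          ← ENNReal.ofReal_mul (by positivity), div_mul_cancel₀ _ hp1.ne', mul_comm 10 p,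
          ENNReal.ofReal_mul hp0.le]
        simp
    _ = _ := by
        rw [← hlay, hden, ← mul_assoc, ← ENNReal.ofReal_mul (by positivity)]

/-- Convolutions with rescaled integrable bumps are dominated by averages. -/
lemma exists_average_of_lt_lintegral {f : ℝ → ℝ≥0∞} (hf : Measurable f) {c t : ℝ} (hc : 0 < c)
    (ht : 0 < t) {x : ℝ}
    (h : ENNReal.ofReal (16 * t) <
      ∫⁻ y, ENNReal.ofReal (c / (1 + (c * (x - y)) ^ 2)) * f y) :
    ∃ r > 0, ENNReal.ofReal (t * (2 * r)) ≤ ∫⁻ y in Metric.closedBall x r, f y := by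
  by_contra! hcon
  refine h.not_ge ?_
  have hpt : ∀ y, ENNReal.ofReal (c / (1 + (c * (x - y)) ^ 2)) * f y ≤
      ∑' k : ℕ, ENNReal.ofReal (4 * c * (1 / 4) ^ k) *
        (Metric.closedBall x (2 ^ k / c)).indicator f y := fun y => by
    obtain ⟨k, hk1, hk2⟩ : ∃ k : ℕ, c * |x - y| ≤ 2 ^ k ∧
        (4 : ℝ) ^ k ≤ 4 * (1 + (c * (x - y)) ^ 2) := by
      have hex : ∃ k : ℕ, c * |x - y| ≤ 2 ^ k :=
        (pow_unbounded_of_one_lt _ one_lt_two).imp fun _ h => h.le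
      classical
      refine ⟨Nat.find hex, Nat.find_spec hex, ?_⟩
      rcases Nat.eq_zero_or_pos (Nat.find hex) with h0 | h0
      · rw [h0, pow_zero]; nlinarith [sq_nonneg (c * (x - y))]
      · obtain ⟨n, hn⟩ := Nat.exists_eq_add_of_lt h0
        have hlt := Nat.find_min hex (m := n) (by omega)
        rw [not_le] at hlt
        have h4 : ((2 : ℝ) ^ n) ^ 2 ≤ (c * (x - y)) ^ 2 := by
          rw [← sq_abs (c * (x - y)), abs_mul, abs_of_pos hc]
          exact pow_le_pow_left₀ (by positivity) hlt.le 2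
        rw [hn, zero_add, pow_succ, show (4 : ℝ) ^ n = (2 ^ n) ^ 2 by
          rw [← pow_mul, mul_comm, pow_mul]; norm_num]
        linarith
    refine le_trans ?_ (ENNReal.le_tsum k)
    rw [indicator_of_mem]
    · gcongr ?_ * _
      apply ENNReal.ofReal_le_ofReal
      rw [one_div, inv_pow, ← div_eq_mul_inv, div_le_div_iff₀ (by positivity) (by positivity)]
      nlinarith
    · rw [Metric.mem_closedBall, Real.dist_eq, abs_sub_comm, le_div_iff₀ hc]
      linarith
  have hr : ∀ k : ℕ, (0 : ℝ) < 2 ^ k / c := fun k => by positivity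
  calc _ ≤ ∑' k : ℕ, ENNReal.ofReal (4 * c * (1 / 4) ^ k) *
        ∫⁻ y in Metric.closedBall x (2 ^ k / c), f y := by
        refine (lintegral_mono hpt).trans_eq ?_
        rw [lintegral_tsum fun k => ((hf.indicator
          Metric.isClosed_closedBall.measurableSet).const_mul _).aemeasurable]
        refine tsum_congr fun k => ?_
        rw [lintegral_const_mul _ (hf.indicator Metric.isClosed_closedBall.measurableSet),
          lintegral_indicator Metric.isClosed_closedBall.measurableSet]
    _ ≤ ∑' k : ℕ, ENNReal.ofReal (8 * t) * 2⁻¹ ^ k := by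
        refine ENNReal.tsum_le_tsum fun k => ?_
        refine (mul_le_mul_right (hcon _ (hr k)).le _).trans_eq ?_
        rw [← ENNReal.ofReal_mul (by positivity), show (2⁻¹ : ℝ≥0∞) = ENNReal.ofReal 2⁻¹ by simp,
          ← ENNReal.ofReal_pow (by norm_num), ← ENNReal.ofReal_mul (by positivity)]
        congr 1
        rw [show (1 / 4 : ℝ) = 2⁻¹ * 2⁻¹ by norm_num, mul_pow]
        have : (2⁻¹ : ℝ) ^ k * 2 ^ k = 1 := by rw [← mul_pow]; norm_num
        calc _ = 8 * t * 2⁻¹ ^ k * (2⁻¹ ^ k * 2 ^ k) * (c / c) := by ring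
          _ = _ := by rw [this, div_self hc.ne']; ring
    _ = _ := by
        rw [ENNReal.tsum_mul_left, ENNReal.tsum_geometric, ENNReal.one_sub_inv_two, inv_inv,
          show (2 : ℝ≥0∞) = ENNReal.ofReal 2 by simp, ← ENNReal.ofReal_mul (by positivity)]
        congr 1; ring

end PoissonLP

namespace PoissonLP
open Filter Topology

lemma norm_vec_unit (f : Unit → ℝ → ℂ) (x : ℝ) : ‖vec f x‖ = ‖f () x‖ := by
  rw [EuclideanSpace.norm_eq]; simp [vec]

lemma eLpNorm_vec_unit (f : Unit → ℝ → ℂ) (p : ℝ≥0∞) :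
    eLpNorm (vec f) p volume = eLpNorm (f ()) p volume :=
  eLpNorm_congr_norm_ae (ae_of_all _ (norm_vec_unit f))

/-- A smooth cutoff adapted to `[-1, 1]`. -/
noncomputable def cutoff : ContDiffBump (0 : ℝ) := ⟨1, 2, one_pos, one_lt_two⟩

lemma contDiff_cutoff : ContDiff ℝ (⊤ : ℕ∞) cutoff := cutoff.contDiff

lemma cutoff_eq_one {t : ℝ} (h : |t| ≤ 1) : cutoff t = 1 :=
  cutoff.one_of_mem_closedBall (by rw [Metric.mem_closedBall, Real.dist_eq, sub_zero]; exact h)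

lemma cutoff_eq_zero {t : ℝ} (h : 2 ≤ |t|) : cutoff t = 0 :=
  cutoff.zero_of_le_dist (by rw [Real.dist_eq, sub_zero]; exact h)

lemma exists_norm_ift_cutoff_le : ∃ A : ℝ, 0 < A ∧ ∀ u,
    ‖ift (fun t => (cutoff t : ℂ)) u‖ ≤ A / (1 + u ^ 2) := by
  have h2 : ContDiff ℝ (⊤ : ℕ∞) (fun t => (cutoff t : ℂ)) :=
    Complex.ofRealCLM.contDiff.comp contDiff_cutoff
  have h1 : HasCompactSupport (fun t => (cutoff t : ℂ)) :=
    cutoff.hasCompactSupport.comp_left (g := ((↑) : ℝ → ℂ)) Complex.ofReal_zero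
  set S : SchwartzMap ℝ ℂ := h1.toSchwartzMap h2 with hS
  have e : ift (fun t => (cutoff t : ℂ)) = ⇑(FourierTransformInv.fourierInv S) := by
    rw [ift_eq_fourierInv, SchwartzMap.fourierInv_coe]; rfl
  set T : SchwartzMap ℝ ℂ := FourierTransformInv.fourierInv S
  refine ⟨SchwartzMap.seminorm ℝ 0 0 T + SchwartzMap.seminorm ℝ 2 0 T + 1, by positivity,
    fun u => ?_⟩
  rw [e, le_div_iff₀ (by positivity)]
  have a0 := SchwartzMap.norm_pow_mul_le_seminorm ℝ T 0 u
  have a2 := SchwartzMap.norm_pow_mul_le_seminorm ℝ T 2 u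
  rw [Real.norm_eq_abs, sq_abs] at a2
  rw [pow_zero, one_mul] at a0
  linarith

lemma ift_comp_div (F : ℝ → ℂ) {c : ℝ} (hc : 0 < c) (u : ℝ) :
    ift (fun ξ => F (ξ / c)) u = c * ift F (c * u) := by
  have h := Measure.integral_comp_div (fun ξ => F ξ * eChar ξ (c * u)) c
  rw [abs_of_pos hc, Complex.real_smul] at h
  rw [ift, ift, ← h]
  refine integral_congr_ae (ae_of_all _ fun ξ => ?_)
  have : (c : ℂ) ≠ 0 := Complex.ofReal_ne_zero.2 hc.ne'
  simp only [eChar]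
  congr 2
  push_cast
  field_simp

/-- Smooth low-pass filters are controlled by a maximal function. -/
lemma enorm_ift_cutoff_le {A : ℝ} (hA : 0 < A)
    (h : ∀ u, ‖ift (fun t => (cutoff t : ℂ)) u‖ ≤ A / (1 + u ^ 2)) {c : ℝ} (hc : 0 < c)
    {F : ℝ → ℂ} (hF : Integrable F) (x : ℝ) :
    ‖ift (fun ξ => (cutoff (ξ / c) : ℂ) * F ξ) x‖ₑ ≤
      ENNReal.ofReal A * ∫⁻ y, ENNReal.ofReal (c / (1 + (c * (x - y)) ^ 2)) * ‖ift F y‖ₑ := by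
  have hcont : Continuous (fun t => (cutoff t : ℂ)) :=
    Complex.continuous_ofReal.comp cutoff.continuous
  have hsupp : HasCompactSupport (fun t => (cutoff t : ℂ)) :=
    cutoff.hasCompactSupport.comp_left (g := ((↑) : ℝ → ℂ)) Complex.ofReal_zero
  have hint : Integrable (fun t => (cutoff t : ℂ)) := hcont.integrable_of_hasCompactSupport hsupp
  have hint2 : Integrable (ift fun t => (cutoff t : ℂ)) := by
    refine (integrable_inv_one_add_sq.const_mul A).mono'
      (continuous_ift hint).aestronglyMeasurable (ae_of_all _ fun u => ?_)
    rw [← div_eq_mul_inv]; exact h u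
  have hk : Integrable (ift fun ξ => (cutoff (ξ / c) : ℂ)) := by
    have : (ift fun ξ => (cutoff (ξ / c) : ℂ)) =
        fun u => c * ift (fun t => (cutoff t : ℂ)) (c * u) :=
      funext (ift_comp_div (fun t => (cutoff t : ℂ)) hc)
    rw [this]
    exact (hint2.comp_mul_left' hc.ne').const_mul _
  rw [← integral_conv_ift (κ := fun ξ => (cutoff (ξ / c) : ℂ))
    (hcont.comp (continuous_id.div_const c)) (hint.comp_div hc.ne') hk hF x,
    ← lintegral_const_mul' _ _ ENNReal.ofReal_ne_top]
  refine (enorm_integral_le_lintegral_enorm _).trans (lintegral_mono fun y => ?_)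
  rw [enorm_mul, ← mul_assoc, ← ENNReal.ofReal_mul hA.le]
  gcongr
  rw [ift_comp_div (fun t => (cutoff t : ℂ)) hc, ← ofReal_norm, norm_mul, Complex.norm_real,
    Real.norm_eq_abs, abs_of_pos hc]
  apply ENNReal.ofReal_le_ofReal
  refine (mul_le_mul_of_nonneg_left (h _) hc.le).trans_eq ?_
  ring

lemma exists_maximal_cutoff {p : ℝ} (hp : 1 < p) :
    ∃ C : ℝ, 0 < C ∧ ∀ (κ : Type) [Fintype κ] (c : κ → ℝ), (∀ k, 0 < c k) →
      ∀ F : ℝ → ℂ, Integrable F → ∀ a, 0 < a →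
      eLpNorm (ift F) (ENNReal.ofReal p) volume ≤ ENNReal.ofReal a →
      eLpNorm (fun x (k : κ) => ift (fun ξ => (cutoff (ξ / c k) : ℂ) * F ξ) x)
        (ENNReal.ofReal p) volume ≤ ENNReal.ofReal (C * a) := by
  obtain ⟨A, hA, h⟩ := exists_norm_ift_cutoff_le
  have hp0 : 0 < p := by linarith
  have hp1 : 0 < p - 1 := by linarith
  set D : ℝ := 10 * p / (p - 1) * 2 ^ (p - 1) with hD
  have hD0 : 0 < D := by positivity
  refine ⟨A * 16 * D ^ p⁻¹, by positivity, ?_⟩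
  intro κ _ c hc F hF a ha hFa
  have hcut : ∀ k, Integrable fun ξ => (cutoff (ξ / c k) : ℂ) * F ξ := fun k => by
    refine hF.bdd_mul (c := 1) ?_ (ae_of_all _ fun ξ => ?_)
    · exact (Complex.continuous_ofReal.comp
        (cutoff.continuous.comp (continuous_id.div_const _))).aestronglyMeasurable
    · rw [Complex.norm_real, Real.norm_eq_abs, abs_of_nonneg cutoff.nonneg]
      exact cutoff.le_one
  set v : ℝ → κ → ℂ := fun x k => ift (fun ξ => (cutoff (ξ / c k) : ℂ) * F ξ) x with hv
  have hvc : Continuous v := continuous_pi fun k => continuous_ift (hcut k)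
  have hF1 := (eLpNorm_le_ofReal_iff hp0 ha.le).1 hFa
  have e : ∀ x, ‖ift F x‖ₑ ^ p = ENNReal.ofReal (‖ift F x‖ ^ p) := fun x => by
    rw [← ENNReal.ofReal_rpow_of_nonneg (norm_nonneg _) hp0.le, ofReal_norm]
  simp only [e] at hF1
  have key := lintegral_rpow_le_of_forall_average hp (m := fun x => ‖v x‖ / (A * 16))
    (g := fun x => ‖ift F x‖) (hvc.norm.div_const _).measurable (fun x => by positivity)
    (continuous_ift hF).norm.measurable (fun x => norm_nonneg _) fun x t ht hlt => by
      rw [lt_div_iff₀ (by positivity)] at hlt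
      obtain ⟨k, hk⟩ : ∃ k, t * (A * 16) < ‖v x k‖ := by
        by_contra! hcon
        exact hlt.not_ge ((pi_norm_le_iff_of_nonneg (by positivity)).2 hcon)
      refine exists_average_of_lt_lintegral (x := x)
        (continuous_ift hF).norm.measurable.ennreal_ofReal (hc k) ht ?_
      have h1 := enorm_ift_cutoff_le hA h (hc k) hF x
      rw [← ofReal_norm] at h1
      have h2 : ENNReal.ofReal A * ENNReal.ofReal (16 * t) < ENNReal.ofReal ‖v x k‖ := by
        rw [← ENNReal.ofReal_mul hA.le]
        exact (ENNReal.ofReal_lt_ofReal_iff_of_nonneg (by positivity)).2 (by linarith)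
      have h3 := h2.trans_le h1
      simp only [ofReal_norm]
      exact lt_of_mul_lt_mul_left' h3
  refine (eLpNorm_le_ofReal_iff hp0 (by positivity)).2 ?_
  have e2 : ∀ x, ‖v x‖ₑ ^ p = ENNReal.ofReal ((A * 16) ^ p) *
      ENNReal.ofReal ((‖v x‖ / (A * 16)) ^ p) := fun x => by
    rw [← ofReal_norm, ENNReal.ofReal_rpow_of_nonneg (norm_nonneg _) hp0.le,
      ← ENNReal.ofReal_mul (by positivity), ← Real.mul_rpow (by positivity) (by positivity)]
    congr 2; field_simp
  simp only [e2]
  rw [lintegral_const_mul' _ _ ENNReal.ofReal_ne_top]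
  refine (mul_le_mul_right (key.trans (mul_le_mul_right hF1 _)) _).trans_eq ?_
  rw [← ENNReal.ofReal_mul hD0.le, ← ENNReal.ofReal_mul (by positivity),
    Real.mul_rpow (y := a) (by positivity) ha.le,
    Real.mul_rpow (y := D ^ p⁻¹) (by positivity) (by positivity), ← Real.rpow_mul hD0.le,
    inv_mul_cancel₀ hp0.ne', Real.rpow_one]
  congr 1; ring

/-- Maximal estimate for the lacunary one-sided frequency truncations `(0, c k]`. -/
theorem exists_maximal_Ioc {p q : ℝ} (hpq : p.HolderConjugate q) :
    ∃ C : ℝ, 0 < C ∧ ∀ (κ : Type) [Fintype κ] (c : κ → ℝ), (∀ k, 0 < c k) →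
      Pairwise (Function.onFun Disjoint fun k => Ioc (1 / c k) (2 * (1 / c k))) →
      ∀ F : ℝ → ℂ, Integrable F → ∀ a, 0 < a →
      eLpNorm (ift F) (ENNReal.ofReal p) volume ≤ ENNReal.ofReal a →
      eLpNorm (fun x (k : κ) => ift ((Ioc 0 (c k)).indicator F) x)
        (ENNReal.ofReal p) volume ≤ ENNReal.ofReal (C * a) := by
  obtain ⟨C1, hC1, h1⟩ := exists_mb_Ioi hpq
  obtain ⟨C2, hC2, h2⟩ := exists_maximal_cutoff hpq.lt
  obtain ⟨C3, hC3, h3⟩ := exists_mb_column_row hpq one_pos one_le_two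
    (contDiff_cutoff.of_le (by exact_mod_cast le_top) : ContDiff ℝ 1 cutoff)
  refine ⟨C2 * C1 + C3, by positivity, ?_⟩
  intro κ _ c hc hdis F hF a ha hFa
  have hFu : eLpNorm (vec fun _ : Unit => ift F) (ENNReal.ofReal p) volume ≤ ENNReal.ofReal a := by
    rwa [eLpNorm_vec_unit]
  have g1 := (h1 Unit (fun _ => 0) (fun _ => F) fun _ => hF).2 a ha hFu
  rw [eLpNorm_vec_unit] at g1
  have hF' : Integrable ((Ioi 0).indicator F) := hF.indicator measurableSet_Ioi
  have g2 := h2 κ c hc _ hF' _ (by positivity) g1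
  have h3' := ((h3 κ c (fun k => 2 * c k) (fun k => 1 / c k) (fun k => by have := hc k; positivity)
    (fun k => by rw [one_div, inv_mul_cancel₀ (hc k).ne'])
    (fun k => by have := (hc k).ne'; field_simp; exact le_rfl) hdis).1 (fun _ => F) fun _ => hF)
  have g3 := h3'.2 a ha hFu
  set w : ℝ → κ → ℂ := fun x k => ift (fun ξ => (Ioc (c k) (2 * c k)).indicator
    (fun ξ => (cutoff (1 / c k * ξ) : ℂ) * F ξ) ξ) x with hw
  have hcut : ∀ k, Integrable fun ξ => (cutoff (ξ / c k) : ℂ) * (Ioi 0).indicator F ξ := fun k => by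
    refine hF'.bdd_mul (c := 1) ?_ (ae_of_all _ fun ξ => ?_)
    · exact (Complex.continuous_ofReal.comp
        (cutoff.continuous.comp (continuous_id.div_const _))).aestronglyMeasurable
    · rw [Complex.norm_real, Real.norm_eq_abs, abs_of_nonneg cutoff.nonneg]
      exact cutoff.le_one
  have g4 : eLpNorm w (ENNReal.ofReal p) volume ≤ ENNReal.ofReal (C3 * a) := by
    refine le_trans (eLpNorm_mono fun x => ?_) g3
    exact (pi_norm_le_iff_of_nonneg (norm_nonneg _)).2 fun k =>
      norm_le_norm_vec (fun k x => w x k) x k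
  have hsplit : (fun x (k : κ) => ift ((Ioc 0 (c k)).indicator F) x) =
      (fun x (k : κ) => ift (fun ξ => (cutoff (ξ / c k) : ℂ) * (Ioi 0).indicator F ξ) x) - w := by
    ext x k
    rw [Pi.sub_apply, Pi.sub_apply, hw, ← ift_sub (hcut k) (h3'.1 k)]
    congr 1
    ext ξ
    have hck := hc k
    rcases le_or_gt ξ 0 with h0 | h0
    · simp [indicator, h0.not_gt, (h0.trans_lt hck).not_gt]
    · rcases le_or_gt ξ (c k) with hle | hgt
      · have : cutoff (ξ / c k) = 1 := cutoff_eq_one (by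
          rw [abs_of_nonneg (by positivity), div_le_one hck]; exact hle)
        simp [indicator, h0, hle, hle.not_gt, this]
      · rcases le_or_gt ξ (2 * c k) with hle2 | hgt2
        · simp [indicator, h0, hgt, hgt.not_ge, hle2, div_eq_inv_mul]
        · have : cutoff (ξ / c k) = 0 := cutoff_eq_zero (by
            rw [abs_of_nonneg (by positivity), le_div_iff₀ hck]; exact hgt2.le)
          simp [indicator, h0, hgt.not_ge, hgt2.not_ge, this]
  rw [hsplit, add_mul, ENNReal.ofReal_add (by positivity) (by positivity), mul_assoc]
  refine (eLpNorm_sub_le ?_ ?_ ?_).trans (add_le_add g2 g4)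
  · exact (continuous_pi fun k => continuous_ift (hcut k)).aestronglyMeasurable
  · exact (continuous_pi fun k => continuous_ift (h3'.1 k)).aestronglyMeasurable
  · simpa using hpq.lt.le

end PoissonLP

namespace PoissonLP
open Filter Topology
open scoped FourierTransform Convolution

lemma ift_convolution {F G : ℝ → ℂ} (hF : Integrable F) (hG : Integrable G) (x : ℝ) :
    ift (F ⋆[ContinuousLinearMap.mul ℂ ℂ] G) x = ift F x * ift G x := by
  simp only [ift_eq_fourierInv, Real.fourierInv_eq_fourier_neg]
  exact Real.fourier_mul_convolution_eq hF hG (-x)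

lemma indicator_convolution {F G : ℝ → ℂ} {α β γ δ : ℝ} :
    (Ioc (α + γ) (β + δ)).indicator
      ((Ioc α β).indicator F ⋆[ContinuousLinearMap.mul ℂ ℂ] (Ioc γ δ).indicator G) =
      (Ioc α β).indicator F ⋆[ContinuousLinearMap.mul ℂ ℂ] (Ioc γ δ).indicator G := by
  refine indicator_eq_self.2 fun z hz => ?_
  by_contra hcon
  refine hz ?_
  rw [convolution_def]
  refine integral_eq_zero_of_ae (ae_of_all _ fun t => ?_)
  simp only [ContinuousLinearMap.mul_apply', Pi.zero_apply, mul_eq_zero]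
  by_contra! h
  have h1 := mem_of_indicator_ne_zero h.1
  have h2 := mem_of_indicator_ne_zero h.2
  exact hcon ⟨by linarith [h1.1, h2.1], by linarith [h1.2, h2.2]⟩

/-- Hölder's inequality for products whose left factor is measured in a supremum norm. -/
lemma eLpNorm_vec_mul_le {p1 p2 r a b : ℝ} (h : p1.HolderTriple p2 r) {κ : Type} [Fintype κ]
    (ha : 0 ≤ a) {f : κ → ℝ → ℂ} {g : ℝ → κ → ℂ} (hf : ∀ k, StronglyMeasurable (f k))
    (hg : Continuous g)
    (hfa : eLpNorm (vec f) (ENNReal.ofReal p1) volume ≤ ENNReal.ofReal a)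
    (hgb : eLpNorm g (ENNReal.ofReal p2) volume ≤ ENNReal.ofReal b) :
    eLpNorm (vec fun k x => f k x * g x k) (ENNReal.ofReal r) volume ≤ ENNReal.ofReal (a * b) := by
  have h1 : eLpNorm (vec fun k x => f k x * g x k) (ENNReal.ofReal r) volume ≤
      eLpNorm ((fun x => ‖g x‖) • vec f) (ENNReal.ofReal r) volume := by
    refine eLpNorm_mono fun x => ?_
    rw [Pi.smul_apply', norm_smul, norm_norm, EuclideanSpace.norm_eq, EuclideanSpace.norm_eq]
    refine Real.sqrt_le_iff.2 ⟨by positivity, ?_⟩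
    rw [mul_pow, Real.sq_sqrt (by positivity), Finset.mul_sum]
    refine Finset.sum_le_sum fun k _ => ?_
    simp only [vec, norm_mul, mul_pow, mul_comm (‖g x‖ ^ 2)]
    gcongr
    exact norm_le_pi_norm (g x) k
  have := h.symm.ennrealOfReal
  refine h1.trans ((eLpNorm_smul_le_mul_eLpNorm (p := ENNReal.ofReal p2) (q := ENNReal.ofReal p1)
    (stronglyMeasurable_vec hf).aestronglyMeasurable hg.norm.aestronglyMeasurable).trans ?_)
  rw [eLpNorm_norm, ENNReal.ofReal_mul ha, mul_comm]
  exact mul_le_mul' hfa hgb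

/-- A bilinear estimate for products of lacunary frequency pieces with lower frequency
truncations. -/
theorem exists_bilinear_lacunary {p1 p2 r q1 q2 q3 : ℝ} (h1 : p1.HolderConjugate q1)
    (h2 : p2.HolderConjugate q2) (h3 : r.HolderConjugate q3) (h : p1.HolderTriple p2 r) :
    ∃ C : ℝ, 0 < C ∧ ∀ (κ : Type) [Fintype κ] (α β c y : κ → ℝ), (∀ k, 0 < y k) → (∀ k, 0 < c k) →
      (∀ k, 1 / 4 ≤ y k * α k) → (∀ k, y k * (β k + c k) ≤ 2) →
      Pairwise (Function.onFun Disjoint fun k => Ioc (y k) (2 * y k)) →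
      Pairwise (Function.onFun Disjoint fun k => Ioc (1 / c k) (2 * (1 / c k))) →
      ∀ F G : ℝ → ℂ, Integrable F → Integrable G → ∀ a b, 0 < a → 0 < b →
      eLpNorm (ift F) (ENNReal.ofReal p1) volume ≤ ENNReal.ofReal a →
      eLpNorm (ift G) (ENNReal.ofReal p2) volume ≤ ENNReal.ofReal b →
      eLpNorm (fun x => ∑ k, ift ((Ioc (α k) (β k)).indicator F) x *
        ift ((Ioc 0 (c k)).indicator G) x) (ENNReal.ofReal r) volume ≤
        ENNReal.ofReal (C * (a * b)) := by
  have hcd : ContDiff ℝ 1 (fun _ : ℝ => (1 : ℝ)) := contDiff_const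
  obtain ⟨C1, hC1, e1⟩ := exists_mb_column_row h1 (c0 := 1 / 4) (c1 := 2) (by norm_num)
    (by norm_num) hcd
  obtain ⟨C2, hC2, e2⟩ := exists_maximal_Ioc h2
  obtain ⟨C3, hC3, e3⟩ := exists_mb_column_row h3 (c0 := 1 / 4) (c1 := 2) (by norm_num)
    (by norm_num) hcd
  refine ⟨C3 * (C1 * C2), by positivity, ?_⟩
  intro κ _ α β c y hy hc hα hβ hdis hdis' F G hF hG a b ha hb hFa hGb
  have hβ' : ∀ k, y k * β k ≤ 2 := fun k =>
    (mul_le_mul_of_nonneg_left (by linarith [hc k]) (hy k).le).trans (hβ k)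
  have hFk : ∀ k, Integrable ((Ioc (α k) (β k)).indicator F) := fun k =>
    hF.indicator measurableSet_Ioc
  have hGk : ∀ k, Integrable ((Ioc 0 (c k)).indicator G) := fun k =>
    hG.indicator measurableSet_Ioc
  have hcol := ((e1 κ α β y hy hα hβ' hdis).1 (fun _ => F) fun _ => hF).2 a ha
    (by rwa [eLpNorm_vec_unit])
  simp only [Complex.ofReal_one, one_mul] at hcol
  have hmax := e2 κ c hc hdis' G hG b hb hGb
  have hprod := eLpNorm_vec_mul_le h (by positivity)
    (f := fun k => ift ((Ioc (α k) (β k)).indicator F))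
    (g := fun x k => ift ((Ioc 0 (c k)).indicator G) x)
    (fun k => (continuous_ift (hFk k)).stronglyMeasurable)
    (continuous_pi fun k => continuous_ift (hGk k)) hcol hmax
  set H : κ → ℝ → ℂ := fun k => (Ioc (α k) (β k)).indicator F ⋆[ContinuousLinearMap.mul ℂ ℂ]
    (Ioc 0 (c k)).indicator G with hH
  have hHi : ∀ k, Integrable (H k) := fun k =>
    (hFk k).integrable_convolution (ContinuousLinearMap.mul ℂ ℂ) (hGk k)
  have hHe : ∀ k x, ift (H k) x =
      ift ((Ioc (α k) (β k)).indicator F) x * ift ((Ioc 0 (c k)).indicator G) x :=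
    fun k => ift_convolution (hFk k) (hGk k)
  have hHs : ∀ k, (Ioc (α k) (β k + c k)).indicator (H k) = H k := fun k => by
    simpa using indicator_convolution (F := F) (G := G) (α := α k) (β := β k) (γ := 0) (δ := c k)
  simp only [← hHe] at hprod ⊢
  have hrow := ((e3 κ α (fun k => β k + c k) y hy hα hβ hdis).2 H hHi).2 _ (by positivity) hprod
  simp only [Complex.ofReal_one, one_mul] at hrow
  rw [eLpNorm_vec_unit] at hrow
  refine (le_of_eq ?_).trans (hrow.trans_eq ?_)
  · congr 1
    ext x
    have : (fun ξ => ∑ k, (Ioc (α k) (β k + c k)).indicator (fun ξ => H k ξ) ξ) =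
        fun ξ => ∑ k, H k ξ := funext fun ξ => Finset.sum_congr rfl fun k _ => congrFun (hHs k) ξ
    rw [this, ift_finset_sum _ hHi]
  · congr 1; ring

end PoissonLP

namespace PoissonLP
open Filter Topology

/-- First coordinates of the lacunary points on the conjugate hyperbola. -/
noncomputable def hypA (j : ℕ) : ℝ := 1 / Real.sqrt (4 ^ (j + 1) - 1)

/-- Second coordinates of the lacunary points on the conjugate hyperbola. -/
noncomputable def hypB (j : ℕ) : ℝ := Real.sqrt (1 + hypA j ^ 2)

lemma four_pow_succ_sub_one_pos (j : ℕ) : (0 : ℝ) < 4 ^ (j + 1) - 1 :=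
  sub_pos.2 (one_lt_pow₀ (by norm_num) (by omega))

lemma hypA_pos (j : ℕ) : 0 < hypA j :=
  one_div_pos.2 (Real.sqrt_pos.2 (four_pow_succ_sub_one_pos j))

lemma sq_hypA (j : ℕ) : hypA j ^ 2 = 1 / (4 ^ (j + 1) - 1) := by
  rw [hypA, div_pow, Real.sq_sqrt (four_pow_succ_sub_one_pos j).le, one_pow]

lemma two_pow_mul_hypA_le (j : ℕ) : 2 ^ j * hypA j ≤ 1 := by
  have h := hypA_pos j
  have h1 := four_pow_succ_sub_one_pos j
  have h4 : (1 : ℝ) ≤ 4 ^ j := one_le_pow₀ (by norm_num)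
  refine (sq_le_one_iff₀ (by positivity)).1 ?_
  rw [mul_pow, sq_hypA, ← pow_mul, mul_comm j 2, pow_mul, mul_one_div, div_le_one h1]
  have h5 : (4 : ℝ) ^ (j + 1) = 4 ^ j * 4 := pow_succ 4 j
  norm_num
  linarith

lemma one_le_two_pow_mul_hypA (j : ℕ) : 1 ≤ 2 ^ (j + 1) * hypA j := by
  have h := hypA_pos j
  have h1 := four_pow_succ_sub_one_pos j
  refine (one_le_sq_iff₀ (by positivity)).1 ?_
  rw [mul_pow, sq_hypA, ← pow_mul, mul_comm (j + 1) 2, pow_mul, mul_one_div, one_le_div h1]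
  norm_num

lemma hypA_le_one (j : ℕ) : hypA j ≤ 1 :=
  (le_mul_of_one_le_left (hypA_pos j).le (one_le_pow₀ one_le_two)).trans (two_pow_mul_hypA_le j)

lemma sq_hypA_succ_le (j : ℕ) : 4 * hypA (j + 1) ^ 2 ≤ hypA j ^ 2 := by
  have h1 := four_pow_succ_sub_one_pos j
  rw [sq_hypA, sq_hypA, mul_one_div, div_le_div_iff₀ (four_pow_succ_sub_one_pos _) h1,
    pow_succ 4 (j + 1)]
  linarith

lemma two_mul_hypA_succ_le (j : ℕ) : 2 * hypA (j + 1) ≤ hypA j := by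
  refine (sq_le_sq₀ (by have := hypA_pos (j + 1); positivity) (hypA_pos j).le).1 ?_
  rw [mul_pow]
  linarith [sq_hypA_succ_le j]

lemma antitone_hypA : Antitone hypA :=
  antitone_nat_of_succ_le fun j => by linarith [two_mul_hypA_succ_le j, hypA_pos (j + 1)]

lemma antitone_hypB : Antitone hypB := fun j k h => by
  refine Real.sqrt_le_sqrt ?_
  gcongr
  · exact (hypA_pos k).le
  · exact antitone_hypA h

lemma one_lt_hypB (j : ℕ) : 1 < hypB j := by
  rw [hypB, Real.lt_sqrt zero_le_one]
  have := hypA_pos j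
  nlinarith

lemma sq_hypB (j : ℕ) : hypB j ^ 2 = 1 + hypA j ^ 2 := Real.sq_sqrt (by positivity)

lemma hypB_sub_one_le (j : ℕ) : hypB j - 1 ≤ hypA j / 2 := by
  nlinarith [sq_hypB j, one_lt_hypB j, hypA_pos j, hypA_le_one j]

lemma two_mul_hypB_succ_sub_one_le (j : ℕ) : 2 * (hypB (j + 1) - 1) ≤ hypB j - 1 := by
  have h1 := one_lt_hypB (j + 1)
  have : 2 * hypB (j + 1) - 1 ≤ hypB j := by
    refine (sq_le_sq₀ (by linarith) (by linarith [one_lt_hypB j])).1 ?_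
    nlinarith [sq_hypB j, sq_hypB (j + 1), sq_hypA_succ_le j]
  linarith

lemma pairwise_disjoint_Ioc_two_mul {y : ℕ → ℝ} (hy0 : ∀ j, 0 ≤ y j)
    (hy : ∀ j, 2 * y j ≤ y (j + 1)) :
    Pairwise (Function.onFun Disjoint fun j => Ioc (y j) (2 * y j)) := by
  have hmono : Monotone y := monotone_nat_of_le_succ fun j => by linarith [hy j, hy0 j]
  refine (symm_disjoint.comap _).pairwise_on _ |>.2 fun i j hij => ?_
  refine disjoint_left.2 fun t hi hj => ?_
  linarith [hi.2, hj.1, hy i, hmono (Nat.succ_le_of_lt hij)]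

lemma disjoint_Jab {j k : ℕ} (h : j + 2 ≤ k) :
    Disjoint (Jab hypA hypB 1 j) (Jab hypA hypB 1 k) := by
  refine disjoint_left.2 ?_
  rintro _ ⟨u, hu, v, hv, rfl⟩ ⟨u', hu', v', hv', e⟩
  have h1 := antitone_hypA h
  have h2 := antitone_hypB h
  have h3 := two_mul_hypA_succ_le (j + 1)
  have h4 := hypB_sub_one_le (j + 2)
  have h5 := hypA_pos (j + 2)
  dsimp only at e
  have e1 := hu.1
  have e2 := hv.1
  have e3 := hu'.2
  have e4 := hv'.2
  rw [show j + 1 + 1 = j + 2 by ring] at h3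
  linarith

theorem exists_partition_Jab : ∃ σ : ℕ → Fin 2, ∀ j k : ℕ, j ≠ k → σ j = σ k →
    Disjoint (Jab hypA hypB 1 j) (Jab hypA hypB 1 k) := by
  refine ⟨fun j => Fin.ofNat 2 j, fun j k hjk h => ?_⟩
  have h' : j % 2 = k % 2 := congrArg Fin.val h
  rcases lt_or_gt_of_ne hjk with hlt | hlt
  · exact disjoint_Jab (by omega)
  · exact (disjoint_Jab (by omega)).symm

end PoissonLP

namespace PoissonLP
open Filter Topology

lemma ift_indicator_Ico (F : ℝ → ℂ) (α β : ℝ) :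
    ift ((Ico α β).indicator F) = ift ((Ioc α β).indicator F) := by
  ext x
  refine integral_congr_ae ?_
  filter_upwards [indicator_ae_eq_of_ae_eq_set (f := F) (Ico_ae_eq_Ioc (a := α) (b := β))] with ξ hξ
  rw [hξ]

lemma Antitone.exists_notMem_Ico {a : ℕ → ℝ} (ha : Antitone a) (ξ : ℝ) :
    ∃ i, ∀ j ≠ i, ξ ∉ Ico (a (j + 2)) (a (j + 1)) := by
  by_cases h : ∃ i, ξ ∈ Ico (a (i + 2)) (a (i + 1))
  · obtain ⟨i, hi⟩ := h
    refine ⟨i, fun j hj hξ => ?_⟩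
    rcases lt_or_gt_of_ne hj with hlt | hlt
    · exact absurd (hi.2.trans_le (ha (by omega : j + 2 ≤ i + 1))) (not_lt.2 hξ.1)
    · exact absurd (hξ.2.trans_le (ha (by omega : i + 2 ≤ j + 1))) (not_lt.2 hi.1)
  · push Not at h
    exact ⟨0, fun j _ => h j⟩

/-- The paraproduct is the limit of its partial sums. -/
lemma tendsto_sum_ift_mul_ift {a : ℕ → ℝ} (ha : Antitone a) (b : ℕ → ℝ) {f g : ℝ → ℂ}
    (hF : Integrable (fourierT f)) (hG : Integrable (fourierT g)) (x : ℝ) :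
    Tendsto (fun N => ∑ j ∈ Finset.range N,
      ift ((Ioc (a (j + 2)) (a (j + 1))).indicator (fourierT f)) x *
      ift ((Ioc (b (j + 1)) (b 0)).indicator (fourierT g)) x) atTop
      (𝓝 (Bm (mab a b) f g x)) := by
  simp only [← ift_indicator_Ico]
  set F := fourierT f with hFdef
  set G := fourierT g with hGdef
  set P : ℕ → ℂ := fun j => ift ((Ico (b (j + 1)) (b 0)).indicator G) x with hP
  set W : ℕ → ℝ → ℂ := fun j ξ => (Ico (a (j + 2)) (a (j + 1))).indicator F ξ * eChar ξ x * P j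
    with hW
  have hWi : ∀ j, Integrable (W j) := fun j =>
    (Integrable.mul_eChar (hF.indicator measurableSet_Ico) x).mul_const _
  have hPle : ∀ j, ‖P j‖ ≤ ∫ η, ‖G η‖ := fun j => (norm_ift_le x).trans
    (integral_mono (hG.indicator measurableSet_Ico).norm hG.norm
      fun η => norm_indicator_le_norm_self _ _)
  have hG0 : 0 ≤ ∫ η, ‖G η‖ := integral_nonneg fun η => norm_nonneg _
  have hsum : ∀ N, ∑ j ∈ Finset.range N, ift ((Ico (a (j + 2)) (a (j + 1))).indicator F) x * P j =
      ∫ ξ, ∑ j ∈ Finset.range N, W j ξ := fun N => by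
    rw [integral_finsetSum _ fun j _ => hWi j]
    exact Finset.sum_congr rfl fun j _ => (integral_mul_const _ _).symm
  refine Tendsto.congr (fun N => (hsum N).symm) ?_
  refine tendsto_integral_of_dominated_convergence (fun ξ => ‖F ξ‖ * ∫ η, ‖G η‖)
    (fun N => (integrable_finsetSum _ fun j _ => hWi j).1) (hF.norm.mul_const _) ?_ ?_
  · refine fun N => ae_of_all _ fun ξ => ?_
    obtain ⟨i, hi⟩ := Antitone.exists_notMem_Ico ha ξ
    have h0 : ∀ j ≠ i, W j ξ = 0 := fun j hj => by simp [hW, indicator_of_notMem (hi j hj)]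
    by_cases hN : i ∈ Finset.range N
    · rw [Finset.sum_eq_single_of_mem i hN fun j _ => h0 j, norm_mul, norm_mul, norm_eChar, mul_one]
      exact mul_le_mul (norm_indicator_le_norm_self _ _) (hPle i) (norm_nonneg _) (norm_nonneg _)
    · rw [Finset.sum_eq_zero fun j hj => h0 j fun h => hN (h ▸ hj), norm_zero]
      positivity
  · refine ae_of_all _ fun ξ => ?_
    obtain ⟨i, hi⟩ := Antitone.exists_notMem_Ico ha ξ
    have h0 : ∀ j ≠ i, W j ξ = 0 := fun j hj => by simp [hW, indicator_of_notMem (hi j hj)]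
    have hlim : ∫ η, mab a b ξ η * F ξ * G η * eChar (ξ + η) x = W i ξ := by
      simp only [hW, hP, ift]
      rw [← integral_const_mul]
      refine integral_congr_ae (ae_of_all _ fun η => ?_)
      dsimp only
      rw [mab, tsum_eq_single i fun j hj => by simp [indC, indicator_of_notMem (hi j hj)],
        eChar_add]
      by_cases h1 : ξ ∈ Ico (a (i + 2)) (a (i + 1)) <;> by_cases h2 : η ∈ Ico (b (i + 1)) (b 0) <;>
        simp only [indC, indicator_of_mem, indicator_of_notMem, h1, h2, not_false_eq_true,
          Pi.one_apply] <;> ring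
    rw [hlim]
    refine tendsto_const_nhds.congr' ?_
    filter_upwards [eventually_gt_atTop i] with N hN
    exact (Finset.sum_eq_single_of_mem i (Finset.mem_range.2 hN) fun j _ => h0 j).symm

end PoissonLP

namespace PoissonLP
open Filter Topology

lemma ift_indicator_Ioc_add {F : ℝ → ℂ} (hF : Integrable F) {α β γ : ℝ} (h1 : α ≤ β) (h2 : β ≤ γ)
    (x : ℝ) : ift ((Ioc α β).indicator F) x + ift ((Ioc β γ).indicator F) x =
      ift ((Ioc α γ).indicator F) x := by
  rw [ift, ift, ift, ← integral_add
    (Integrable.mul_eChar (hF.indicator measurableSet_Ioc) x)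
    (Integrable.mul_eChar (hF.indicator measurableSet_Ioc) x), ← Ioc_union_Ioc_eq_Ioc h1 h2]
  refine integral_congr_ae (ae_of_all _ fun ξ => ?_)
  rw [indicator_union_of_disjoint (Ioc_disjoint_Ioc_of_le le_rfl)]
  exact (add_mul _ _ _).symm

lemma sum_ift_indicator_Ioc {F : ℝ → ℂ} (hF : Integrable F) {a : ℕ → ℝ} (ha : Antitone a) (N : ℕ)
    (x : ℝ) : ∑ j ∈ Finset.range N, ift ((Ioc (a (j + 1)) (a j)).indicator F) x =
      ift ((Ioc (a N) (a 0)).indicator F) x := by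
  induction N with
  | zero => simp [ift]
  | succ N ih =>
    rw [Finset.sum_range_succ, ih, add_comm,
      ift_indicator_Ioc_add hF (ha N.le_succ) (ha N.zero_le)]

/-- The partial sums of the paraproduct, split into a product of two frequency truncations and a
lacunary remainder. -/
lemma sum_ift_mul_ift {F G : ℝ → ℂ} (hF : Integrable F) (hG : Integrable G) {a b : ℕ → ℝ} {c : ℝ}
    (ha : Antitone a) (hb : Antitone b) (hc : ∀ j, c ≤ b j) (N : ℕ) (x : ℝ) :
    ∑ j ∈ Finset.range N, ift ((Ioc (a (j + 2)) (a (j + 1))).indicator F) x *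
        ift ((Ioc (b (j + 1)) (b 0)).indicator G) x =
      ift ((Ioc (a (N + 1)) (a 1)).indicator F) x * ift ((Ioc c (b 0)).indicator G) x -
        eChar c x * ∑ k : Fin N, ift ((Ioc (a (k + 2)) (a (k + 1))).indicator F) x *
          ift ((Ioc 0 (b (k + 1) - c)).indicator fun η => G (η + c)) x := by
  rw [← sum_ift_indicator_Ioc hF (a := fun j => a (j + 1)) (fun i j h => ha (by omega)) N x,
    Finset.sum_mul, Finset.sum_range, Finset.sum_range, Finset.mul_sum, ← Finset.sum_sub_distrib]
  refine Finset.sum_congr rfl fun k _ => ?_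
  have e1 := ift_indicator_Ioc_add hG (hc (k + 1)) (hb (Nat.zero_le (k + 1))) x
  have e2 : ((Ioc 0 (b (k + 1) - c)).indicator fun η => G (η + c)) =
      fun η => (Ioc c (b (k + 1))).indicator G (η + c) := by
    ext η
    simp only [indicator, mem_Ioc, lt_add_iff_pos_left, le_sub_iff_add_le]
  rw [e2, ift_shift, ← e1]
  linear_combination (ift ((Ioc (a (k + 2)) (a (k + 1))).indicator F) x *
    ift ((Ioc c (b (k + 1))).indicator G) x) * eChar_neg_mul c x

lemma exists_eLpNorm_truncation_mul_le {p1 p2 r q1 q2 : ℝ} (h1 : p1.HolderConjugate q1)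
    (h2 : p2.HolderConjugate q2) (h : p1.HolderTriple p2 r) :
    ∃ C : ℝ, 0 < C ∧ ∀ α β γ δ : ℝ, ∀ F G : ℝ → ℂ, Integrable F → Integrable G →
      ∀ a b, 0 < a → 0 < b →
      eLpNorm (ift F) (ENNReal.ofReal p1) volume ≤ ENNReal.ofReal a →
      eLpNorm (ift G) (ENNReal.ofReal p2) volume ≤ ENNReal.ofReal b →
      eLpNorm (fun x => ift ((Ioc α β).indicator F) x * ift ((Ioc γ δ).indicator G) x)
        (ENNReal.ofReal r) volume ≤ ENNReal.ofReal (C * (a * b)) := by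
  obtain ⟨C1, hC1, e1⟩ := exists_mb_Ioc h1
  obtain ⟨C2, hC2, e2⟩ := exists_mb_Ioc h2
  refine ⟨C1 * C2, by positivity, ?_⟩
  intro α β γ δ F G hF hG a b ha hb hFa hGb
  have k1 := (e1 Unit (fun _ => α) (fun _ => β) (fun _ => F) fun _ => hF).2 a ha
    (by rwa [eLpNorm_vec_unit])
  have k2 := (e2 Unit (fun _ => γ) (fun _ => δ) (fun _ => G) fun _ => hG).2 b hb
    (by rwa [eLpNorm_vec_unit])
  rw [eLpNorm_vec_unit] at k2
  have key := eLpNorm_vec_mul_le h (by positivity)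
    (f := fun _ : Unit => ift ((Ioc α β).indicator F))
    (g := fun x _ => ift ((Ioc γ δ).indicator G) x)
    (fun _ => (continuous_ift (hF.indicator measurableSet_Ioc)).stronglyMeasurable)
    (continuous_pi fun _ => continuous_ift (hG.indicator measurableSet_Ioc)) k1
    ((eLpNorm_congr_norm_ae (ae_of_all _ fun x => pi_norm_const _)).trans_le k2)
  rw [eLpNorm_vec_unit] at key
  refine key.trans_eq ?_
  congr 1; ring

lemma eLpNorm_eChar_mul (c : ℝ) (f : ℝ → ℂ) (p : ℝ≥0∞) :
    eLpNorm (fun x => eChar c x * f x) p volume = eLpNorm f p volume :=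
  eLpNorm_congr_norm_ae (ae_of_all _ fun x => by rw [norm_mul, norm_eChar, one_mul])

theorem exists_paraproduct_bound {p1 p2 r q1 q2 q3 : ℝ} (h1 : p1.HolderConjugate q1)
    (h2 : p2.HolderConjugate q2) (h3 : r.HolderConjugate q3) (h : p1.HolderTriple p2 r) :
    ∃ C : ℝ, 0 < C ∧ ∀ f g : ℝ → ℂ, Integrable (fourierT f) → Integrable (fourierT g) →
      ∀ a b, 0 < a → 0 < b →
      eLpNorm (ift (fourierT f)) (ENNReal.ofReal p1) volume ≤ ENNReal.ofReal a →
      eLpNorm (ift (fourierT g)) (ENNReal.ofReal p2) volume ≤ ENNReal.ofReal b →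
      eLpNorm (Bm (mab hypA hypB) f g) (ENNReal.ofReal r) volume ≤
        ENNReal.ofReal (C * (a * b)) := by
  obtain ⟨C1, hC1, e1⟩ := exists_eLpNorm_truncation_mul_le h1 h2 h
  obtain ⟨C2, hC2, e2⟩ := exists_bilinear_lacunary h1 h2 h3 h
  refine ⟨C1 + C2, by positivity, ?_⟩
  intro f g hF hG a b ha hb hFa hGb
  have hc : ∀ j, 0 < hypB j - 1 := fun j => sub_pos.2 (one_lt_hypB j)
  have hdis : Pairwise (Function.onFun Disjoint fun j : ℕ => Ioc ((2 : ℝ) ^ j) (2 * 2 ^ j)) :=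
    pairwise_disjoint_Ioc_two_mul (fun j => by positivity) fun j => (pow_succ' 2 j).ge
  have hdis' : Pairwise (Function.onFun Disjoint fun j : ℕ =>
      Ioc (1 / (hypB j - 1)) (2 * (1 / (hypB j - 1)))) :=
    pairwise_disjoint_Ioc_two_mul (fun j => by have := hc j; positivity) fun j => by
      rw [mul_one_div, div_le_div_iff₀ (hc j) (hc (j + 1)), one_mul]
      exact two_mul_hypB_succ_sub_one_le j
  have hinj : ∀ N, Function.Injective fun k : Fin N => (k : ℕ) + 1 := fun N i j hij =>
    Fin.ext (by simpa using hij)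
  have hFi : ∀ α β, Integrable ((Ioc α β).indicator (fourierT f)) := fun α β =>
    hF.indicator measurableSet_Ioc
  have hGi : ∀ α β, Integrable ((Ioc α β).indicator (fourierT g)) := fun α β =>
    hG.indicator measurableSet_Ioc
  have hGs : ∀ α β, Integrable ((Ioc α β).indicator fun η => fourierT g (η + 1)) := fun α β =>
    (hG.comp_add_right 1).indicator measurableSet_Ioc
  have hGb' : eLpNorm (ift fun η => fourierT g (η + 1)) (ENNReal.ofReal p2) volume ≤
      ENNReal.ofReal b :=
    (eLpNorm_congr_norm_ae (ae_of_all _ (norm_ift_shift _ 1))).trans_le hGb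
  refine (Lp.eLpNorm_lim_le_liminf_eLpNorm (fun N => ?_) _
    (ae_of_all _ (tendsto_sum_ift_mul_ift antitone_hypA hypB hF hG))).trans
    (liminf_le_of_frequently_le' (Eventually.of_forall fun N => ?_).frequently)
  · exact (continuous_finsetSum _ fun j _ =>
      (continuous_ift (hFi _ _)).mul (continuous_ift (hGi _ _))).aestronglyMeasurable
  · have k1 := e1 (hypA (N + 1)) (hypA 1) 1 (hypB 0) _ _ hF hG a b ha hb hFa hGb
    have k2 := e2 (Fin N) (fun k => hypA (k + 2)) (fun k => hypA (k + 1))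
      (fun k => hypB (k + 1) - 1) (fun k => 2 ^ ((k : ℕ) + 1)) (fun k => by positivity)
      (fun k => hc _)
      (fun k => by
        have := one_le_two_pow_mul_hypA ((k : ℕ) + 2)
        rw [pow_succ, pow_succ] at this
        linarith)
      (fun k => by
        have h1 := two_pow_mul_hypA_le ((k : ℕ) + 1)
        have h2 := mul_le_mul_of_nonneg_left (hypB_sub_one_le ((k : ℕ) + 1))
          (by positivity : (0 : ℝ) ≤ 2 ^ ((k : ℕ) + 1))
        rw [mul_add]
        linarith)
      (hdis.comp_of_injective (hinj N)) (hdis'.comp_of_injective (hinj N))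
      _ _ hF (hG.comp_add_right 1) a b ha hb hFa hGb'
    simp only [sum_ift_mul_ift hF hG antitone_hypA antitone_hypB fun j => (one_lt_hypB j).le]
    rw [add_mul, ENNReal.ofReal_add (by positivity) (by positivity)]
    refine (eLpNorm_sub_le ?_ ?_ (ENNReal.one_le_ofReal.2 h3.lt.le)).trans
      (add_le_add k1 ((eLpNorm_eChar_mul _ _ _).trans_le k2))
    · exact ((continuous_ift (hFi _ _)).mul (continuous_ift (hGi _ _))).aestronglyMeasurable
    · exact ((continuous_eChar_right 1).mul (continuous_finsetSum _ fun k _ =>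
        (continuous_ift (hFi _ _)).mul (continuous_ift (hGs _ _)))).aestronglyMeasurable

open scoped FourierTransform in
lemma integrable_fourierT (f : SchwartzMap ℝ ℂ) : Integrable (fourierT f) := by
  rw [fourierT_eq_fourier, ← SchwartzMap.fourier_coe]
  exact (𝓕 f).integrable

lemma ift_fourierT (f : SchwartzMap ℝ ℂ) : ift (fourierT f) = f := by
  have := integrable_fourierT f
  rw [fourierT_eq_fourier] at this ⊢
  rw [ift_eq_fourierInv]
  exact f.continuous.fourierInv_fourier_eq f.integrable this

lemma le_ofReal_mul_of_forall_pos {L A B : ℝ≥0∞} {C : ℝ} (hC : 0 ≤ C) (hA : A ≠ ∞) (hB : B ≠ ∞)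
    (h : ∀ a b : ℝ, 0 < a → 0 < b → A ≤ ENNReal.ofReal a → B ≤ ENNReal.ofReal b →
      L ≤ ENNReal.ofReal (C * (a * b))) : L ≤ ENNReal.ofReal C * A * B := by
  have hlim : Tendsto (fun ε : ℝ => ENNReal.ofReal (C * ((A.toReal + ε) * (B.toReal + ε))))
      (𝓝[>] 0) (𝓝 (ENNReal.ofReal (C * ((A.toReal + 0) * (B.toReal + 0))))) :=
    ((ENNReal.continuous_ofReal.comp (by fun_prop)).tendsto 0).mono_left nhdsWithin_le_nhds
  rw [add_zero, add_zero, ENNReal.ofReal_mul hC, ENNReal.ofReal_mul ENNReal.toReal_nonneg,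
    ENNReal.ofReal_toReal hA, ENNReal.ofReal_toReal hB, ← mul_assoc] at hlim
  refine ge_of_tendsto hlim ?_
  filter_upwards [self_mem_nhdsWithin] with ε (hε : 0 < ε)
  refine h _ _ (add_pos_of_nonneg_of_pos ENNReal.toReal_nonneg hε)
    (add_pos_of_nonneg_of_pos ENNReal.toReal_nonneg hε) ?_ ?_
  · exact (ENNReal.le_ofReal_iff_toReal_le hA (by positivity)).2 (by linarith)
  · exact (ENNReal.le_ofReal_iff_toReal_le hB (by positivity)).2 (by linarith)

theorem exists_paraproduct_schwartz_bound {p1 p2 r q1 q2 q3 : ℝ} (h1 : p1.HolderConjugate q1)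
    (h2 : p2.HolderConjugate q2) (h3 : r.HolderConjugate q3) (h : p1.HolderTriple p2 r) :
    ∃ C : ℝ, 0 < C ∧ ∀ f g : SchwartzMap ℝ ℂ,
      eLpNorm (Bm (mab hypA hypB) f g) (ENNReal.ofReal r) volume ≤
        ENNReal.ofReal C * eLpNorm f (ENNReal.ofReal p1) volume *
          eLpNorm g (ENNReal.ofReal p2) volume := by
  obtain ⟨C, hC, e⟩ := exists_paraproduct_bound h1 h2 h3 h
  refine ⟨C, hC, fun f g => ?_⟩
  have hf : eLpNorm f (ENNReal.ofReal p1) volume < ∞ := (f.memLp _ volume).2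
  have hg : eLpNorm g (ENNReal.ofReal p2) volume < ∞ := (g.memLp _ volume).2
  refine le_ofReal_mul_of_forall_pos hC.le hf.ne hg.ne fun a b ha hb hfa hgb => ?_
  rw [← ift_fourierT f] at hfa
  rw [← ift_fourierT g] at hgb
  exact e f g (integrable_fourierT f) (integrable_fourierT g) a b ha hb hfa hgb

end PoissonLP

/-- For `a_j = 1/√(4^{j+1}-1)` and `b_j = √(1+a_j²)` (points on the conjugate hyperbola
`η = √(1+ξ²)` with `b_j → 1`), the collection `{-[a_{j+1},a_j) - (1,b_j)}` splits into two
pairwise disjoint subcollections, and the associated paraproduct is bounded for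
`2 ≤ p₁, p₃ < ∞`, `1 < p₂ < ∞`, `1/p₁ + 1/p₂ + 1/p₃ = 1`. -/
theorem conjugate_hyperbola_paraproduct_bound (p1 p2 p3 : ℝ)
    (hp1 : 2 ≤ p1) (hp2 : 1 < p2) (hp3 : 2 ≤ p3)
    (hsum : 1 / p1 + 1 / p2 + 1 / p3 = 1) :
    (∃ σ : ℕ → Fin 2, ∀ j k : ℕ, j ≠ k → σ j = σ k →
      Disjoint
        (Jab (fun j => 1 / Real.sqrt (4 ^ (j + 1) - 1))
          (fun j => Real.sqrt (1 + (1 / Real.sqrt (4 ^ (j + 1) - 1)) ^ 2)) 1 j)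
        (Jab (fun j => 1 / Real.sqrt (4 ^ (j + 1) - 1))
          (fun j => Real.sqrt (1 + (1 / Real.sqrt (4 ^ (j + 1) - 1)) ^ 2)) 1 k)) ∧
    ∃ C : ℝ, 0 < C ∧
      ∀ f g : SchwartzMap ℝ ℂ,
        eLpNorm
            (Bm (mab (fun j => 1 / Real.sqrt (4 ^ (j + 1) - 1))
                (fun j => Real.sqrt (1 + (1 / Real.sqrt (4 ^ (j + 1) - 1)) ^ 2)))
              (⇑f) (⇑g))
            (ENNReal.ofReal (p3 / (p3 - 1))) volume ≤
          ENNReal.ofReal C * eLpNorm (⇑f) (ENNReal.ofReal p1) volume *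
            eLpNorm (⇑g) (ENNReal.ofReal p2) volume := by
  have h3 := (Real.HolderConjugate.conjExponent (p := p3) (by linarith)).symm
  refine ⟨PoissonLP.exists_partition_Jab, PoissonLP.exists_paraproduct_schwartz_bound
    (.conjExponent (by linarith)) (.conjExponent hp2) h3 ⟨?_, by linarith, by linarith⟩⟩
  have := h3.inv_add_inv_eq_inv
  rw [Real.conjExponent, inv_one] at this
  simp only [one_div] at hsum
  linarith
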